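/- arXiv:2503.10295 — 4 statements merged into one kernel-verified Lean document; each statement's English description precedes it below -/
import Mathlib

section
/- Let k ≥ 2 be an integer. Every 3k-strong quasi-transitive digraph D with δ⁺(D) ≥ 23k is k-linked. -/
/-- A simple digraph: an irreflexive adjacency relation (no loops, no parallel arcs). -/
structure Digr (V : Type) where
  Adj : V → V → Prop
  irrefl : ∀ v, ¬ Adj v v

namespace Digr

variable {V : Type}

/-- `p` is a directed path (as a list of distinct vertices) from `x` to `y`. -/
def IsPathFrom (G : Digr V) (p : List V) (x y : V) : Prop :=
  p.head? = some x ∧ p.getLast? = some y ∧ p.Chain' G.Adj ∧ p.Nodup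

/-- A path from `x` to `y` all of whose vertices lie in `A`. -/
def IsPathOn (G : Digr V) (A : Set V) (p : List V) (x y : V) : Prop :=
  G.IsPathFrom p x y ∧ ∀ v ∈ p, v ∈ A

/-- The digraph restricted to `A` is strongly connected. -/
def StronglyConnectedOn (G : Digr V) (A : Set V) : Prop :=
  ∀ x ∈ A, ∀ y ∈ A, x ≠ y → ∃ p, G.IsPathOn A p x y

/-- A digraph is strong if every ordered pair of distinct vertices is joined by a path. -/
def IsStrong (G : Digr V) : Prop :=
  ∀ x y : V, x ≠ y → ∃ p, G.IsPathFrom p x y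

/-- `G` is `k`-strong: at least `k+1` vertices, and deleting any at most `k-1`
vertices leaves a strongly connected digraph. -/
def KStrong [Fintype V] (G : Digr V) (k : ℕ) : Prop :=
  k + 1 ≤ Fintype.card V ∧
  ∀ S : Finset V, S.card ≤ k - 1 → G.StronglyConnectedOn ((↑S : Set V)ᶜ)

/-- `G` is `k`-linked. -/
def KLinked [Fintype V] (G : Digr V) (k : ℕ) : Prop :=
  2 * k ≤ Fintype.card V ∧
  ∀ x y : Fin k → V, Function.Injective (Sum.elim x y) →
    ∃ P : Fin k → List V,
      (∀ i, G.IsPathFrom (P i) (x i) (y i)) ∧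
      (∀ i j, i ≠ j → ∀ v, v ∈ P i → v ∉ P j)

/-- Semicomplete: at least one arc between any two distinct vertices. -/
def Semicomplete (G : Digr V) : Prop :=
  ∀ x y : V, x ≠ y → G.Adj x y ∨ G.Adj y x

/-- Out-degree of a vertex. -/
noncomputable def outDeg [Fintype V] (G : Digr V) (v : V) : ℕ :=
  Set.ncard {w | G.Adj v w}

/-- In-degree of a vertex. -/
noncomputable def inDeg [Fintype V] (G : Digr V) (v : V) : ℕ :=
  Set.ncard {w | G.Adj w v}

/-- `G` together with the surjection `φ : V → ι` realizes a composition `H[S₁,…,S_h]`: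
between distinct parts, the arcs of `G` are exactly those prescribed by `H`. -/
def IsCompositionOver {ι : Type} (G : Digr V) (H : Digr ι) (φ : V → ι) : Prop :=
  Function.Surjective φ ∧ ∀ u v : V, φ u ≠ φ v → (G.Adj u v ↔ H.Adj (φ u) (φ v))

end Digr

namespace Digr

/-- Quasi-transitive digraph: whenever xy and yz are arcs, x and z are adjacent. -/
def QuasiTransitive {V : Type} (G : Digr V) : Prop :=
  ∀ x y z : V, G.Adj x y → G.Adj y z → x ≠ z → (G.Adj x z ∨ G.Adj z x)

end Digr

namespace Linkage

open Relation

variable {V : Type}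

/-- The relation `E` restricted to the vertex set `S`. -/
def Within (E : V → V → Prop) (S : Set V) (u v : V) : Prop :=
  E u v ∧ u ∈ S ∧ v ∈ S

theorem Within.mono {E E' : V → V → Prop} {S S' : Set V} (hE : ∀ u v, E u v → E' u v)
    (hS : S ⊆ S') {u v : V} (h : Within E S u v) : Within E' S' u v :=
  ⟨hE _ _ h.1, hS h.2.1, hS h.2.2⟩

theorem reflTransGen_of_isChain {E : V → V → Prop} {S : Set V} {y : V} (p : List V) :
    ∀ x, p.head? = some x → p.getLast? = some y → p.IsChain E → (∀ v ∈ p, v ∈ S) →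
      ReflTransGen (Within E S) x y := by
  induction p with
  | nil => intro x hx; simp at hx
  | cons a l ih =>
    intro x hx hy hc hS
    obtain rfl : a = x := by simpa using hx
    cases l with
    | nil =>
      obtain rfl : a = y := by simpa using hy
      exact .refl
    | cons b l =>
      rw [List.isChain_cons_cons] at hc
      refine .head ⟨hc.1, hS _ (by simp), hS _ (by simp)⟩
        (ih b rfl (by simpa using hy) hc.2 fun v hv => hS v (List.mem_cons_of_mem _ hv))

theorem exists_nodup_of_reflTransGen {E : V → V → Prop} {S : Set V} {x y : V}
    (h : ReflTransGen (Within E S) x y) (hy : y ∈ S) :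
    ∃ p : List V, p.head? = some x ∧ p.getLast? = some y ∧ p.IsChain E ∧ p.Nodup ∧
      ∀ v ∈ p, v ∈ S := by
  induction h using ReflTransGen.head_induction_on with
  | refl => exact ⟨[y], by simp [hy]⟩
  | @head a c hac _ ih =>
    obtain ⟨p, hhead, hlast, hchain, hnodup, hS⟩ := ih
    by_cases hap : a ∈ p
    · obtain ⟨s, t, rfl⟩ := List.mem_iff_append.1 hap
      exact ⟨a :: t, rfl, by simpa using hlast, hchain.right_of_append,
        (List.nodup_append.1 hnodup).2.1, fun v hv => hS v (List.mem_append_right _ hv)⟩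
    · refine ⟨a :: p, rfl, ?_, ?_, List.nodup_cons.2 ⟨hap, hnodup⟩, ?_⟩
      · cases p with
        | nil => simp at hhead
        | cons b l => simpa using hlast
      · rw [List.isChain_cons]
        refine ⟨fun b hb => ?_, hchain⟩
        rw [hhead] at hb
        obtain rfl : c = b := by simpa using hb
        exact hac.1
      · intro v hv
        rcases List.mem_cons.1 hv with rfl | hv
        · exact hac.2.1
        · exact hS v hv

/-- A walk from outside `U` into `U` traverses an arc entering `U`. -/
theorem exists_entering_arc {r : V → V → Prop} {x y : V} (h : ReflTransGen r x y) (U : Set V)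
    (hx : x ∉ U) (hy : y ∈ U) : ∃ p q, r p q ∧ p ∉ U ∧ q ∈ U := by
  induction h using ReflTransGen.head_induction_on with
  | refl => exact absurd hy hx
  | @head a c hac _ ih =>
    by_cases hc : c ∈ U
    · exact ⟨a, c, hac, hx, hc⟩
    · exact ih hc

/-! ### Modules of quasi-transitive digraphs -/

/-- Adjacency in the complement of the underlying graph (reflexive when `E` is irreflexive). -/
def NonAdj (E : V → V → Prop) (u v : V) : Prop := ¬ E u v ∧ ¬ E v u

theorem NonAdj.symm {E : V → V → Prop} {u v : V} (h : NonAdj E u v) : NonAdj E v u :=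
  ⟨h.2, h.1⟩

/-- `u` and `v` lie in the same component of the complement of the underlying graph. -/
def CoConn (E : V → V → Prop) : V → V → Prop := ReflTransGen (NonAdj E)

theorem CoConn.symm {E : V → V → Prop} {u v : V} (h : CoConn E u v) : CoConn E v u := by
  induction h with
  | refl => exact .refl
  | tail _ hbc ih => exact .head hbc.symm ih

theorem CoConn.trans {E : V → V → Prop} {u v w : V} (h : CoConn E u v) (h' : CoConn E v w) :
    CoConn E u w := ReflTransGen.trans h h'

theorem adj_of_not_coConn {E : V → V → Prop} {u v : V} (h : ¬ CoConn E u v) : E u v ∨ E v u := by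
  by_contra hn
  exact h (.single ⟨fun h => hn (.inl h), fun h => hn (.inr h)⟩)

/-- Quasi-transitivity of a relation. -/
def QuasiTrans (E : V → V → Prop) : Prop :=
  ∀ x y z, E x y → E y z → x ≠ z → E x z ∨ E z x

theorem QuasiTrans.flip {E : V → V → Prop} (hE : QuasiTrans E) :
    QuasiTrans fun u v => E v u := fun x y z hxy hyz hne => hE z y x hyz hxy hne.symm |>.imp id id

theorem CoConn.flip {E : V → V → Prop} {u v : V} (h : CoConn E u v) :
    CoConn (fun u v => E v u) u v :=
  ReflTransGen.mono (fun _ _ h => ⟨h.2, h.1⟩) _ _ h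

/-- Co-connected classes are modules: out-arcs to other classes are shared. -/
theorem QuasiTrans.adj_of_coConn {E : V → V → Prop} (hE : QuasiTrans E) {u u' v : V}
    (huu' : CoConn E u u') (huv : ¬ CoConn E u v) (h : E u v) : E u' v := by
  induction huu' with
  | refl => exact h
  | @tail b c hub hbc ih =>
    have hcv : ¬ CoConn E c v := fun h' => huv ((CoConn.trans hub (.single hbc)).trans h')
    by_cases hne : b = c
    · exact hne ▸ ih
    · rcases adj_of_not_coConn hcv with h' | h'
      · exact h'
      · exact (hE b v c ih h' hne).elim (absurd · hbc.1) (absurd · hbc.2)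

/-- Co-connected classes are modules: in-arcs from other classes are shared. -/
theorem QuasiTrans.adj_of_coConn' {E : V → V → Prop} (hE : QuasiTrans E) {u u' v : V}
    (huu' : CoConn E u u') (huv : ¬ CoConn E u v) (h : E v u) : E v u' :=
  hE.flip.adj_of_coConn huu'.flip (fun hc => huv hc.flip) h

/-- There are no two-cycles between a nontrivial co-connected class and its complement. -/
theorem QuasiTrans.not_adj_of_adj {E : V → V → Prop} (hE : QuasiTrans E) {m m' v : V}
    (hmm' : CoConn E m m') (hne : m ≠ m') (hmv : ¬ CoConn E m v) (h : E m v) : ¬ E v m := by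
  intro h'
  obtain ⟨c, hmc, hnadj⟩ : ∃ c, m ≠ c ∧ NonAdj E m c := by
    clear h h' hmv
    induction hmm' using ReflTransGen.head_induction_on with
    | refl => exact absurd rfl hne
    | @head a c hac _ ih =>
      by_cases hc : a = c
      · subst hc; exact ih hne
      · exact ⟨c, hc, hac⟩
  have hcv := hE.adj_of_coConn (.single hnadj) hmv h
  exact (hE c v m hcv h' hmc.symm).elim hnadj.2 hnadj.1

/-- If `P` only leaves through `v` and `v` sends an arc to `b` outside `P`, where the set
`insert v P` has no closed subset contained in `P`, then `v` is adjacent to all of `P`. -/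
theorem QuasiTrans.not_nonAdj {E : V → V → Prop} (hE : QuasiTrans E) {P : Set V} {v b : V}
    (hvP : v ∉ P) (hbP : b ∉ P) (hvb : E v b) (hPb : ∀ p ∈ P, ¬ E p b)
    (hleave : ∀ U ⊆ P, U.Nonempty → ∃ p ∈ U, ∃ q ∈ insert v P, q ∉ U ∧ E p q) :
    ∀ u ∈ P, ¬ NonAdj E u v := by
  intro u hu huv
  have hne : ∀ p ∈ P, p ≠ v := fun p hp h => hvP (h ▸ hp)
  have hneb : ∀ p ∈ P, p ≠ b := fun p hp h => hbP (h ▸ hp)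
  have hbp : ∀ a, ∀ p ∈ P, E b a → E a p → E b p := fun a p hp h1 h2 =>
    (hE b a p h1 h2 (hneb p hp).symm).resolve_right (hPb p hp)
  have hnb : ∀ p ∈ P, NonAdj E p v → ¬ E b p := fun p hp h h' =>
    (hE v b p hvb h' (hne p hp).symm).elim h.2 h.1
  have hbA : ∀ a ∈ P, E a v → E b a := fun a ha h =>
    (hE a v b h hvb (hneb a ha)).resolve_left (hPb a ha)
  set U₀ : Set V := {p ∈ P | NonAdj E p v}
  set C : Set V := {c ∈ P | E v c ∧ ¬ E c v ∧ ∃ p ∈ U₀, E p c}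
  obtain ⟨p, hp, q, hq, hqU, hpq⟩ := hleave (U₀ ∪ C)
    (by rintro x (h | h) <;> exact h.1) ⟨u, .inl ⟨hu, huv⟩⟩
  simp only [Set.mem_union, not_or] at hqU
  rcases hq with rfl | hqP
  · rcases hp with hp | hp
    · exact hp.2.1 hpq
    · exact hp.2.2.1 hpq
  have hqv : E q v ∨ E v q := by
    by_contra h
    exact hqU.1 ⟨hqP, fun h' => h (.inl h'), fun h' => h (.inr h')⟩
  rcases hp with hp | ⟨hpP, hvp, hpv, w, hw, hwp⟩
  · by_cases hqv' : E q v
    · exact (hE p q v hpq hqv' (hne p hp.1)).elim hp.2.1 hp.2.2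
    · exact hqU.2 ⟨hqP, hqv.resolve_left hqv', hqv', p, hp, hpq⟩
  · have hwq : w ≠ q := by rintro rfl; exact hqU.1 hw
    by_cases hqv' : E q v
    · rcases hE w p q hwp hpq hwq with h | h
      · exact (hE w q v h hqv' (hne w hw.1)).elim hw.2.1 hw.2.2
      · exact hnb w hw.1 hw.2 (hbp q w hw.1 (hbA q hqP hqv') h)
    · have hvq := hqv.resolve_left hqv'
      rcases hE w p q hwp hpq hwq with h | h
      · exact hqU.2 ⟨hqP, hvq, hqv', w, hw, h⟩
      · exact (hE v q w hvq h (hne w hw.1).symm).elim hw.2.2 hw.2.1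

/-- The complement of the underlying graph of a strong quasi-transitive digraph with at least two
vertices is disconnected. -/
theorem QuasiTrans.exists_not_coConn [Finite V] {E : V → V → Prop} (hE : QuasiTrans E)
    {x₀ y₀ : V} (hne : x₀ ≠ y₀) (hstrong : ∀ x y, ReflTransGen E x y) :
    ∃ u v, ¬ CoConn E u v := by
  by_contra hcon
  push Not at hcon
  have hcross : ∀ A : Set V, A.Nonempty → A ≠ Set.univ → ∃ u ∈ A, ∃ v ∉ A, NonAdj E u v := by
    rintro A ⟨a, ha⟩ hA
    obtain ⟨c, hc⟩ := (Set.ne_univ_iff_exists_notMem A).1 hA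
    obtain ⟨p, q, hpq, hp, hq⟩ := exists_entering_arc (hcon c a) A hc ha
    exact ⟨q, hq, p, hp, hpq.symm⟩
  let Bad : Set (Set V) := {A | ∃ P R : Set V, P ∪ R = A ∧ Disjoint P R ∧ P.Nonempty ∧
    R.Nonempty ∧ ∀ p ∈ P, ∀ q ∈ R, ¬ E p q}
  have hbad : Bad.Nonempty := by
    obtain ⟨u, hu, v, hv, huv⟩ := hcross {x₀} ⟨x₀, rfl⟩
      (fun h => hne (by simpa using (Set.eq_univ_iff_forall.1 h y₀).symm))
    refine ⟨{u, v}, {u}, {v}, rfl, ?_, by simp, by simp, ?_⟩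
    · rw [Set.disjoint_singleton]; rintro rfl; exact hv hu
    · rintro p rfl q rfl; exact huv.1
  obtain ⟨A, hA⟩ := (Set.toFinite Bad).exists_maximal hbad
  obtain ⟨P, R, hPR, hdisj, hP, hR, hno⟩ := hA.prop
  have hAne : A ≠ Set.univ := by
    rintro rfl
    obtain ⟨p, hp⟩ := hP
    obtain ⟨q, hq⟩ := hR
    obtain ⟨a, b, hab, ha, hb⟩ := exists_entering_arc (hstrong p q) R
      (Set.disjoint_left.1 hdisj hp) hq
    have : a ∈ P ∪ R := hPR ▸ Set.mem_univ a
    exact hno a (this.resolve_right ha) b hb hab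
  obtain ⟨u, hu, v, hv, huv⟩ := hcross A (hPR ▸ hP.mono Set.subset_union_left) hAne
  have hvP : v ∉ P := fun h => hv (hPR ▸ .inl h)
  have hvR : v ∉ R := fun h => hv (hPR ▸ .inr h)
  have hleave : ∀ U ⊆ insert v A, U.Nonempty → U ≠ insert v A →
      ∃ p ∈ U, ∃ q ∈ insert v A, q ∉ U ∧ E p q := by
    intro U hUA hU hne
    by_contra hcl
    push Not at hcl
    have hmem : insert v A ∈ Bad := by
      refine ⟨U, insert v A \ U, Set.union_sdiff_cancel hUA, Set.disjoint_sdiff_right, hU,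
        Set.nonempty_of_ssubset (hUA.ssubset_of_ne hne), fun p hp q hq => hcl p hp q hq.1 hq.2⟩
    exact hv (hA.le_of_ge hmem (Set.subset_insert v A) (Set.mem_insert v A))
  obtain ⟨a, ha, hav⟩ : ∃ a ∈ P, E a v := by
    obtain ⟨p, hp, q, hq, hqP, hpq⟩ := hleave P
      (hPR ▸ Set.subset_union_left.trans (Set.subset_insert _ _)) hP
      (fun h => hvP (h ▸ Set.mem_insert v A))
    rcases hq with rfl | hq
    · exact ⟨p, hp, hpq⟩
    · rw [← hPR] at hq
      exact absurd hpq (hno p hp q (hq.resolve_left hqP))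
  obtain ⟨b, hb, hvb⟩ : ∃ b ∈ R, E v b := by
    obtain ⟨p, hp, q, hq, hqP, hpq⟩ := hleave (insert v P)
      (hPR ▸ Set.insert_subset_insert Set.subset_union_left) (Set.insert_nonempty _ _)
      (fun h => by
        obtain ⟨c, hc⟩ := hR
        have : c ∈ insert v P := h ▸ Set.mem_insert_of_mem v (hPR ▸ .inr hc)
        rcases this with rfl | h'
        · exact hvR hc
        · exact Set.disjoint_left.1 hdisj h' hc)
    have hqR : q ∈ R := by
      rcases hq with rfl | hq
      · exact absurd (Set.mem_insert _ _) hqP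
      · rw [← hPR] at hq
        exact hq.resolve_left fun h => hqP (.inr h)
    rcases hp with rfl | hp
    · exact ⟨q, hqR, hpq⟩
    · exact absurd hpq (hno p hp q hqR)
  rw [← hPR] at hu
  rcases hu with hu | hu
  · refine hE.not_nonAdj hvP (Set.disjoint_right.1 hdisj hb) hvb (fun p hp => hno p hp b hb) ?_
      u hu huv
    intro U hUP hU
    obtain ⟨p, hp, q, hq, hqU, hpq⟩ := hleave U
      (hUP.trans (hPR ▸ Set.subset_union_left.trans (Set.subset_insert _ _))) hU
      (fun h => hvP (hUP (h ▸ Set.mem_insert v A)))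
    refine ⟨p, hp, q, ?_, hqU, hpq⟩
    rcases hq with rfl | hq
    · exact .inl rfl
    · rw [← hPR] at hq
      exact .inr (hq.resolve_right fun h => hno p (hUP hp) q h hpq)
  · refine hE.flip.not_nonAdj hvR (Set.disjoint_left.1 hdisj ha) hav (fun p hp => hno a ha p hp) ?_
      u hu huv.symm
    intro U hUR hU
    obtain ⟨w, hw⟩ := hU
    obtain ⟨p, hp, q, hq, hqU, hpq⟩ := hleave (insert v A \ U) Set.sdiff_subset
      ⟨v, Set.mem_insert _ _, fun h => hvR (hUR h)⟩
      (fun h => by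
        have hwA : w ∈ insert v A := .inr (hPR ▸ .inr (hUR hw))
        exact ((Set.ext_iff.1 h w).2 hwA).2 hw)
    have hqR : q ∈ R := hUR (by by_contra h; exact hqU ⟨hq, h⟩)
    refine ⟨q, by by_contra h; exact hqU ⟨hq, h⟩, p, ?_, hp.2, hpq⟩
    rcases hp.1 with rfl | hp'
    · exact .inl rfl
    · rw [← hPR] at hp'
      exact .inr (hp'.resolve_left fun h => hno p h q hqR hpq)

/-! ### Disjoint paths -/

section Menger

variable [Fintype V] [DecidableEq V]

/-- Hall-type form of Menger's theorem for linking a set onto `Y` from `T`. -/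
theorem exists_disjoint_paths (r : V → V → Prop) [DecidableRel r] (T Y : Finset V)
    (hhall : ∀ U : Finset V, Disjoint U T →
      (U ∩ Y).card ≤ ((Finset.univ.filter fun p => ∃ q ∈ U, r p q) \ (U ∪ Y)).card) :
    ∃ P : V → List V,
      (∀ y ∈ Y, (∃ t ∈ T, (P y).head? = some t) ∧ (P y).getLast? = some y ∧ (P y).IsChain r) ∧
      ∀ y ∈ Y, ∀ y' ∈ Y, y ≠ y' → ∀ v ∈ P y, v ∉ P y' := by
  let N : {v // v ∉ T} → Finset V := fun v =>
    insert v.1 (Finset.univ.filter fun p => r p v.1) \ Y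
  obtain ⟨f, hfinj, hf⟩ := (Finset.all_card_le_biUnion_card_iff_exists_injective N).1 (by
    intro s
    set U : Finset V := s.map (Function.Embedding.subtype _) with hU
    have hUT : Disjoint U T := by
      rw [Finset.disjoint_left]
      intro v hv
      simp only [hU, Finset.mem_map] at hv
      obtain ⟨a, _, rfl⟩ := hv
      exact a.2
    have hsub : (U \ Y) ∪ ((Finset.univ.filter fun p => ∃ q ∈ U, r p q) \ (U ∪ Y)) ⊆
        s.biUnion N := by
      intro v hv
      simp only [Finset.mem_union, Finset.mem_sdiff, Finset.mem_filter, Finset.mem_univ,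
        true_and, hU, Finset.mem_map] at hv
      simp only [Finset.mem_biUnion, N, Finset.mem_sdiff, Finset.mem_insert, Finset.mem_filter,
        Finset.mem_univ, true_and]
      rcases hv with ⟨⟨a, ha, rfl⟩, hvY⟩ | ⟨⟨q, ⟨a, ha, rfl⟩, hq⟩, hvY⟩
      · exact ⟨a, ha, .inl rfl, hvY⟩
      · exact ⟨a, ha, .inr hq, fun h => hvY (.inr h)⟩
    have hd : Disjoint (U \ Y) ((Finset.univ.filter fun p => ∃ q ∈ U, r p q) \ (U ∪ Y)) := by
      rw [Finset.disjoint_left]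
      intro v hv hv'
      exact (Finset.mem_sdiff.1 hv').2 (Finset.mem_union_left _ (Finset.mem_sdiff.1 hv).1)
    have h1 := Finset.card_le_card hsub
    rw [Finset.card_union_of_disjoint hd] at h1
    have h2 := Finset.card_sdiff_add_card_inter U Y
    have h3 := hhall U hUT
    have h4 : U.card = s.card := Finset.card_map _
    omega)
  let g : V → V := fun v => if h : v ∉ T then f ⟨v, h⟩ else v
  have hgf : ∀ v (h : v ∉ T), g v = f ⟨v, h⟩ := fun v h => dif_pos h
  have hgY : ∀ v, v ∉ T → g v ∉ Y := fun v h => by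
    rw [hgf v h]; exact (Finset.mem_sdiff.1 (hf ⟨v, h⟩)).2
  have hgr : ∀ v, v ∉ T → g v ≠ v → r (g v) v := fun v h hne => by
    have := (Finset.mem_sdiff.1 (hf ⟨v, h⟩)).1
    rw [← hgf v h, Finset.mem_insert] at this
    simpa using this.resolve_left hne
  have hginj : ∀ u v, u ∉ T → v ∉ T → g u = g v → u = v := fun u v hu hv h => by
    rw [hgf u hu, hgf v hv] at h
    exact congrArg Subtype.val (hfinj h)
  have hcancel : ∀ a b y y', y ∈ Y → y' ∈ Y → (∀ i < a, g^[i] y ∉ T) → (∀ i < b, g^[i] y' ∉ T) →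
      g^[a] y = g^[b] y' → a = b ∧ y = y' := by
    intro a
    induction a with
    | zero =>
      intro b y y' hy _ _ hb h
      cases b with
      | zero => exact ⟨rfl, h⟩
      | succ b =>
        rw [Function.iterate_succ_apply'] at h
        exact absurd (h ▸ hy) (hgY _ (hb b b.lt_succ_self))
    | succ a ih =>
      intro b y y' hy hy' ha hb h
      cases b with
      | zero =>
        rw [Function.iterate_succ_apply'] at h
        exact absurd (h ▸ hy') (hgY _ (ha a a.lt_succ_self))
      | succ b =>
        rw [Function.iterate_succ_apply', Function.iterate_succ_apply'] at h
        obtain ⟨h1, h2⟩ := ih b y y' hy hy' (fun i hi => ha i (hi.trans a.lt_succ_self))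
          (fun i hi => hb i (hi.trans b.lt_succ_self))
          (hginj _ _ (ha a a.lt_succ_self) (hb b b.lt_succ_self) h)
        exact ⟨congrArg _ h1, h2⟩
  have hlist : ∀ y ∈ Y, ∀ n, (∀ i < n, g^[i] y ∉ T) → ∃ p : List V, p.head? = some (g^[n] y) ∧
      p.getLast? = some y ∧ p.IsChain r ∧ ∀ v ∈ p, ∃ i ≤ n, v = g^[i] y := by
    intro y hy n
    induction n with
    | zero =>
      exact fun _ => ⟨[y], rfl, rfl, .singleton y, fun v hv => ⟨0, le_rfl, by simpa using hv⟩⟩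
    | succ n ih =>
      intro hn
      have hn' : ∀ i < n, g^[i] y ∉ T := fun i hi => hn i (hi.trans n.lt_succ_self)
      obtain ⟨p, hhead, hlast, hchain, hmem⟩ := ih hn'
      refine ⟨g^[n + 1] y :: p, rfl, ?_, ?_, ?_⟩
      · cases p with
        | nil => simp at hhead
        | cons b l => simpa using hlast
      · rw [List.isChain_cons]
        refine ⟨fun b hb => ?_, hchain⟩
        rw [hhead] at hb
        obtain rfl : g^[n] y = b := by simpa using hb
        rw [Function.iterate_succ_apply']
        refine hgr _ (hn n n.lt_succ_self) fun h => ?_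
        have := (hcancel (n + 1) n y y hy hy hn hn' (by rwa [Function.iterate_succ_apply'])).1
        omega
      · intro v hv
        rcases List.mem_cons.1 hv with rfl | hv
        · exact ⟨n + 1, le_rfl, rfl⟩
        · obtain ⟨i, hi, rfl⟩ := hmem v hv
          exact ⟨i, hi.trans n.le_succ, rfl⟩
  have hreach : ∀ y ∈ Y, ∃ n, g^[n] y ∈ T ∧ ∀ i < n, g^[i] y ∉ T := by
    intro y hy
    have hex : ∃ n, g^[n] y ∈ T := by
      by_contra h
      push Not at h
      obtain ⟨a, b, hab, he⟩ := Finite.exists_ne_map_eq_of_infinite fun n => g^[n] y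
      exact hab (hcancel a b y y hy hy (fun i _ => h i) (fun i _ => h i) he).1
    exact ⟨Nat.find hex, Nat.find_spec hex, fun i hi => Nat.find_min hex hi⟩
  choose! n hnT hn using hreach
  have hex : ∀ y ∈ Y, ∃ p : List V, p.head? = some (g^[n y] y) ∧
      p.getLast? = some y ∧ p.IsChain r ∧ ∀ v ∈ p, ∃ i ≤ n y, v = g^[i] y :=
    fun y hy => hlist y hy (n y) (hn y hy)
  choose! P hP using hex
  refine ⟨P, fun y hy => ⟨⟨_, hnT y hy, (hP y hy).1⟩, (hP y hy).2.1, (hP y hy).2.2.1⟩, ?_⟩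
  intro y hy y' hy' hne v hv hv'
  obtain ⟨i, hi, rfl⟩ := (hP y hy).2.2.2 v hv
  obtain ⟨j, hj, hij⟩ := (hP y' hy').2.2.2 _ hv'
  exact hne (hcancel i j y y' hy hy' (fun l hl => hn y hy l (hl.trans_le hi))
    (fun l hl => hn y' hy' l (hl.trans_le hj)) hij).2

end Menger

/-! ### Counting lemmas -/

section Counting

variable [DecidableEq V]

/-- A finset has a subset of any smaller size maximizing a given function. -/
theorem exists_top_subset (s : Finset V) (f : V → ℕ) {m : ℕ} (hm : m ≤ s.card) :
    ∃ T ⊆ s, T.card = m ∧ ∀ t ∈ T, ∀ v ∈ s, v ∉ T → f v ≤ f t := by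
  induction m with
  | zero => exact ⟨∅, by simp⟩
  | succ m ih =>
    obtain ⟨T, hTs, hT, htop⟩ := ih (by omega)
    have hne : (s \ T).Nonempty := by
      rw [← Finset.card_pos, Finset.card_sdiff_of_subset hTs]
      omega
    obtain ⟨a, ha, hmax⟩ := Finset.exists_max_image _ f hne
    rw [Finset.mem_sdiff] at ha
    refine ⟨insert a T, Finset.insert_subset ha.1 hTs,
      by rw [Finset.card_insert_of_notMem ha.2, hT],
      fun t ht v hv hvT => ?_⟩
    rw [Finset.mem_insert, not_or] at hvT
    rcases Finset.mem_insert.1 ht with rfl | ht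
    · exact hmax v (Finset.mem_sdiff.2 ⟨hv, hvT.2⟩)
    · exact htop t ht v hv hvT.2

/-- Sets that are at least as large as the index type have distinct representatives. -/
theorem exists_injOn_of_card_le {ι : Type*} [Fintype ι] [Nonempty V] (p : ι → Prop)
    (C : ι → Finset V) (hC : ∀ i, p i → Fintype.card ι ≤ (C i).card) :
    ∃ f : ι → V, (∀ i, p i → f i ∈ C i) ∧ ∀ i j, p i → p j → f i = f j → i = j := by
  classical
  obtain ⟨f, hinj, hf⟩ := (Finset.all_card_le_biUnion_card_iff_exists_injective
    fun i : {i // p i} => C i).1 fun s => by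
      rcases s.eq_empty_or_nonempty with rfl | ⟨i, hi⟩
      · simp
      · exact s.card_le_univ.trans <| (Fintype.card_subtype_le p).trans <| (hC i i.2).trans
          (Finset.card_le_card (Finset.subset_biUnion_of_mem (fun i : {i // p i} => C i) hi))
  refine ⟨fun i => if h : p i then f ⟨i, h⟩ else Classical.arbitrary V, fun i hi => ?_,
    fun i j hi hj h => ?_⟩
  · simpa [hi] using hf ⟨i, hi⟩
  · simp only [hi, hj, dif_pos] at h
    exact congrArg Subtype.val (hinj h)

/-- Greedy choice of pairwise disjoint sets of size at most `m`. -/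
theorem exists_pairwise_disjoint_of_step {k m : ℕ} (p : Fin k → Finset V → Prop)
    (hstep : ∀ i, ∀ F : Finset V, F.card ≤ m * (k - 1) → ∃ M, M.card ≤ m ∧ Disjoint M F ∧ p i M) :
    ∃ M : Fin k → Finset V, (∀ i j, i ≠ j → Disjoint (M i) (M j)) ∧ ∀ i, p i (M i) := by
  have key : ∀ J : Finset (Fin k), ∃ M : Fin k → Finset V, (∀ i ∈ J, (M i).card ≤ m ∧ p i (M i)) ∧
      ∀ i ∈ J, ∀ j ∈ J, i ≠ j → Disjoint (M i) (M j) := by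
    intro J
    induction J using Finset.induction_on with
    | empty => exact ⟨fun _ => ∅, by simp, by simp⟩
    | @insert a J haJ ih =>
      obtain ⟨M, hM, hdisj⟩ := ih
      have hJ : J.card ≤ k - 1 := by
        have := Finset.card_le_univ (insert a J)
        rw [Finset.card_insert_of_notMem haJ, Fintype.card_fin] at this
        omega
      obtain ⟨A, hA, hAF, hpA⟩ := hstep a (J.biUnion M)
        ((Finset.card_biUnion_le_card_mul J M m fun i hi => (hM i hi).1).trans (by
          rw [mul_comm]; exact Nat.mul_le_mul_left m hJ))
      have hne : ∀ i ∈ J, i ≠ a := fun i hi h => haJ (h ▸ hi)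
      have hAM : ∀ i ∈ J, Disjoint A (M i) := fun i hi =>
        hAF.mono_right (Finset.subset_biUnion_of_mem M hi)
      refine ⟨Function.update M a A, fun i hi => ?_, fun i hi j hj hij => ?_⟩
      · rcases Finset.mem_insert.1 hi with rfl | hi
        · simpa using ⟨hA, hpA⟩
        · simpa [hne i hi] using hM i hi
      · rcases Finset.mem_insert.1 hi with hia | hi' <;>
          rcases Finset.mem_insert.1 hj with hja | hj'
        · exact absurd (hia.trans hja.symm) hij
        · simpa [hia, hne j hj'] using hAM j hj'
        · simpa [hja, hne i hi'] using (hAM i hi').symm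
        · simpa [hne i hi', hne j hj'] using hdisj i hi' j hj' hij
  obtain ⟨M, hM, hdisj⟩ := key Finset.univ
  exact ⟨M, fun i j => hdisj i (Finset.mem_univ i) j (Finset.mem_univ j),
    fun i => (hM i (Finset.mem_univ i)).2⟩

/-- In a semicomplete digraph some vertex has at least half of the others as in-neighbours. -/
theorem exists_large_inDeg (E : V → V → Prop) [DecidableRel E] (B : Finset V) (hB : B.Nonempty)
    (hsemi : ∀ u ∈ B, ∀ v ∈ B, u ≠ v → E u v ∨ E v u) :
    ∃ b ∈ B, B.card ≤ 2 * (B.filter fun u => E u b).card + 1 := by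
  by_contra! h
  have h1 : ∑ b ∈ B, (B.filter fun u => E b u).card = ∑ b ∈ B, (B.filter fun u => E u b).card :=
    Finset.sum_card_bipartiteAbove_eq_sum_card_bipartiteBelow E
  have h2 : ∀ b ∈ B, B.card ≤
      (B.filter fun u => E b u).card + (B.filter fun u => E u b).card + 1 := by
    intro b hb
    have hsub : B.erase b ⊆ (B.filter fun u => E b u) ∪ (B.filter fun u => E u b) := by
      intro u hu
      rw [Finset.mem_erase] at hu
      rw [Finset.mem_union, Finset.mem_filter, Finset.mem_filter]
      exact (hsemi b hb u hu.2 hu.1.symm).imp (⟨hu.2, ·⟩) (⟨hu.2, ·⟩)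
    have := (Finset.card_le_card hsub).trans (Finset.card_union_le _ _)
    rw [Finset.card_erase_of_mem hb] at this
    omega
  have h3 : ∑ b ∈ B, (2 * (B.filter fun u => E u b).card + 1) < ∑ _b ∈ B, B.card :=
    Finset.sum_lt_sum_of_nonempty hB h
  have h4 := Finset.sum_le_sum h2
  simp only [Finset.sum_add_distrib, ← Finset.mul_sum] at h3 h4
  omega

end Counting


/-! ### Short disjoint paths -/

section ShortPaths

variable {k : ℕ}

/-- `P` is a family of pairwise disjoint paths from `T` to the vertices `y j`, avoiding `F`. -/
structure IsPathSystem (E : V → V → Prop) (T F : Finset V) (y : Fin k → V)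
    (P : Fin k → List V) : Prop where
  head : ∀ j, ∃ t ∈ T, (P j).head? = some t
  last : ∀ j, (P j).getLast? = some (y j)
  chain : ∀ j, (P j).IsChain E
  avoid : ∀ j, ∀ v ∈ P j, v ∉ F
  disj : ∀ i j, i ≠ j → ∀ v ∈ P i, v ∉ P j

theorem forall_mem_of_isChain_within {E : V → V → Prop} {S : Set V} {y : V} (hy : y ∈ S) :
    ∀ p : List V, p.getLast? = some y → p.IsChain (Within E S) → ∀ v ∈ p, v ∈ S
  | [], _, _ => by simp
  | [a], h, _ => by
    obtain rfl : a = y := by simpa using h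
    simpa using hy
  | a :: b :: l, h, hc => by
    rw [List.isChain_cons_cons] at hc
    intro v hv
    rcases List.mem_cons.1 hv with rfl | hv
    · exact hc.1.2.1
    · exact forall_mem_of_isChain_within hy (b :: l) (by simpa using h) hc.2 v hv

theorem exists_isPathSystem [Fintype V] [DecidableEq V] {E : V → V → Prop} {T F : Finset V}
    {y : Fin k → V} {n : ℕ} (hy : y.Injective) (hyF : ∀ j, y j ∉ F)
    (hF : F.card + k ≤ n) (hT : n ≤ T.card)
    (hconn : ∀ S : Finset V, S.card < n → ∀ a b, a ∉ S → b ∉ S → a ≠ b →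
      ReflTransGen (Within E (↑S : Set V)ᶜ) a b) :
    ∃ P : Fin k → List V, IsPathSystem E T F y P := by
  classical
  set Y : Finset V := Finset.univ.image y with hY
  have hYcard : Y.card = k := by rw [hY, Finset.card_image_of_injective _ hy]; simp
  obtain ⟨P, hP, hdisj⟩ := exists_disjoint_paths (Within E (↑F : Set V)ᶜ) T Y (by
    intro U hUT
    by_contra! hlt
    set N := (Finset.univ.filter fun p => ∃ q ∈ U, Within E (↑F : Set V)ᶜ p q) \ (U ∪ Y) with hN
    set S : Finset V := F ∪ (N ∪ (Y \ U)) with hS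
    have h1 : S.card ≤ F.card + (N.card + (Y \ U).card) :=
      (Finset.card_union_le _ _).trans (Nat.add_le_add_left (Finset.card_union_le _ _) _)
    have h2 := Finset.card_sdiff_add_card_inter Y U
    rw [Finset.inter_comm, hYcard] at h2
    have hScard : S.card < n := by omega
    obtain ⟨t, htT, htS⟩ := Finset.exists_mem_notMem_of_card_lt_card (hScard.trans_le hT)
    obtain ⟨b, hb⟩ : (U ∩ Y).Nonempty := Finset.card_pos.1 (by omega)
    rw [Finset.mem_inter] at hb
    have hbF : b ∉ F := by
      obtain ⟨j, _, rfl⟩ := Finset.mem_image.1 hb.2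
      exact hyF j
    have htU : t ∉ U := fun h => Finset.disjoint_left.1 hUT h htT
    have hbS : b ∉ S := by
      simp [hS, hN, hb.1, hb.2, hbF]
    obtain ⟨p, q, hpq, hp, hq⟩ := exists_entering_arc
      (hconn S hScard t b htS hbS (fun h => htU (h ▸ hb.1))) (↑U : Set V) htU hb.1
    have hpS : p ∉ S := hpq.2.1
    have hqS : q ∉ S := hpq.2.2
    rw [hS, Finset.mem_union, Finset.mem_union, not_or, not_or] at hpS hqS
    have hpU : p ∉ U := hp
    by_cases hpY : p ∈ Y
    · exact hpS.2.2 (Finset.mem_sdiff.2 ⟨hpY, hpU⟩)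
    · refine hpS.2.1 ?_
      rw [hN, Finset.mem_sdiff, Finset.mem_union, not_or, Finset.mem_filter]
      exact ⟨⟨Finset.mem_univ _, q, hq, hpq.1, hpS.1, hqS.1⟩, hpU, hpY⟩)
  have hmem : ∀ j, y j ∈ Y := fun j => Finset.mem_image_of_mem y (Finset.mem_univ j)
  exact ⟨fun j => P (y j), fun j => (hP _ (hmem j)).1, fun j => (hP _ (hmem j)).2.1,
    fun j => (hP _ (hmem j)).2.2.imp fun _ _ h => h.1,
    fun j => forall_mem_of_isChain_within (S := (↑F : Set V)ᶜ) (hyF j) _ (hP _ (hmem j)).2.1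
      (hP _ (hmem j)).2.2,
    fun i j hij => hdisj _ (hmem i) _ (hmem j) (hy.ne hij)⟩

theorem IsPathSystem.exists_minimal {E : V → V → Prop} {T F : Finset V} {y : Fin k → V}
    {P : Fin k → List V} (hP : IsPathSystem E T F y P) :
    ∃ P : Fin k → List V, IsPathSystem E T F y P ∧ ∀ j, ∀ l : List V, (∃ t ∈ T, l.head? = some t) →
      l.getLast? = some (y j) → l.IsChain E → (∀ v ∈ l, v ∉ F) →
      (∀ i, i ≠ j → ∀ v ∈ l, v ∉ P i) → (P j).length ≤ l.length := by
  let S : Set (Fin k → List V) := {P | IsPathSystem E T F y P}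
  let f : (Fin k → List V) → ℕ := fun P => ∑ j, (P j).length
  obtain ⟨P₀, hP₀, hmin⟩ : ∃ P ∈ S, ∀ P' ∈ S, f P ≤ f P' :=
    ⟨_, Function.argminOn_mem f S ⟨P, hP⟩, fun P' hP' => Function.argminOn_le f S hP'⟩
  refine ⟨P₀, hP₀, fun j l hhead hlast hchain havoid hdisj => ?_⟩
  have hle := hmin (Function.update P₀ j l) ⟨?_, ?_, ?_, ?_, ?_⟩
  · simp only [f, ← Finset.add_sum_erase Finset.univ _ (Finset.mem_univ j)] at hle
    have heq : ∑ i ∈ Finset.univ.erase j, (Function.update P₀ j l i).length =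
        ∑ i ∈ Finset.univ.erase j, (P₀ i).length :=
      Finset.sum_congr rfl fun i hi => by rw [Function.update_of_ne (Finset.ne_of_mem_erase hi)]
    rw [heq, Function.update_self] at hle
    omega
  all_goals intro i
  · by_cases h : i = j
    · subst h; simpa using hhead
    · simpa [h] using hP₀.head i
  · by_cases h : i = j
    · subst h; simpa using hlast
    · simpa [h] using hP₀.last i
  · by_cases h : i = j
    · subst h; simpa using hchain
    · simpa [h] using hP₀.chain i
  · by_cases h : i = j
    · subst h; simpa using havoid
    · simpa [h] using hP₀.avoid i
  · intro i' hne v hv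
    by_cases h : i = j
    · subst h
      rw [Function.update_of_ne hne.symm]
      rw [Function.update_self] at hv
      exact hdisj i' hne.symm v hv
    · rw [Function.update_of_ne h] at hv
      by_cases h' : i' = j
      · subst h'
        rw [Function.update_self]
        exact fun hv' => hdisj i h v hv' hv
      · rw [Function.update_of_ne h']
        exact hP₀.disj i i' hne v hv

theorem mem_take_of_append {l₁ l₂ : List V} {q : V} {n : ℕ} (h : l₁.length < n) :
    q ∈ (l₁ ++ q :: l₂).take n := by
  rw [List.take_append]
  refine List.mem_append_right _ ?_
  obtain ⟨m, hm⟩ : ∃ m, n - l₁.length = m + 1 := ⟨n - l₁.length - 1, by omega⟩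
  simp [hm]

theorem card_biUnion_take_le [DecidableEq V] (P : Fin k → List V) (n : ℕ) :
    (Finset.univ.biUnion fun j => ((P j).take n).toFinset).card ≤ n * k := by
  refine (Finset.card_biUnion_le_card_mul _ _ n fun j _ => ?_).trans ?_
  · exact (List.toFinset_card_le _).trans (List.length_take_le _ _)
  · simp [mul_comm]

/-- A path system of minimal total length receives few arcs from `T`, also in two steps. -/
theorem exists_short_isPathSystem [DecidableEq V] {E : V → V → Prop} [DecidableRel E]
    {T F : Finset V} {y : Fin k → V} {P : Fin k → List V} (hP : IsPathSystem E T F y P)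
    (hTF : Disjoint T F) :
    ∃ P : Fin k → List V, IsPathSystem E T F y P ∧
      ∃ Q R : Finset V, (∀ v, v ∈ Q ↔ ∃ j, v ∈ P j) ∧ (T ∩ Q).card ≤ k ∧ R.card ≤ k ∧
        (∀ t ∈ T, t ∉ Q → ∀ q ∈ Q, E t q → q ∈ T ∨ q ∈ R) ∧
        ∀ t ∈ T, t ∉ Q → ∀ b, b ∉ Q → b ∉ F → E t b → (Q.filter (E b)).card ≤ 3 * k := by
  obtain ⟨P, hP, hmin⟩ := hP.exists_minimal
  refine ⟨P, hP, Finset.univ.biUnion fun j => (P j).toFinset,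
    Finset.univ.biUnion fun j => ((P j).tail.take 1).toFinset, by simp, ?_, ?_, ?_, ?_⟩
  · refine (Finset.card_le_card fun q hq => ?_).trans ((card_biUnion_take_le P 1).trans (by simp))
    rw [Finset.mem_inter] at hq
    simp only [Finset.mem_biUnion, Finset.mem_univ, true_and, List.mem_toFinset] at hq ⊢
    obtain ⟨hqT, j, hqj⟩ := hq
    obtain ⟨l₁, l₂, h⟩ := List.mem_iff_append.1 hqj
    have hsub : ∀ v ∈ q :: l₂, v ∈ P j := fun v hv => h ▸ List.mem_append_right _ hv
    have hle := hmin j (q :: l₂) ⟨q, hqT, rfl⟩ (by simpa [h] using hP.last j)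
      (by have := hP.chain j; rw [h] at this; exact this.right_of_append)
      (fun v hv => hP.avoid j v (hsub v hv)) (fun i hij v hv => hP.disj j i hij.symm v (hsub v hv))
    refine ⟨j, ?_⟩
    rw [h] at hle ⊢
    simp only [List.length_append, List.length_cons] at hle
    exact mem_take_of_append (by omega)
  · exact (card_biUnion_take_le (fun j => (P j).tail) 1).trans (by simp)
  · intro t ht htQ q hq htq
    simp only [Finset.mem_biUnion, Finset.mem_univ, true_and, List.mem_toFinset, not_exists]
      at htQ hq ⊢
    obtain ⟨j, hqj⟩ := hq
    obtain ⟨l₁, l₂, h⟩ := List.mem_iff_append.1 hqj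
    have hsub : ∀ v ∈ q :: l₂, v ∈ P j := fun v hv => h ▸ List.mem_append_right _ hv
    have hle := hmin j (t :: q :: l₂) ⟨t, ht, rfl⟩ (by simpa [h] using hP.last j)
      (by
        have := hP.chain j
        rw [h] at this
        exact List.isChain_cons_cons.2 ⟨htq, this.right_of_append⟩)
      (by
        intro v hv
        rcases List.mem_cons.1 hv with rfl | hv
        · exact Finset.disjoint_left.1 hTF ht
        · exact hP.avoid j v (hsub v hv))
      (by
        intro i hij v hv
        rcases List.mem_cons.1 hv with rfl | hv
        · exact htQ i
        · exact hP.disj j i hij.symm v (hsub v hv))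
    simp only [h, List.length_append, List.length_cons] at hle
    cases l₁ with
    | nil =>
      obtain ⟨t', ht', hh⟩ := hP.head j
      rw [h] at hh
      obtain rfl : q = t' := by simpa using hh
      exact .inl ht'
    | cons a l₁ =>
      refine .inr ⟨j, ?_⟩
      rw [h, List.cons_append, List.tail_cons]
      simp only [List.length_cons] at hle
      exact mem_take_of_append (by omega)
  · intro t ht htQ b hbQ hbF htb
    refine (Finset.card_le_card fun q hq => ?_).trans (card_biUnion_take_le P 3)
    rw [Finset.mem_filter] at hq
    simp only [Finset.mem_biUnion, Finset.mem_univ, true_and, List.mem_toFinset, not_exists]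
      at htQ hbQ hq ⊢
    obtain ⟨⟨j, hqj⟩, hbq⟩ := hq
    obtain ⟨l₁, l₂, h⟩ := List.mem_iff_append.1 hqj
    have hsub : ∀ v ∈ q :: l₂, v ∈ P j := fun v hv => h ▸ List.mem_append_right _ hv
    have hle := hmin j (t :: b :: q :: l₂) ⟨t, ht, rfl⟩ (by simpa [h] using hP.last j)
      (by
        have := hP.chain j
        rw [h] at this
        exact List.isChain_cons_cons.2 ⟨htb, List.isChain_cons_cons.2
          ⟨hbq, this.right_of_append⟩⟩)
      (by
        intro v hv
        rcases List.mem_cons.1 hv with rfl | hv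
        · exact Finset.disjoint_left.1 hTF ht
        rcases List.mem_cons.1 hv with rfl | hv
        · exact hbF
        · exact hP.avoid j v (hsub v hv))
      (by
        intro i hij v hv
        rcases List.mem_cons.1 hv with rfl | hv
        · exact htQ i
        rcases List.mem_cons.1 hv with rfl | hv
        · exact hbQ i
        · exact hP.disj j i hij.symm v (hsub v hv))
    refine ⟨j, ?_⟩
    rw [h] at hle ⊢
    simp only [List.length_append, List.length_cons] at hle
    exact mem_take_of_append (by omega)

end ShortPaths

/-! ### Linking terminals -/

section Linking

variable [Fintype V] [DecidableEq V] {k : ℕ}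

/-- Connecting `s` to `w` through at most two fresh vertices. -/
theorem exists_short_connection (E : V → V → Prop) [DecidableRel E] {s w : V}
    {B Q X F : Finset V} (hBX : Disjoint B X) (hBQ : Disjoint B Q) (hBF : Disjoint B F)
    (hQX : Disjoint Q X)
    (hsB : ∀ b ∈ B, E s b) (hsemi : ∀ b ∈ B, ∀ v, v ≠ b → E v b ∨ E b v)
    (hBQout : ∀ b ∈ B, (Q.filter (E b)).card ≤ 3 * k)
    (hdeg : ∀ b ∈ B, (Finset.univ.filter fun u => E u b ∧ u ∉ X).card ≤
      (Finset.univ.filter fun u => E u w ∧ u ∉ X).card)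
    (hF : F.card + 2 ≤ 4 * k) (hB : 14 * k + 2 ≤ B.card) :
    ∃ M : Finset V, M.card ≤ 2 ∧ Disjoint M (X ∪ Q ∪ F) ∧
      ReflTransGen (Within E (insert s (insert w (↑M : Set V)))) s w := by
  have hB' : ∀ b ∈ B, b ∉ X ∪ Q ∪ F := fun b hb => by
    simp only [Finset.mem_union, not_or]
    exact ⟨⟨Finset.disjoint_left.1 hBX hb, Finset.disjoint_left.1 hBQ hb⟩,
      Finset.disjoint_left.1 hBF hb⟩
  by_cases hb₁ : ∃ b ∈ B, E b w
  · obtain ⟨b, hb, hbw⟩ := hb₁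
    refine ⟨{b}, by simp, by simpa using hB' b hb, ?_⟩
    exact .head ⟨hsB b hb, by simp, by simp⟩ (.single ⟨hbw, by simp, by simp⟩)
  push Not at hb₁
  set A : Finset V := Finset.univ.filter fun a => E a w ∧ a ∉ X ∪ Q ∪ F with hA
  have hAmem : ∀ a, a ∈ A ↔ E a w ∧ a ∉ X ∪ Q ∪ F := fun a => by simp [hA]
  by_cases hb₂ : ∃ b ∈ B, ∃ a ∈ A, E b a
  · obtain ⟨b, hb, a, ha, hba⟩ := hb₂
    rw [hAmem] at ha
    refine ⟨{b, a}, Finset.card_le_two, ?_, ?_⟩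
    · rw [Finset.disjoint_left]
      intro v hv
      rcases Finset.mem_insert.1 hv with rfl | hv
      · exact hB' _ hb
      · rw [Finset.mem_singleton.1 hv]; exact ha.2
    · exact .head ⟨hsB b hb, by simp, by simp⟩ (.head ⟨hba, by simp, by simp⟩
        (.single ⟨ha.1, by simp, by simp⟩))
  push Not at hb₂
  exfalso
  have hAB : ∀ a ∈ A, a ∉ B := fun a ha hb => hb₁ a hb ((hAmem a).1 ha).1
  obtain ⟨b, hb, hin⟩ := exists_large_inDeg E B (Finset.card_pos.1 (by omega))
    (fun u _ v hv huv => hsemi v hv u huv)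
  have h1 : (A ∪ (Q.filter fun q => ¬ E b q)) ∪ (B.filter fun u => E u b) ⊆
      Finset.univ.filter fun u => E u b ∧ u ∉ X := by
    intro u hu
    simp only [Finset.mem_union, Finset.mem_filter, Finset.mem_univ, true_and] at hu ⊢
    rcases hu with (hu | ⟨hu, hbu⟩) | ⟨hu, hub⟩
    · refine ⟨(hsemi b hb u (fun h => hAB u hu (h ▸ hb))).resolve_right (hb₂ b hb u hu),
        fun h => ((hAmem u).1 hu).2 (by simp [h])⟩
    · exact ⟨(hsemi b hb u (fun h => Finset.disjoint_left.1 hBQ hb (h ▸ hu))).resolve_right hbu,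
        Finset.disjoint_left.1 hQX hu⟩
    · exact ⟨hub, Finset.disjoint_left.1 hBX hu⟩
  have h2 : (Finset.univ.filter fun u => E u w ∧ u ∉ X) ⊆ (A ∪ Q) ∪ F := by
    intro u hu
    simp only [Finset.mem_union, Finset.mem_filter, Finset.mem_univ, true_and, hAmem] at hu ⊢
    tauto
  have hd1 : Disjoint A (Q.filter fun q => ¬ E b q) := by
    rw [Finset.disjoint_left]
    intro a ha hq
    exact ((hAmem a).1 ha).2 (by simp [(Finset.mem_filter.1 hq).1])
  have hd2 : Disjoint (A ∪ (Q.filter fun q => ¬ E b q)) (B.filter fun u => E u b) := by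
    rw [Finset.disjoint_left]
    intro a ha hq
    have haB := (Finset.mem_filter.1 hq).1
    rcases Finset.mem_union.1 ha with ha | ha
    · exact hAB a ha haB
    · exact Finset.disjoint_left.1 hBQ haB (Finset.mem_filter.1 ha).1
  have h1' := Finset.card_le_card h1
  rw [Finset.card_union_of_disjoint hd2, Finset.card_union_of_disjoint hd1] at h1'
  have h2' := (Finset.card_le_card h2).trans ((Finset.card_union_le _ _).trans
    (Nat.add_le_add_right (Finset.card_union_le _ _) _))
  have h3 := Finset.card_filter_add_card_filter_not (s := Q) (E b)
  have h4 := hBQout b hb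
  have h5 := hdeg b hb
  omega

/-- A highly connected digraph in which every vertex is adjacent to all vertices outside the
target set links the vertices `x i` to the targets `y i` inside disjoint vertex sets. -/
theorem exists_disjoint_connecting_sets (E : V → V → Prop) [DecidableRel E] (hk : 1 ≤ k)
    (x y : Fin k → V) (hxy : Function.Injective (Sum.elim x y))
    (hsemi : ∀ u v, u ≠ v → (∀ j, v ≠ y j) → E u v ∨ E v u)
    (hdeg : ∀ v, 22 * k ≤ ((Finset.univ.filter (E v)) \ Finset.univ.image y).card)
    (hconn : ∀ S : Finset V, S.card < 3 * k → ∀ a b, a ∉ S → b ∉ S → a ≠ b →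
      ReflTransGen (Within E (↑S : Set V)ᶜ) a b) :
    ∃ S : Fin k → Finset V, (∀ i j, i ≠ j → Disjoint (S i) (S j)) ∧
      ∀ i, y i ∈ S i ∧ ReflTransGen (Within E (↑(S i) : Set V)) (x i) (y i) := by
  classical
  have hxinj : x.Injective := fun i j h => Sum.inl_injective (hxy (a₁ := .inl i) (a₂ := .inl j) h)
  have hyinj : y.Injective := fun i j h => Sum.inr_injective (hxy (a₁ := .inr i) (a₂ := .inr j) h)
  have hxney : ∀ i j, x i ≠ y j := fun i j h => by
    simpa using hxy (a₁ := .inl i) (a₂ := .inr j) h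
  have : Nonempty V := ⟨x ⟨0, hk⟩⟩
  set X := Finset.univ.image x with hX
  set Y := Finset.univ.image y with hY
  have hXcard : X.card = k := by rw [hX, Finset.card_image_of_injective _ hxinj]; simp
  have hYcard : Y.card = k := by rw [hY, Finset.card_image_of_injective _ hyinj]; simp
  have hxX : ∀ i, x i ∈ X := fun i => Finset.mem_image_of_mem x (Finset.mem_univ i)
  have hnY : ∀ v, v ∉ Y → ∀ j, v ≠ y j := fun v hv j h =>
    hv (h ▸ Finset.mem_image_of_mem y (Finset.mem_univ j))
  -- the set `T` of vertices with the largest in-degree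
  obtain ⟨T, hTs, hTcard, htop⟩ := exists_top_subset (Finset.univ \ (X ∪ Y))
    (fun v => (Finset.univ.filter fun u => E u v ∧ u ∉ X).card) (m := 3 * k) (by
      have h1 := hdeg (x ⟨0, hk⟩)
      have h2 := Finset.card_le_card
        (Finset.sdiff_subset_sdiff (Finset.subset_univ (Finset.univ.filter (E (x ⟨0, hk⟩))))
          (subset_refl Y))
      have h3 := Finset.le_card_sdiff (X ∪ Y) Finset.univ
      have h4 := Finset.card_union_le X Y
      have h5 := Finset.card_le_card (Finset.sdiff_subset (s := Finset.univ) (t := Y))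
      omega)
  have hTX : ∀ t ∈ T, t ∉ X := fun t ht h => by simpa [h] using hTs ht
  have hTY : ∀ t ∈ T, t ∉ Y := fun t ht h => by simpa [h] using hTs ht
  -- second vertices for the paths that start by a detour into `T`
  set C : Fin k → Finset V := fun i => Finset.univ.filter fun c => E (x i) c ∧ c ∉ X ∧ c ∉ Y ∧
    c ∉ T ∧ 2 * k ≤ (T.filter (E c)).card with hC
  have hCmem : ∀ i c, c ∈ C i ↔ E (x i) c ∧ c ∉ X ∧ c ∉ Y ∧ c ∉ T ∧
    2 * k ≤ (T.filter (E c)).card := fun i c => by simp [hC]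
  obtain ⟨z, hzC, hzinj⟩ := exists_injOn_of_card_le (fun i => k ≤ (C i).card) C (by simp)
  set Z : Finset V := (Finset.univ.filter fun i => k ≤ (C i).card).image z with hZ
  have hZmem : ∀ v, v ∈ Z ↔ ∃ i, k ≤ (C i).card ∧ z i = v := fun v => by simp [hZ]
  have hZcard : Z.card ≤ k := Finset.card_image_le.trans
    ((Finset.card_filter_le _ _).trans (by simp))
  have hZprop : ∀ v ∈ Z, v ∉ X ∧ v ∉ Y ∧ v ∉ T ∧ 2 * k ≤ (T.filter (E v)).card := by
    intro v hv
    obtain ⟨i, hi, rfl⟩ := (hZmem v).1 hv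
    exact ((hCmem i _).1 (hzC i hi)).2
  have hTF : Disjoint T (X ∪ Z) := by
    rw [Finset.disjoint_left]
    intro t ht h
    rcases Finset.mem_union.1 h with h | h
    · exact hTX t ht h
    · exact (hZprop t h).2.2.1 ht
  obtain ⟨P₀, hP₀⟩ := exists_isPathSystem (E := E) (T := T) (F := X ∪ Z) (n := 3 * k) hyinj
    (fun j h => by
      have hj : y j ∈ Y := Finset.mem_image_of_mem y (Finset.mem_univ j)
      rcases Finset.mem_union.1 h with h | h
      · obtain ⟨i, _, hi⟩ := Finset.mem_image.1 h
        exact hxney i j hi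
      · exact (hZprop _ h).2.1 hj)
    (by have := Finset.card_union_le X Z; omega) hTcard.ge hconn
  obtain ⟨P, hP, Q, R, hQ, hTQ, hR, hQR, hQout⟩ := exists_short_isPathSystem hP₀ hTF
  have hQF : ∀ q ∈ Q, q ∉ X ∧ q ∉ Z := fun q hq => by
    obtain ⟨j, hj⟩ := (hQ q).1 hq
    simpa using hP.avoid j q hj
  have hTQ' : ∀ S ⊆ T, S.card ≤ (S \ Q).card + k := fun S hS => by
    have h1 := Finset.card_sdiff_add_card_inter S Q
    have h2 := Finset.card_le_card (Finset.inter_subset_inter_right hS (u := Q))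
    omega
  -- third vertices for these paths
  obtain ⟨u, huC, huinj⟩ := exists_injOn_of_card_le (fun i => k ≤ (C i).card)
    (fun i => T.filter (E (z i)) \ Q) (fun i hi => by
      have h1 := ((hCmem i _).1 (hzC i hi)).2.2.2.2
      have h2 := hTQ' _ (Finset.filter_subset (E (z i)) T)
      rw [Fintype.card_fin]
      omega)
  have huprop : ∀ i, k ≤ (C i).card → u i ∈ T ∧ E (z i) (u i) ∧ u i ∉ Q := fun i hi => by
    have := huC i hi
    rw [Finset.mem_sdiff, Finset.mem_filter] at this
    exact ⟨this.1.1, this.1.2, this.2⟩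
  set U : Finset V := (Finset.univ.filter fun i => k ≤ (C i).card).image u with hU
  have hUmem : ∀ v, v ∈ U ↔ ∃ i, k ≤ (C i).card ∧ u i = v := fun v => by simp [hU]
  have hUcard : U.card ≤ k := Finset.card_image_le.trans
    ((Finset.card_filter_le _ _).trans (by simp))
  have hUT : ∀ v ∈ U, v ∈ T ∧ v ∉ Q := fun v hv => by
    obtain ⟨i, hi, rfl⟩ := (hUmem v).1 hv
    exact ⟨(huprop i hi).1, (huprop i hi).2.2⟩
  set s : Fin k → V := fun i => if k ≤ (C i).card then u i else x i with hs
  set pre : Fin k → Finset V := fun i => if k ≤ (C i).card then {x i, z i, u i} else {x i}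
    with hpre
  have hpremem : ∀ i v, v ∈ pre i ↔ v = x i ∨ (k ≤ (C i).card ∧ (v = z i ∨ v = u i)) := by
    intro i v
    by_cases hi : k ≤ (C i).card <;> simp [hpre, hi]
  have hprereach : ∀ i, ReflTransGen (Within E (↑(pre i) : Set V)) (x i) (s i) := by
    intro i
    by_cases hi : k ≤ (C i).card
    · have hsi : s i = u i := by simp [hs, hi]
      rw [hsi]
      exact .head ⟨((hCmem i _).1 (hzC i hi)).1, by simp [hpremem], by simp [hpremem, hi]⟩
        (.single ⟨(huprop i hi).2.1, by simp [hpremem, hi], by simp [hpremem, hi]⟩)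
    · have hsi : s i = x i := by simp [hs, hi]
      rw [hsi]
  have hspre : ∀ i, s i ∈ pre i := fun i => by
    by_cases hi : k ≤ (C i).card <;> simp [hpre, hs, hi]
  have hpresub : ∀ i, pre i ⊆ X ∪ Z ∪ U := by
    intro i v hv
    rw [Finset.mem_union, Finset.mem_union]
    rcases (hpremem i v).1 hv with rfl | ⟨hi, rfl | rfl⟩
    · exact .inl (.inl (hxX i))
    · exact .inl (.inr ((hZmem _).2 ⟨i, hi, rfl⟩))
    · exact .inr ((hUmem _).2 ⟨i, hi, rfl⟩)
  have hpredisj : ∀ i j, i ≠ j → Disjoint (pre i) (pre j) := by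
    intro i j hij
    rw [Finset.disjoint_left]
    intro v hvi hvj
    have hz : ∀ i, k ≤ (C i).card → z i ∈ Z := fun i hi => (hZmem _).2 ⟨i, hi, rfl⟩
    rcases (hpremem i v).1 hvi with rfl | ⟨hi, rfl | rfl⟩ <;>
      rcases (hpremem j _).1 hvj with h | ⟨hj, h | h⟩
    · exact hij (hxinj h)
    · exact (hZprop _ (hz j hj)).1 (h ▸ hxX i)
    · exact hTX _ (huprop j hj).1 (h ▸ hxX i)
    · exact (hZprop _ (hz i hi)).1 (h ▸ hxX j)
    · exact hij (hzinj i j hi hj h)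
    · exact (hZprop _ (hz i hi)).2.2.1 (h ▸ (huprop j hj).1)
    · exact hTX _ (huprop i hi).1 (h ▸ hxX j)
    · exact (hZprop _ (hz j hj)).2.2.1 (h ▸ (huprop i hi).1)
    · exact hij (huinj i j hi hj h)
  have hpreQ : ∀ i, Disjoint (pre i) Q := fun i => by
    refine Finset.disjoint_left.2 fun v hv hvQ => ?_
    have := hpresub i hv
    rw [Finset.mem_union, Finset.mem_union] at this
    rcases this with (h | h) | h
    · exact (hQF v hvQ).1 h
    · exact (hQF v hvQ).2 h
    · exact (hUT v h).2 hvQ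
  have hw : ∀ i, ∃ w ∈ T, (P i).head? = some w := hP.head
  choose w hwT hw using hw
  -- connecting `s i` to the path ending in `y i`
  obtain ⟨M, hMdisj, hM⟩ := exists_pairwise_disjoint_of_step (m := 2)
    (fun i M => Disjoint M (X ∪ Q ∪ (Z ∪ U)) ∧
      ReflTransGen (Within E (insert (s i) (insert (w i) (↑M : Set V)))) (s i) (w i)) (by
    intro i F hF
    set Z' := if k ≤ (C i).card then Z else C i with hZ'
    have hZ'card : Z'.card ≤ k := by
      by_cases hi : k ≤ (C i).card
      · simpa [hZ', hi] using hZcard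
      · simp only [hZ', hi, if_false]; omega
    set B₀ := ((Finset.univ.filter (E (s i))) \ Y) \ (X ∪ T ∪ Z' ∪ R) with hB₀
    have hB₀card : 16 * k ≤ B₀.card := by
      have h1 := hdeg (s i)
      have h2 : ((Finset.univ.filter (E (s i))) \ Y).card - (X ∪ T ∪ Z' ∪ R).card ≤ B₀.card :=
        Finset.le_card_sdiff _ _
      have h3 := Finset.card_union_le (X ∪ T ∪ Z') R
      have h4 := Finset.card_union_le (X ∪ T) Z'
      have h5 := Finset.card_union_le X T
      omega
    have hB₀mem : ∀ b ∈ B₀, E (s i) b ∧ b ∉ Y ∧ b ∉ X ∧ b ∉ T ∧ b ∉ Z' ∧ b ∉ R := by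
      intro b hb
      simp only [hB₀, Finset.mem_sdiff, Finset.mem_filter, Finset.mem_univ, true_and,
        Finset.mem_union, not_or] at hb
      tauto
    have hB₀Z : ∀ b ∈ B₀, b ∉ Z := by
      intro b hb hbZ
      obtain ⟨h1, h2, h3, h4, h5, h6⟩ := hB₀mem b hb
      by_cases hi : k ≤ (C i).card
      · simp only [hZ', hi, if_true] at h5
        exact h5 hbZ
      · simp only [hZ', hs, hi, if_false] at h1 h5
        exact h5 ((hCmem i b).2 ⟨h1, hZprop b hbZ⟩)
    have hB₀t : ∀ b ∈ B₀, ∃ t ∈ T, t ∉ Q ∧ E t b := by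
      intro b hb
      obtain ⟨h1, h2, h3, h4, h5, h6⟩ := hB₀mem b hb
      by_cases hi : k ≤ (C i).card
      · simp only [hs, hi, if_true] at h1
        exact ⟨u i, (huprop i hi).1, (huprop i hi).2.2, h1⟩
      · simp only [hZ', hs, hi, if_false] at h1 h5
        have h7 : (T.filter (E b)).card < 2 * k := by
          by_contra! h
          exact h5 ((hCmem i b).2 ⟨h1, h3, h2, h4, h⟩)
        have h8 := hTQ' T subset_rfl
        obtain ⟨t, ht, htb⟩ := Finset.exists_mem_notMem_of_card_lt_card
          (show (T.filter (E b)).card < (T \ Q).card by omega)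
        rw [Finset.mem_sdiff] at ht
        refine ⟨t, ht.1, ht.2, (hsemi t b (fun h => h4 (h ▸ ht.1)) (hnY b h2)).resolve_right
          fun h => htb (Finset.mem_filter.2 ⟨ht.1, h⟩)⟩
    have hB₀Q : ∀ b ∈ B₀, b ∉ Q := by
      intro b hb hbQ
      obtain ⟨h1, h2, h3, h4, h5, h6⟩ := hB₀mem b hb
      obtain ⟨t, ht, htQ, htb⟩ := hB₀t b hb
      exact (hQR t ht htQ b hbQ htb).elim h4 h6
    obtain ⟨M, hM2, hMd, hMr⟩ := exists_short_connection (k := k) E (s := s i) (w := w i)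
      (B := B₀ \ F) (Q := Q) (X := X) (F := Z ∪ U ∪ F)
      (Finset.disjoint_left.2 fun b hb => (hB₀mem b (Finset.mem_sdiff.1 hb).1).2.2.1)
      (Finset.disjoint_left.2 fun b hb => hB₀Q b (Finset.mem_sdiff.1 hb).1)
      (Finset.disjoint_left.2 fun b hb => by
        rw [Finset.mem_sdiff] at hb
        simp only [Finset.mem_union, not_or]
        exact ⟨⟨hB₀Z b hb.1, fun h => (hB₀mem b hb.1).2.2.2.1 (hUT b h).1⟩, hb.2⟩)
      (Finset.disjoint_left.2 fun q hq => (hQF q hq).1)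
      (fun b hb => (hB₀mem b (Finset.mem_sdiff.1 hb).1).1)
      (fun b hb v hv => hsemi v b hv (hnY b (hB₀mem b (Finset.mem_sdiff.1 hb).1).2.1))
      (fun b hb => by
        have hb := (Finset.mem_sdiff.1 hb).1
        obtain ⟨t, ht, htQ, htb⟩ := hB₀t b hb
        refine hQout t ht htQ b (hB₀Q b hb) ?_ htb
        rw [Finset.mem_union, not_or]
        exact ⟨(hB₀mem b hb).2.2.1, hB₀Z b hb⟩)
      (fun b hb => by
        have hb := hB₀mem b (Finset.mem_sdiff.1 hb).1
        refine htop (w i) (hwT i) b ?_ hb.2.2.2.1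
        simp [hb.2.1, hb.2.2.1])
      (by
        have h1 := Finset.card_union_le (Z ∪ U) F
        have h2 := Finset.card_union_le Z U
        omega)
      (by
        have := Finset.le_card_sdiff F B₀
        omega)
    refine ⟨M, hM2, hMd.mono_right fun v hv => ?_, hMd.mono_right fun v hv => ?_, hMr⟩
    · simp [hv]
    · simp only [Finset.mem_union] at hv ⊢
      tauto)
  have hPQ : ∀ i, (P i).toFinset ⊆ Q := fun i v hv => (hQ v).2 ⟨i, List.mem_toFinset.1 hv⟩
  have hMQ : ∀ i, Disjoint (M i) Q := fun i => (hM i).1.mono_right fun v hv => by simp [hv]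
  have hMpre : ∀ i j, Disjoint (M i) (pre j) := fun i j => (hM i).1.mono_right fun v hv => by
    have := hpresub j hv
    simp only [Finset.mem_union] at this ⊢
    tauto
  refine ⟨fun i => pre i ∪ M i ∪ (P i).toFinset, fun i j hij => ?_, fun i => ⟨?_, ?_⟩⟩
  · have h1 := hpredisj i j hij
    have h2 := hMpre i j
    have h3 := (hMpre j i).symm
    have h4 := hMdisj i j hij
    have h5 := (hpreQ i).mono_right (hPQ j)
    have h6 := ((hpreQ j).mono_right (hPQ i)).symm
    have h7 := (hMQ i).mono_right (hPQ j)
    have h8 := ((hMQ j).mono_right (hPQ i)).symm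
    have h9 : Disjoint (P i).toFinset (P j).toFinset := Finset.disjoint_left.2 fun v hv hv' =>
      hP.disj i j hij v (List.mem_toFinset.1 hv) (List.mem_toFinset.1 hv')
    simp only [Finset.disjoint_union_left, Finset.disjoint_union_right]
    tauto
  · have := List.mem_of_getLast? (hP.last i)
    simp [this]
  · have h1 := reflTransGen_of_isChain (S := (↑(P i).toFinset : Set V)) (P i) (w i) (hw i)
      (hP.last i) (hP.chain i) (by simp)
    have hwi : w i ∈ P i := List.mem_of_head? (hw i)
    refine (ReflTransGen.mono (fun _ _ => Within.mono (fun _ _ => id) ?_) _ _ (hprereach i)).trans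
      ((ReflTransGen.mono (fun _ _ => Within.mono (fun _ _ => id) ?_) _ _ (hM i).2).trans
        (ReflTransGen.mono (fun _ _ => Within.mono (fun _ _ => id) ?_) _ _ h1))
    · intro v hv
      have : v ∈ pre i := hv
      simp [this]
    · rintro v (rfl | rfl | hv)
      · simp [hspre i]
      · simp [hwi]
      · have : v ∈ M i := hv
        simp [this]
    · intro v hv
      have : v ∈ P i := List.mem_toFinset.1 hv
      simp [this]

end Linking

/-! ### Replacing arcs inside co-connected classes -/

section Reduction

/-- The arcs of `E` between distinct co-connected classes. -/
def CrossArc (E : V → V → Prop) (u v : V) : Prop := E u v ∧ ¬ CoConn E u v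

/-- A path between distinct co-connected classes can avoid arcs inside the classes. -/
theorem QuasiTrans.transGen_crossArc {E : V → V → Prop} (hE : QuasiTrans E) {S : Set V} {a b : V}
    (h : ReflTransGen (Within E S) a b) (hab : ¬ CoConn E a b) :
    TransGen (Within (CrossArc E) S) a b := by
  induction h using ReflTransGen.head_induction_on with
  | refl => exact absurd .refl hab
  | @head a c hac hcb ih =>
    obtain ⟨hE', ha, hc⟩ := hac
    by_cases hcc : CoConn E c b
    · have hac' : ¬ CoConn E a c := fun h => hab (h.trans hcc)
      have hb : b ∈ S := by
        rcases ReflTransGen.cases_tail hcb with rfl | ⟨_, _, h⟩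
        · exact hc
        · exact h.2.2
      exact .single ⟨⟨hE.adj_of_coConn' hcc (fun h => hac' h.symm) hE', hab⟩, ha, hb⟩
    by_cases hac' : CoConn E a c
    · obtain ⟨n, hcn, hnb⟩ := TransGen.head'_iff.1 (ih hcc)
      refine TransGen.head' ⟨⟨hE.adj_of_coConn hac'.symm hcn.1.2 hcn.1.1, ?_⟩, ha, hcn.2.2⟩ hnb
      exact fun h => hcn.1.2 (hac'.symm.trans h)
    · exact .head ⟨⟨hE', hac'⟩, ha, hc⟩ (ih hcc)

/-- The digraph obtained from `E` by replacing the arcs inside each co-connected class by all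
arcs that do not end in `Y`. -/
def Completion (E : V → V → Prop) (Y : Set V) (u v : V) : Prop :=
  u ≠ v ∧ (CrossArc E u v ∨ CoConn E u v ∧ v ∉ Y)

theorem CrossArc.completion {E : V → V → Prop} {Y : Set V} {u v : V} (h : CrossArc E u v) :
    Completion E Y u v := ⟨fun huv => h.2 (huv ▸ .refl), .inl h⟩

/-- Connections in the completion ending in `Y` come from genuine paths. -/
theorem QuasiTrans.reflTransGen_of_completion {E : V → V → Prop} (hE : QuasiTrans E)
    {Y S : Set V} {a b : V} (hb : b ∈ Y) (h : ReflTransGen (Within (Completion E Y) S) a b) :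
    ReflTransGen (Within E S) a b := by
  suffices h' : a = b ∨ TransGen (Within (CrossArc E) S) a b by
    rcases h' with rfl | h'
    · exact .refl
    · exact ReflTransGen.mono (fun _ _ => Within.mono (fun _ _ h => h.1) subset_rfl) _ _
        h'.to_reflTransGen
  induction h using ReflTransGen.head_induction_on with
  | refl => exact .inl rfl
  | @head a c hac _ ih =>
    obtain ⟨⟨hne, hac⟩, ha, hc⟩ := hac
    right
    rcases hac with hac | ⟨hac, hcY⟩
    · rcases ih with rfl | ih
      · exact .single ⟨hac, ha, hc⟩
      · exact .head ⟨hac, ha, hc⟩ ih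
    · rcases ih with rfl | ih
      · exact absurd hb hcY
      · obtain ⟨n, hcn, hnb⟩ := TransGen.head'_iff.1 ih
        refine TransGen.head' ⟨⟨hE.adj_of_coConn hac.symm hcn.1.2 hcn.1.1, ?_⟩, ha, hcn.2.2⟩ hnb
        exact fun h => hcn.1.2 (hac.symm.trans h)

/-- In a highly connected quasi-transitive digraph, no small vertex set covers everything outside
a nontrivial co-connected class. -/
theorem QuasiTrans.exists_not_coConn_notMem [Finite V] {E : V → V → Prop} (hE : QuasiTrans E)
    {n : ℕ} (hn : 0 < n)
    (hconn : ∀ S : Finset V, S.card < n → ∀ a b, a ∉ S → b ∉ S → a ≠ b →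
      ReflTransGen (Within E (↑S : Set V)ᶜ) a b)
    {a b : V} (hab : CoConn E a b) (hne : a ≠ b) (S : Finset V) (hS : S.card < n) :
    ∃ v, v ∉ S ∧ ¬ CoConn E a v := by
  classical
  have := Fintype.ofFinite V
  by_contra! hcov
  have hstrong : ∀ x y, ReflTransGen E x y := fun x y => by
    by_cases h : x = y
    · exact h ▸ .refl
    · exact ReflTransGen.mono (fun _ _ h => h.1) _ _
        (hconn ∅ (by simpa using hn) x y (by simp) (by simp) h)
  obtain ⟨c, hc⟩ : ∃ c, ¬ CoConn E a c := by
    by_contra! h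
    obtain ⟨u, v, huv⟩ := hE.exists_not_coConn hne hstrong
    exact huv ((h u).symm.trans (h v))
  set N : Finset V := Finset.univ.filter (CrossArc E a) with hN
  have hNS : N ⊆ S := fun v hv => by
    by_contra h
    exact (Finset.mem_filter.1 hv).2.2 (hcov v h)
  obtain ⟨p, q, hpq, hp, hq⟩ := exists_entering_arc (hstrong c a) {v | CoConn E a v} hc .refl
  have hap : E p a := hE.adj_of_coConn' (CoConn.symm hq) (fun h => hp (CoConn.trans hq h)) hpq
  have hpN : p ∉ N := fun h => hE.not_adj_of_adj hab hne hp (Finset.mem_filter.1 h).2.1 hap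
  have haN : a ∉ N := fun h => (Finset.mem_filter.1 h).2.2 .refl
  obtain ⟨u, v, huv, hu, hv⟩ := exists_entering_arc
    (hconn N ((Finset.card_le_card hNS).trans_lt hS) a p haN hpN (fun h => hp (h ▸ .refl)))
    {v | ¬ CoConn E a v} (fun h => h .refl) hp
  have hau : CoConn E a u := not_not.1 hu
  exact huv.2.2 (Finset.mem_filter.2 ⟨Finset.mem_univ _,
    hE.adj_of_coConn hau.symm (fun h => hv (hau.trans h)) huv.1, hv⟩)

/-- The completion inherits connectivity. -/
theorem QuasiTrans.completion_connected [Finite V] {E : V → V → Prop} (hE : QuasiTrans E)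
    (Y : Set V) {n : ℕ} (hn : 0 < n)
    (hconn : ∀ S : Finset V, S.card < n → ∀ a b, a ∉ S → b ∉ S → a ≠ b →
      ReflTransGen (Within E (↑S : Set V)ᶜ) a b)
    (S : Finset V) (hS : S.card < n) {a b : V} (ha : a ∉ S) (hb : b ∉ S) (hne : a ≠ b) :
    ReflTransGen (Within (Completion E Y) (↑S : Set V)ᶜ) a b := by
  have key : ∀ a b, a ∉ S → b ∉ S → ¬ CoConn E a b →
      ReflTransGen (Within (Completion E Y) (↑S : Set V)ᶜ) a b := fun a b ha hb hab =>
    ReflTransGen.mono (fun _ _ => Within.mono (fun _ _ h => h.completion) subset_rfl) _ _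
      (hE.transGen_crossArc (hconn S hS a b ha hb (fun h => hab (h ▸ .refl))) hab).to_reflTransGen
  by_cases hab : CoConn E a b
  · obtain ⟨v, hv, hav⟩ := hE.exists_not_coConn_notMem hn hconn hab hne S hS
    exact (key a v ha hv hav).trans (key v b hv hb fun h => hav (hab.trans h.symm))
  · exact key a b ha hb hab

end Reduction

end Linkage

/-- Every 3k-strong quasi-transitive digraph with δ⁺ ≥ 23k is
k-linked (k ≥ 2). -/
theorem quasi_transitive_is_k_linked {V : Type} [Fintype V] (k : ℕ) (hk : 2 ≤ k)
    (G : Digr V) (hqt : G.QuasiTransitive) (hstrong : G.KStrong (3 * k))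
    (hdeg : ∀ v : V, 23 * k ≤ G.outDeg v) :
    G.KLinked k := by
  classical
  have hE : Linkage.QuasiTrans G.Adj := hqt
  have hconn : ∀ S : Finset V, S.card < 3 * k → ∀ a b, a ∉ S → b ∉ S → a ≠ b →
      Relation.ReflTransGen (Linkage.Within G.Adj (↑S : Set V)ᶜ) a b := by
    intro S hS a b ha hb hab
    obtain ⟨p, hp, hpS⟩ := hstrong.2 S (by omega) a ha b hb hab
    exact Linkage.reflTransGen_of_isChain p a hp.1 hp.2.1 hp.2.2.1 hpS
  refine ⟨by have := hstrong.1; omega, fun x y hxy => ?_⟩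
  set Y := Finset.univ.image y with hY
  have hYcard : Y.card ≤ k := Finset.card_image_le.trans (by simp)
  have hmemY : ∀ i, y i ∈ (↑Y : Set V) := fun i =>
    Finset.mem_image_of_mem y (Finset.mem_univ i)
  obtain ⟨S, hdisj, hS⟩ := Linkage.exists_disjoint_connecting_sets
    (Linkage.Completion G.Adj (↑Y : Set V)) (by omega) x y hxy
    (by
      intro u v huv hv
      have hvY : v ∉ (↑Y : Set V) := fun h => by
        obtain ⟨j, _, hj⟩ := Finset.mem_image.1 (Finset.mem_coe.1 h)
        exact hv j hj.symm
      by_cases h : Linkage.CoConn G.Adj u v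
      · exact .inl ⟨huv, .inr ⟨h, hvY⟩⟩
      · exact (Linkage.adj_of_not_coConn h).imp
          (fun h' => Linkage.CrossArc.completion ⟨h', h⟩)
          (fun h' => Linkage.CrossArc.completion ⟨h', fun h'' => h h''.symm⟩))
    (by
      intro v
      have h1 := hdeg v
      rw [Digr.outDeg, Set.ncard_eq_toFinset_card'] at h1
      have h2 := Finset.le_card_sdiff Y {w | G.Adj v w}.toFinset
      refine le_trans (by omega) (Finset.card_le_card (s := {w | G.Adj v w}.toFinset \ Y) ?_)
      intro w hw
      simp only [Finset.mem_sdiff, Set.mem_toFinset, Set.mem_ofPred_eq, Finset.mem_filter,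
        Finset.mem_univ, true_and] at hw ⊢
      refine ⟨⟨fun h => G.irrefl v (h ▸ hw.1), ?_⟩, hw.2⟩
      by_cases h : Linkage.CoConn G.Adj v w
      · exact .inr ⟨h, hw.2⟩
      · exact .inl ⟨hw.1, h⟩)
    (fun S hS a b ha hb hab => hE.completion_connected _ (by omega) hconn S hS ha hb hab)
  choose P hP using fun i => Linkage.exists_nodup_of_reflTransGen
    (hE.reflTransGen_of_completion (hmemY i) (hS i).2) (hS i).1
  refine ⟨P, fun i => ⟨(hP i).1, (hP i).2.1, (hP i).2.2.1, (hP i).2.2.2.1⟩,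
    fun i j hij v hvi hvj => ?_⟩
  exact Finset.disjoint_left.1 (hdisj i j hij) ((hP i).2.2.2.2 v hvi) ((hP j).2.2.2.2 v hvj)
end

section
/- Let k ≥ 2 and l ≥ 2 be integers. Every 81k²(l+2)²-strong l-quasi-transitive digraph is k-linked. -/
namespace Digr

/-- An l-quasi-transitive digraph: whenever there is a path of length l (i.e. with
l arcs, hence l+1 vertices) from u to v, the vertices u and v are adjacent. -/
def LQuasiTransitive {V : Type} (G : Digr V) (l : ℕ) : Prop :=
  ∀ u v : V, (∃ p : List V, G.IsPathFrom p u v ∧ p.length = l + 1) →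
    (G.Adj u v ∨ G.Adj v u)

end Digr

namespace Digr

section Sequences

variable {V : Type}

/-- The list `z 0, z 1, …, z n`. -/
def initialSeg (z : ℕ → V) (n : ℕ) : List V := (List.range (n + 1)).map z

theorem length_initialSeg (z : ℕ → V) (n : ℕ) : (initialSeg z n).length = n + 1 := by
  simp [initialSeg]

theorem mem_initialSeg {z : ℕ → V} {n : ℕ} {v : V} :
    v ∈ initialSeg z n ↔ ∃ i ≤ n, z i = v := by
  simp [initialSeg]

theorem head?_initialSeg (z : ℕ → V) (n : ℕ) : (initialSeg z n).head? = some (z 0) := by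
  simp [initialSeg, List.range_succ_eq_map]

theorem getLast?_initialSeg (z : ℕ → V) (n : ℕ) : (initialSeg z n).getLast? = some (z n) := by
  simp [initialSeg, List.range_succ]

theorem isChain_initialSeg {R : V → V → Prop} {z : ℕ → V} {n : ℕ}
    (h : ∀ i < n, R (z i) (z (i + 1))) : (initialSeg z n).IsChain R := by
  rw [initialSeg, List.isChain_map, List.isChain_range]
  intro m hm
  exact h m (by omega)

theorem nodup_initialSeg {z : ℕ → V} {n : ℕ}
    (h : ∀ i ≤ n, ∀ j ≤ n, z i = z j → i = j) : (initialSeg z n).Nodup := by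
  refine List.Nodup.map_on ?_ List.nodup_range
  intro i hi j hj hij
  simp only [List.mem_range] at hi hj
  exact h i (by omega) j (by omega) hij

end Sequences

variable {V : Type} {G : Digr V} {l : ℕ}

theorem LQuasiTransitive.adj_or_adj (hqt : G.LQuasiTransitive l) {z : ℕ → V}
    (hinj : ∀ i ≤ l, ∀ j ≤ l, z i = z j → i = j) (harc : ∀ i < l, G.Adj (z i) (z (i + 1))) :
    G.Adj (z 0) (z l) ∨ G.Adj (z l) (z 0) :=
  hqt _ _ ⟨initialSeg z l, ⟨head?_initialSeg z l, getLast?_initialSeg z l,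
    isChain_initialSeg harc, nodup_initialSeg hinj⟩, length_initialSeg z l⟩

/-- The end of a long path without forward chords dominates every earlier vertex whose
distance from it is at least `l` and has the parity of `l`. -/
theorem LQuasiTransitive.adj_back (hqt : G.LQuasiTransitive l) (hl : 2 ≤ l) {z : ℕ → V} {n : ℕ}
    (hinj : ∀ i ≤ n, ∀ j ≤ n, z i = z j → i = j) (harc : ∀ i < n, G.Adj (z i) (z (i + 1)))
    (hchord : ∀ i j, i + 2 ≤ j → j ≤ n → ¬ G.Adj (z i) (z j)) (m : ℕ) (hm : l + 2 * m ≤ n) :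
    G.Adj (z n) (z (n - l - 2 * m)) := by
  have back : ∀ i, i + l ≤ n → G.Adj (z (i + l)) (z i) := by
    intro i hi
    have h := hqt.adj_or_adj (z := fun t => z (i + t))
      (fun a ha b hb hab => by
        have := hinj (i + a) (by omega) (i + b) (by omega) hab
        omega)
      (fun a ha => harc (i + a) (by omega))
    exact h.resolve_left (hchord _ _ (by omega) hi)
  induction m with
  | zero =>
    have := back (n - l) (by omega)
    rwa [Nat.sub_add_cancel (by omega)] at this
  | succ m ih =>
    have ih := ih (by omega)
    obtain ⟨c, hc⟩ : ∃ c, n - l - 2 * m = c + 2 := ⟨n - l - 2 * m - 2, by omega⟩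
    rw [hc] at ih
    have hc' : n - l - 2 * (m + 1) = c := by omega
    rw [hc']
    let f : ℕ → ℕ := fun t => if t = 0 then n else if t = l then c else c + 1 + t
    have hf : ∀ t ≤ l, f t ≤ n := by
      intro t ht
      simp only [f]
      split_ifs <;> omega
    have h := hqt.adj_or_adj (z := fun t => z (f t))
      (fun a ha b hb hab => by
        have := hinj _ (hf a ha) _ (hf b hb) hab
        simp only [f] at this
        split_ifs at this <;> omega)
      (fun a ha => by
        simp only [f]
        rcases Nat.eq_zero_or_pos a with rfl | ha0
        · by_cases h1 : 0 + 1 = l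
          · omega
          · simpa [h1] using ih
        · by_cases h1 : a + 1 = l
          · have h2 := back c (by omega)
            have h3 : c + 1 + a = c + l := by omega
            simpa [h1, ha0.ne', ha.ne, h3, show l ≠ 0 by omega] using h2
          · have h2 := harc (c + 1 + a) (by omega)
            simpa [h1, ha0.ne', ha.ne, add_assoc] using h2)
    have h0 : f 0 = n := by simp [f]
    have h1 : f l = c := by simp [f]; omega
    simp only [h0, h1] at h
    exact h.resolve_right (hchord _ _ (by omega) le_rfl)

/-- There is a walk of length `n` from `x` to `y` inside `A`. -/
def HasWalk (G : Digr V) (A : Set V) (n : ℕ) (x y : V) : Prop :=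
  ∃ z : ℕ → V, z 0 = x ∧ z n = y ∧ (∀ i ≤ n, z i ∈ A) ∧ ∀ i < n, G.Adj (z i) (z (i + 1))

theorem HasWalk.trans {A : Set V} {m n : ℕ} {x y w : V} (h₁ : G.HasWalk A m x y)
    (h₂ : G.HasWalk A n y w) : G.HasWalk A (m + n) x w := by
  obtain ⟨z₁, hx, hy, hA, harc⟩ := h₁
  obtain ⟨z₂, hx', hy', hA', harc'⟩ := h₂
  refine ⟨fun t => if t ≤ m then z₁ t else z₂ (t - m), by simp [hx], ?_, ?_, ?_⟩
  · rcases Nat.eq_zero_or_pos n with rfl | hn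
    · simp [hy, ← hy', hx']
    · simp [hn.ne', hy']
  · intro i hi
    dsimp only
    split_ifs with h
    · exact hA i h
    · exact hA' _ (by omega)
  · intro i hi
    dsimp only
    by_cases h : i + 1 ≤ m
    · rw [if_pos (by omega), if_pos h]
      exact harc i (by omega)
    · rw [if_neg h]
      by_cases h' : i ≤ m
      · have : i = m := by omega
        subst this
        rw [if_pos le_rfl, hy, ← hx', Nat.add_sub_cancel_left]
        exact harc' 0 (by omega)
      · rw [if_neg h', Nat.sub_add_comm (by omega)]
        exact harc' _ (by omega)

theorem hasWalk_one {A : Set V} {u v : V} (hu : u ∈ A) (hv : v ∈ A) (h : G.Adj u v) :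
    G.HasWalk A 1 u v :=
  ⟨fun t => if t = 0 then u else v, by simp, by simp,
    fun i _ => by dsimp only; split_ifs <;> assumption,
    fun i hi => by obtain rfl : i = 0 := by omega
                   simpa using h⟩

theorem StronglyConnectedOn.exists_hasWalk {A : Set V} (h : G.StronglyConnectedOn A) {x y : V}
    (hx : x ∈ A) (hy : y ∈ A) : ∃ n, G.HasWalk A n x y := by
  by_cases hxy : x = y
  · subst hxy
    exact ⟨0, fun _ => x, rfl, rfl, fun _ _ => hx, fun i hi => by omega⟩
  obtain ⟨p, ⟨hhead, hlast, hchain, -⟩, hpA⟩ := h x hx y hy hxy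
  have hpos : 0 < p.length := by
    rcases p with _ | ⟨a, p⟩ <;> simp_all
  refine ⟨p.length - 1, fun t => p.getD t x, ?_, ?_, ?_, ?_⟩
  · simp [List.getD_eq_getElem?_getD, ← List.head?_eq_getElem?, hhead]
  · simp [List.getD_eq_getElem?_getD, ← List.getLast?_eq_getElem?, hlast]
  · intro i hi
    have hi' : i < p.length := by omega
    simp only [List.getD_eq_getElem _ _ hi']
    exact hpA _ (List.getElem_mem _)
  · intro i hi
    have hi' : i + 1 < p.length := by omega
    simp only [List.getD_eq_getElem _ _ hi', List.getD_eq_getElem _ _ (Nat.lt_of_succ_lt hi')]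
    exact List.isChain_iff_getElem.1 hchain i hi'

/-- The length of a shortest walk from `x` to `y` inside `A`. -/
noncomputable def walkDist (G : Digr V) (A : Set V) (x y : V) : ℕ :=
  sInf {n | G.HasWalk A n x y}

theorem HasWalk.walkDist_le {A : Set V} {n : ℕ} {x y : V} (h : G.HasWalk A n x y) :
    G.walkDist A x y ≤ n := Nat.sInf_le h

section Distance

variable {A : Set V} {r : V}

theorem StronglyConnectedOn.hasWalk_walkDist (hA : G.StronglyConnectedOn A) {x y : V}
    (hx : x ∈ A) (hy : y ∈ A) : G.HasWalk A (G.walkDist A x y) x y :=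
  Nat.sInf_mem (s := {n | G.HasWalk A n x y}) (hA.exists_hasWalk hx hy)

theorem StronglyConnectedOn.walkDist_le_succ (hA : G.StronglyConnectedOn A) (hr : r ∈ A) {u v : V}
    (hu : u ∈ A) (hv : v ∈ A) (h : G.Adj u v) : G.walkDist A r v ≤ G.walkDist A r u + 1 :=
  ((hA.hasWalk_walkDist hr hu).trans (hasWalk_one hu hv h)).walkDist_le

theorem StronglyConnectedOn.exists_geodesic (hA : G.StronglyConnectedOn A) (hr : r ∈ A) {v : V}
    (hv : v ∈ A) : ∃ z : ℕ → V, z 0 = r ∧ z (G.walkDist A r v) = v ∧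
      (∀ i ≤ G.walkDist A r v, z i ∈ A ∧ G.walkDist A r (z i) = i) ∧
      ∀ i < G.walkDist A r v, G.Adj (z i) (z (i + 1)) := by
  obtain ⟨z, h0, hn, hzA, harc⟩ := hA.hasWalk_walkDist hr hv
  refine ⟨z, h0, hn, fun i hi => ⟨hzA i hi, le_antisymm ?_ ?_⟩, harc⟩
  · exact HasWalk.walkDist_le
      ⟨z, h0, rfl, fun j hj => hzA j (by omega), fun j hj => harc j (by omega)⟩
  · have h₂ : G.HasWalk A (G.walkDist A r v - i) (z i) v :=
      ⟨fun t => z (i + t), rfl, by simp only [Nat.add_sub_cancel' hi, hn],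
        fun j hj => hzA _ (by omega), fun j hj => harc (i + j) (by omega)⟩
    have := ((hA.hasWalk_walkDist hr (hzA i hi)).trans h₂).walkDist_le
    omega

theorem StronglyConnectedOn.geodesic_inj {z : ℕ → V} {n : ℕ}
    (h : ∀ i ≤ n, z i ∈ A ∧ G.walkDist A r (z i) = i) :
    ∀ i ≤ n, ∀ j ≤ n, z i = z j → i = j := by
  intro i hi j hj hij
  rw [← (h i hi).2, ← (h j hj).2, hij]

theorem StronglyConnectedOn.geodesic_not_adj (hA : G.StronglyConnectedOn A) (hr : r ∈ A)
    {z : ℕ → V} {n : ℕ} (h : ∀ i ≤ n, z i ∈ A ∧ G.walkDist A r (z i) = i) :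
    ∀ i j, i + 2 ≤ j → j ≤ n → ¬ G.Adj (z i) (z j) := by
  intro i j hij hj hadj
  have := hA.walkDist_le_succ hr (h i (by omega)).1 (h j hj).1 hadj
  rw [(h i (by omega)).2, (h j hj).2] at this
  omega

/-- A vertex far from the root dominates the root when its distance has the parity of `l`. -/
theorem LQuasiTransitive.adj_root (hqt : G.LQuasiTransitive l) (hl : 2 ≤ l)
    (hA : G.StronglyConnectedOn A) (hr : r ∈ A) {u : V} (hu : u ∈ A) {m : ℕ}
    (hm : G.walkDist A r u = l + 2 * m) : G.Adj u r := by
  obtain ⟨z, h0, hn, hz, harc⟩ := hA.exists_geodesic hr hu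
  have := hqt.adj_back hl (StronglyConnectedOn.geodesic_inj hz) harc
    (hA.geodesic_not_adj hr hz) m hm.ge
  rwa [hn, hm, show l + 2 * m - l - 2 * m = 0 by omega, h0] at this

/-- A vertex dominating the root dominates all lower layers whose index is a multiple
of `l - 1`. -/
theorem LQuasiTransitive.adj_of_adj_root (hqt : G.LQuasiTransitive l) (hl : 2 ≤ l)
    (hA : G.StronglyConnectedOn A) (hr : r ∈ A) {u : V} (hu : u ∈ A) (hur : G.Adj u r) (j : ℕ)
    (hj : j * (l - 1) + 2 ≤ G.walkDist A r u) {v : V} (hv : v ∈ A)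
    (hvj : G.walkDist A r v = j * (l - 1)) : G.Adj u v := by
  induction j generalizing v with
  | zero =>
    obtain ⟨z, h0, hn, hz, harc⟩ := hA.exists_geodesic hr hv
    rw [hvj, Nat.zero_mul, h0] at hn
    rwa [← hn]
  | succ j ih =>
    obtain ⟨z, h0, hn, hz, harc⟩ := hA.exists_geodesic hr hv
    rw [hvj] at hn hz harc
    rw [Nat.succ_mul] at hj hn hz harc hvj
    set c := j * (l - 1) with hc
    have hz' := hz c (by omega)
    have hc' := ih (by omega) hz'.1 hz'.2
    let w : ℕ → V := fun t => if t = 0 then u else z (c + (t - 1))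
    have h := hqt.adj_or_adj (z := w)
      (fun a ha b hb hab => by
        by_cases ha0 : a = 0 <;> by_cases hb0 : b = 0
        · omega
        · simp only [w, ha0, hb0, if_true, if_false] at hab
          have := (hz (c + (b - 1)) (by omega)).2
          rw [← hab] at this
          omega
        · simp only [w, ha0, hb0, if_true, if_false] at hab
          have := (hz (c + (a - 1)) (by omega)).2
          rw [hab] at this
          omega
        · simp only [w, ha0, hb0, if_false] at hab
          have := StronglyConnectedOn.geodesic_inj hz _ (by omega) _ (by omega) hab
          omega)
      (fun a ha => by
        rcases Nat.eq_zero_or_pos a with rfl | ha0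
        · simpa [w] using hc'
        · have := harc (c + (a - 1)) (by omega)
          rw [show c + (a - 1) + 1 = c + a by omega] at this
          simpa [w, ha0.ne'] using this)
    have hwl : w l = v := by
      simp only [w, show l ≠ 0 by omega, if_false, hn]
    rw [hwl] at h
    refine h.resolve_right fun hvu => ?_
    have := hA.walkDist_le_succ hr hv hu hvu
    omega

end Distance

/-- A bounded-length path inside `C` from `x` to a vertex lying in `W` or having an
in-neighbour in `W`. -/
theorem LQuasiTransitive.exists_short_path (hqt : G.LQuasiTransitive l) (hl : 2 ≤ l) {C W : Set V}
    (hC : G.StronglyConnectedOn C) {x : V} (hx : x ∈ C) (hW : ∃ w ∈ W, w ∈ C) :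
    ∃ p w, G.IsPathOn C p x w ∧ p.length ≤ l + 1 ∧
      (w ∈ W ∨ ∃ w' ∈ W, w' ∈ C ∧ G.Adj w' w) := by
  obtain ⟨w, hwW, hwC⟩ := hW
  obtain ⟨z, h0, hn, hz, harc⟩ := hC.exists_geodesic hx hwC
  have hinj := StronglyConnectedOn.geodesic_inj hz
  have hchord := hC.geodesic_not_adj hx hz
  generalize G.walkDist C x w = n at *
  have key : ∀ i ≤ n, i ≤ l → (z i ∈ W ∨ ∃ w' ∈ W, w' ∈ C ∧ G.Adj w' (z i)) →
      ∃ p w, G.IsPathOn C p x w ∧ p.length ≤ l + 1 ∧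
        (w ∈ W ∨ ∃ w' ∈ W, w' ∈ C ∧ G.Adj w' w) := by
    intro i hi hil h
    refine ⟨initialSeg z i, z i, ⟨⟨?_, getLast?_initialSeg z i,
      isChain_initialSeg fun j hj => harc j (by omega),
      nodup_initialSeg fun a ha b hb => hinj a (by omega) b (by omega)⟩, ?_⟩, ?_, h⟩
    · rw [head?_initialSeg, h0]
    · intro v hv
      obtain ⟨j, hj, rfl⟩ := mem_initialSeg.1 hv
      exact (hz j (by omega)).1
    · rw [length_initialSeg]
      omega
  by_cases hnl : n ≤ l
  · exact key n le_rfl hnl (Or.inl (hn ▸ hwW))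
  · obtain ⟨m, hm | hm⟩ := Nat.even_or_odd' (n - l)
    · have := hqt.adj_back hl hinj harc hchord m (by omega)
      rw [hn, hm, Nat.sub_self] at this
      exact key 0 (by omega) (by omega) (Or.inr ⟨w, hwW, hwC, this⟩)
    · have := hqt.adj_back hl hinj harc hchord m (by omega)
      rw [hn, hm, Nat.add_sub_cancel_left] at this
      exact key 1 (by omega) (by omega) (Or.inr ⟨w, hwW, hwC, this⟩)

end Digr

namespace Digr

section Reversal

variable {V : Type} {G : Digr V} {l : ℕ}

/-- The digraph with all arcs reversed. -/
def rev (G : Digr V) : Digr V := ⟨fun u v => G.Adj v u, G.irrefl⟩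

theorem isPathFrom_rev {p : List V} {x y : V} :
    G.rev.IsPathFrom p x y ↔ G.IsPathFrom p.reverse y x := by
  simp only [IsPathFrom, List.head?_reverse, List.getLast?_reverse, List.nodup_reverse,
    List.Chain', List.isChain_reverse, rev]
  tauto

theorem isPathOn_rev {A : Set V} {p : List V} {x y : V} :
    G.rev.IsPathOn A p x y ↔ G.IsPathOn A p.reverse y x := by
  simp only [IsPathOn, isPathFrom_rev, List.mem_reverse]

theorem LQuasiTransitive.rev (h : G.LQuasiTransitive l) : G.rev.LQuasiTransitive l := by
  rintro u v ⟨p, hp, hlen⟩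
  exact h v u ⟨p.reverse, isPathFrom_rev.1 hp, by rwa [List.length_reverse]⟩

theorem StronglyConnectedOn.rev {A : Set V} (h : G.StronglyConnectedOn A) :
    G.rev.StronglyConnectedOn A := by
  intro x hx y hy hxy
  obtain ⟨p, hp⟩ := h y hy x hx hxy.symm
  exact ⟨p.reverse, isPathOn_rev.2 (by rwa [List.reverse_reverse])⟩

theorem KStrong.rev [Fintype V] {k : ℕ} (h : G.KStrong k) : G.rev.KStrong k :=
  ⟨h.1, fun S hS => (h.2 S hS).rev⟩

/-- A bounded-length path inside `C` to `y` from a vertex lying in `W` or having an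
out-neighbour in `W`. -/
theorem LQuasiTransitive.exists_short_path_to (hqt : G.LQuasiTransitive l) (hl : 2 ≤ l)
    {C W : Set V} (hC : G.StronglyConnectedOn C) {y : V} (hy : y ∈ C) (hW : ∃ w ∈ W, w ∈ C) :
    ∃ p w, G.IsPathOn C p w y ∧ p.length ≤ l + 1 ∧
      (w ∈ W ∨ ∃ w' ∈ W, w' ∈ C ∧ G.Adj w w') := by
  obtain ⟨p, w, hp, hlen, hw⟩ := hqt.rev.exists_short_path hl hC.rev hy hW
  exact ⟨p.reverse, w, isPathOn_rev.1 hp, by rwa [List.length_reverse], hw⟩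

variable [Fintype V] [DecidableEq V]

theorem KStrong.exists_out_neighbor {K : ℕ} (h : G.KStrong K) (x : V) (F : Finset V)
    (hF : F.card + 1 ≤ K) : ∃ v, v ∉ F ∧ G.Adj x v := by
  have hcard : (insert x F).card < (Finset.univ : Finset V).card := by
    have := Finset.card_insert_le x F
    have := h.1
    rw [Finset.card_univ]
    omega
  obtain ⟨t, -, ht⟩ := Finset.exists_mem_notMem_of_card_lt_card hcard
  simp only [Finset.mem_insert, not_or] at ht
  have hS : (F.erase x).card ≤ K - 1 := (Finset.card_le_card (Finset.erase_subset x F)).trans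
    (by omega)
  obtain ⟨p, ⟨hhead, hlast, hchain, hnodup⟩, hpA⟩ :=
    h.2 (F.erase x) hS x (by simp) t (by simp [ht.2]) (Ne.symm ht.1)
  rcases p with _ | ⟨a, _ | ⟨b, p⟩⟩
  · simp at hhead
  · simp at hhead hlast
    exact absurd (hlast.symm.trans hhead) ht.1
  · simp only [List.head?_cons, Option.some.injEq] at hhead
    subst hhead
    refine ⟨b, fun hb => ?_, (List.isChain_cons_cons.1 hchain).1⟩
    have h1 := hpA b (by simp)
    simp only [List.nodup_cons, List.mem_cons, not_or] at hnodup
    simp only [Finset.coe_erase, Set.mem_compl_iff, Set.mem_sdiff, Finset.mem_coe,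
      Set.mem_singleton_iff, not_and, not_not] at h1
    exact hnodup.1.1 (h1 hb).symm

theorem KStrong.exists_in_neighbor {K : ℕ} (h : G.KStrong K) (y : V) (F : Finset V)
    (hF : F.card + 1 ≤ K) : ∃ v, v ∉ F ∧ G.Adj v y :=
  h.rev.exists_out_neighbor y F hF

end Reversal

/-- Lists of bounded length that exist outside any small set can be chosen disjoint. -/
theorem exists_disjoint_lists {V τ : Type} [DecidableEq V] [Fintype τ] (P : τ → List V → Prop)
    (m : ℕ) (h : ∀ i, ∀ F : Finset V, F.card ≤ Fintype.card τ * m →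
      ∃ p, P i p ∧ p.length ≤ m ∧ ∀ v ∈ p, v ∉ F) :
    ∃ p : τ → List V, (∀ i, P i (p i) ∧ (p i).length ≤ m) ∧
      ∀ i j, i ≠ j → ∀ v, v ∈ p i → v ∉ p j := by
  classical
  suffices H : ∀ s : Finset τ, ∃ p : τ → List V, (∀ i ∈ s, P i (p i) ∧ (p i).length ≤ m) ∧
      ∀ i ∈ s, ∀ j ∈ s, i ≠ j → ∀ v, v ∈ p i → v ∉ p j by
    obtain ⟨p, h1, h2⟩ := H Finset.univ
    exact ⟨p, fun i => h1 i (Finset.mem_univ i),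
      fun i j => h2 i (Finset.mem_univ i) j (Finset.mem_univ j)⟩
  intro s
  induction s using Finset.induction_on with
  | empty => exact ⟨fun _ => [], by simp, by simp⟩
  | insert a s ha ih =>
    obtain ⟨p, h1, h2⟩ := ih
    obtain ⟨q, hq, hlen, hF⟩ := h a (s.biUnion fun i => (p i).toFinset) (by
      refine (Finset.card_biUnion_le_card_mul s _ m fun i hi => ?_).trans
        (Nat.mul_le_mul_right m (Finset.card_le_univ s))
      exact (List.toFinset_card_le _).trans (h1 i hi).2)
    simp only [Finset.mem_biUnion, List.mem_toFinset, not_exists, not_and] at hF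
    refine ⟨Function.update p a q, ?_, ?_⟩
    · intro i hi
      by_cases hia : i = a
      · subst hia
        simpa using ⟨hq, hlen⟩
      · simpa [hia] using h1 i (Finset.mem_of_mem_insert_of_ne hi hia)
    · intro i hi j hj hij v hvi hvj
      by_cases hia : i = a
      · have hja : j ≠ a := fun hja => hij (hia.trans hja.symm)
        subst hia
        rw [Function.update_self] at hvi
        rw [Function.update_of_ne hja] at hvj
        exact hF v hvi j (Finset.mem_of_mem_insert_of_ne hj hja) hvj
      · rw [Function.update_of_ne hia] at hvi
        have his := Finset.mem_of_mem_insert_of_ne hi hia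
        by_cases hja : j = a
        · subst hja
          rw [Function.update_self] at hvj
          exact hF v hvj i his hvi
        · rw [Function.update_of_ne hja] at hvj
          exact h2 i his j (Finset.mem_of_mem_insert_of_ne hj hja) hij v hvi hvj

/-- Menger's theorem: if no set of fewer than `|A|` vertices separates `A` from `B`, then
disjoint paths lead from the vertices of `A` into `B`. -/
theorem exists_disjoint_paths {V : Type} [Fintype V] [DecidableEq V] (R : V → V → Prop)
    (A B : Finset V)
    (h : ∀ Z : Finset V, Z.card < A.card → ∃ z : ℕ → V, ∃ n, z 0 ∈ A ∧ z n ∈ B ∧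
      (∀ i ≤ n, z i ∉ Z) ∧ ∀ i < n, R (z i) (z (i + 1))) :
    ∃ P : V → List V, (∀ a ∈ A, (P a).head? = some a ∧ (∃ b ∈ B, (P a).getLast? = some b) ∧
      (P a).IsChain R ∧ (P a).Nodup) ∧
      ∀ a ∈ A, ∀ a' ∈ A, a ≠ a' → ∀ v, v ∈ P a → v ∉ P a' := by
  classical
  let N : {v // v ∉ B} → Finset V := fun v =>
    {w | (w = v.1 ∨ R v.1 w) ∧ w ∉ A}
  obtain ⟨f, hf, hfN⟩ := (Finset.all_card_le_biUnion_card_iff_exists_injective N).1 (by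
    intro s
    by_contra! hs
    let X : Finset V := s.image Subtype.val
    have hXcard : X.card = s.card := Finset.card_image_of_injective _ Subtype.val_injective
    obtain ⟨z, n, h0, hn, hZ, harc⟩ := h ((s.biUnion N ∪ A) \ X) (by
      have h1 : X ⊆ s.biUnion N ∪ A := by
        intro v hv
        obtain ⟨v, hvs, rfl⟩ := Finset.mem_image.1 hv
        by_cases hvA : v.1 ∈ A
        · exact Finset.mem_union_right _ hvA
        · refine Finset.mem_union_left _ (Finset.mem_biUnion.2 ⟨v, hvs, ?_⟩)
          simp [N, hvA]
      have h2 := Finset.card_sdiff_add_card_eq_card h1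
      have h3 := Finset.card_union_le (s.biUnion N) A
      omega)
    have hX : ∀ i ≤ n, z i ∈ X := by
      intro i
      induction i with
      | zero =>
        intro hi
        have := hZ 0 hi
        by_contra hX
        exact this (Finset.mem_sdiff.2 ⟨Finset.mem_union_right _ h0, hX⟩)
      | succ i ih =>
        intro hi
        by_contra hX
        refine hZ (i + 1) hi (Finset.mem_sdiff.2 ⟨?_, hX⟩)
        obtain ⟨v, hvs, hv⟩ := Finset.mem_image.1 (ih (by omega))
        by_cases hA : z (i + 1) ∈ A
        · exact Finset.mem_union_right _ hA
        · refine Finset.mem_union_left _ (Finset.mem_biUnion.2 ⟨v, hvs, ?_⟩)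
          have := harc i (by omega)
          rw [← hv] at this
          simp [N, hA, this]
    obtain ⟨v, -, hv⟩ := Finset.mem_image.1 (hX n le_rfl)
    exact v.2 (hv ▸ hn))
  let g : V → V := fun v => if hv : v ∉ B then f ⟨v, hv⟩ else v
  have hg : ∀ v, v ∉ B → (g v = v ∨ R v (g v)) ∧ g v ∉ A := by
    intro v hv
    have := hfN ⟨v, hv⟩
    simp only [N, Finset.mem_filter, Finset.mem_univ, true_and] at this
    simpa [g, hv] using this
  have hginj : ∀ u v, u ∉ B → v ∉ B → g u = g v → u = v := by
    intro u v hu hv huv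
    simp only [g, hu, hv, not_false_eq_true, dif_pos] at huv
    exact congrArg Subtype.val (hf huv)
  have key : ∀ a ∈ A, ∀ a' ∈ A, ∀ i j, i ≤ j → (∀ t < i, g^[t] a ∉ B) →
      (∀ t < j, g^[t] a' ∉ B) → g^[i] a = g^[j] a' → i = j ∧ a = a' := by
    intro a ha a' ha' i
    induction i with
    | zero =>
      intro j _ _ h2 hij
      rcases j with _ | j
      · exact ⟨rfl, hij⟩
      · rw [Function.iterate_succ_apply'] at hij
        exact absurd ha ((show a = _ from hij) ▸ (hg _ (h2 j (by omega))).2)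
    | succ i ih =>
      intro j hle h1 h2 hij
      obtain ⟨j, rfl⟩ : ∃ j', j = j' + 1 := ⟨j - 1, by omega⟩
      rw [Function.iterate_succ_apply', Function.iterate_succ_apply'] at hij
      have := ih j (by omega) (fun t ht => h1 t (by omega)) (fun t ht => h2 t (by omega))
        (hginj _ _ (h1 i (by omega)) (h2 j (by omega)) hij)
      exact ⟨by omega, this.2⟩
  have key' : ∀ a ∈ A, ∀ a' ∈ A, ∀ i j, (∀ t < i, g^[t] a ∉ B) →
      (∀ t < j, g^[t] a' ∉ B) → g^[i] a = g^[j] a' → i = j ∧ a = a' := by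
    intro a ha a' ha' i j h1 h2 hij
    rcases le_total i j with hle | hle
    · exact key a ha a' ha' i j hle h1 h2 hij
    · have := key a' ha' a ha j i hle h2 h1 hij.symm
      exact ⟨this.1.symm, this.2.symm⟩
  have hend : ∀ a ∈ A, ∃ n, g^[n] a ∈ B ∧ ∀ t < n, g^[t] a ∉ B := by
    intro a ha
    have hex : ∃ n, g^[n] a ∈ B := by
      by_contra! hno
      exact not_injective_infinite_finite (fun n => g^[n] a) fun i j hij =>
        (key' a ha a ha i j (fun t _ => hno t) (fun t _ => hno t) hij).1
    exact ⟨Nat.find hex, Nat.find_spec hex, fun t ht => Nat.find_min hex ht⟩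
  choose! n hnB hnot using hend
  refine ⟨fun a => initialSeg (fun t => g^[t] a) (n a), fun a ha => ⟨head?_initialSeg _ _,
    ⟨_, hnB a ha, getLast?_initialSeg _ _⟩, ?_, ?_⟩, ?_⟩
  · refine isChain_initialSeg fun i hi => ?_
    have h1 := (hg _ (hnot a ha i hi)).1
    rw [← Function.iterate_succ_apply' g] at h1
    refine h1.resolve_left fun heq => ?_
    have := (key' a ha a ha (i + 1) i (fun t ht => hnot a ha t (by omega))
      (fun t ht => hnot a ha t (by omega)) heq).1
    omega
  · exact nodup_initialSeg fun i hi j hj hij => (key' a ha a ha i j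
      (fun t ht => hnot a ha t (by omega)) (fun t ht => hnot a ha t (by omega)) hij).1
  · intro a ha a' ha' hne v hv hv'
    obtain ⟨i, hi, rfl⟩ := mem_initialSeg.1 hv
    obtain ⟨j, hj, hij⟩ := mem_initialSeg.1 hv'
    exact hne (key' a ha a' ha' i j (fun t ht => hnot a ha t (by omega))
      (fun t ht => hnot a' ha' t (by omega)) hij.symm).2

end Digr

namespace Digr

section Tracks

variable {V : Type} {G : Digr V}

/-- A path in `A` that ends at a vertex of potential at least `H` and meets potential at
most `L`. -/
structure IsTrack (G : Digr V) (A : Set V) (φ : V → ℕ) (H L : ℕ) (p : List V) : Prop where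
  chain : p.IsChain G.Adj
  nodup : p.Nodup
  mem : ∀ v ∈ p, v ∈ A
  low : ∃ v ∈ p, φ v ≤ L
  high : ∃ v, p.getLast? = some v ∧ H ≤ φ v

theorem IsTrack.mono {A : Set V} {φ : V → ℕ} {H L L' : ℕ} {p : List V}
    (h : G.IsTrack A φ H L p) (hL : L ≤ L') : G.IsTrack A φ H L' p :=
  ⟨h.chain, h.nodup, h.mem, h.low.imp fun _ hv => ⟨hv.1, hv.2.trans hL⟩, h.high⟩

/-- Discrete intermediate value theorem along a path. -/
theorem exists_mem_eq_of_isChain {A : Set V} {φ : V → ℕ}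
    (hφ : ∀ u ∈ A, ∀ v ∈ A, G.Adj u v → φ v ≤ φ u + 1) {m : ℕ} {v : V} {p : List V}
    (hchain : (v :: p).IsChain G.Adj) (hA : ∀ w ∈ v :: p, w ∈ A) (hv : φ v ≤ m)
    (hlast : ∃ w, (v :: p).getLast? = some w ∧ m ≤ φ w) : ∃ u ∈ v :: p, φ u = m := by
  induction p generalizing v with
  | nil =>
    obtain ⟨w, hw, hm⟩ := hlast
    simp only [List.getLast?_singleton, Option.some.injEq] at hw
    subst hw
    exact ⟨v, by simp, le_antisymm hv hm⟩
  | cons a p ih =>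
    rcases hv.eq_or_lt with heq | hlt
    · exact ⟨v, by simp, heq⟩
    · obtain ⟨hva, hchain'⟩ := List.isChain_cons_cons.1 hchain
      have hstep := hφ v (hA v (by simp)) a (hA a (by simp)) hva
      obtain ⟨u, hu, hum⟩ := ih hchain' (fun w hw => hA w (List.mem_cons_of_mem _ hw)) (by omega)
        (by simpa [List.getLast?_cons_cons] using hlast)
      exact ⟨u, List.mem_cons_of_mem _ hu, hum⟩

theorem IsTrack.exists_split {A : Set V} {φ : V → ℕ}
    (hφ : ∀ u ∈ A, ∀ v ∈ A, G.Adj u v → φ v ≤ φ u + 1) {H L m : ℕ} {p : List V}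
    (h : G.IsTrack A φ H L p) (hL : L ≤ m) (hH : m ≤ H) :
    ∃ s u t, p = s ++ u :: t ∧ φ u = m := by
  obtain ⟨v, hv, hvL⟩ := h.low
  obtain ⟨s, t, rfl⟩ := List.append_of_mem hv
  obtain ⟨w, hw, hwH⟩ := h.high
  obtain ⟨u, hu, hum⟩ := exists_mem_eq_of_isChain hφ (m := m)
    (List.isChain_append.1 h.chain).2.1 (fun w hw => h.mem w (List.mem_append_right _ hw))
    (hvL.trans hL) ⟨w, by simpa [List.getLast?_append] using hw, hH.trans hwH⟩
  obtain ⟨s', t', hst⟩ := List.append_of_mem hu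
  exact ⟨s ++ s', u, t', by rw [hst, List.append_assoc], hum⟩

/-- A track can jump from level `β` down to the level `α` of a second track, while the second
track takes over the rest of the first one. -/
theorem IsTrack.exchange {A : Set V} {φ : V → ℕ}
    (hφ : ∀ u ∈ A, ∀ v ∈ A, G.Adj u v → φ v ≤ φ u + 1) {H L α β : ℕ}
    (hjump : ∀ u ∈ A, ∀ v ∈ A, φ u = β → φ v = α → G.Adj u v)
    (hLα : L ≤ α) (hαβ : α ≤ β) (hβH : β < H) {p q : List V}
    (hp : G.IsTrack A φ H L p) (hq : G.IsTrack A φ H L q) (hpq : ∀ v, v ∈ p → v ∉ q) :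
    ∃ p' q', G.IsTrack A φ H (β + 1) p' ∧ G.IsTrack A φ H (β + 1) q' ∧
      p'.head? = p.head? ∧ p'.getLast? = q.getLast? ∧ q'.getLast? = p.getLast? ∧
      (∀ v, v ∈ p' → v ∉ q') ∧ (∀ v, v ∈ p' → v ∈ p ∨ v ∈ q) ∧ (∀ v, v ∈ q' → v ∈ p) := by
  obtain ⟨s, u, t, rfl, hu⟩ := hp.exists_split hφ (hLα.trans hαβ) hβH.le
  obtain ⟨s', v, t', rfl, hv⟩ := hq.exists_split hφ hLα (hαβ.trans hβH.le)
  have huA := hp.mem u (by simp)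
  have hvA := hq.mem v (by simp)
  obtain ⟨w, hw, hwH⟩ := hp.high
  obtain ⟨b, t, rfl⟩ : ∃ b t₀, t = b :: t₀ := by
    rcases t with _ | ⟨b, t⟩
    · simp only [List.getLast?_append, List.getLast?_singleton, Option.some_or,
        Option.some.injEq] at hw
      subst hw
      omega
    · exact ⟨b, t, rfl⟩
  have hpc := hp.chain
  have hqc := hq.chain
  have hpn := hp.nodup
  have hqn := hq.nodup
  rw [List.isChain_split] at hpc hqc
  have hpc2 := List.isChain_cons_cons.1 hpc.2
  refine ⟨s ++ u :: v :: t', b :: t, ⟨?_, ?_, ?_, ⟨v, by simp, by omega⟩, ?_⟩,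
    ⟨hpc2.2, ?_, fun x hx => hp.mem x (by simp_all), ⟨b, by simp, ?_⟩, ?_⟩, ?_, ?_, ?_,
    ?_, ?_, ?_⟩
  · rw [List.isChain_split, List.isChain_cons_cons]
    exact ⟨hpc.1, hjump u huA v hvA hu hv, hqc.2⟩
  · rw [List.nodup_append] at hpn hqn ⊢
    simp only [List.nodup_cons, List.mem_cons, List.mem_append] at *
    grind
  · intro x hx
    have h1 := hp.mem x
    have h2 := hq.mem x
    simp only [List.mem_append, List.mem_cons] at hx h1 h2
    tauto
  · simpa [List.getLast?_append] using hq.high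
  · exact (List.nodup_cons.1 (List.nodup_append.1 hpn).2.1).2
  · have := hφ u huA b (hp.mem b (by simp)) hpc2.1
    omega
  · exact ⟨w, by simpa [List.getLast?_append] using hw, hwH⟩
  · simp [List.head?_append]
  · simp [List.getLast?_append, List.getLast?_cons]
  · simp [List.getLast?_append, List.getLast?_cons]
  · intro x hx hx'
    have h1 := hpq x
    rw [List.nodup_append] at hpn
    simp only [List.nodup_cons, List.mem_cons, List.mem_append] at *
    grind
  · intro x hx
    simp only [List.mem_cons, List.mem_append] at *
    tauto
  · intro x hx
    simp only [List.mem_cons, List.mem_append] at *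
    tauto

variable {ι : Type} [DecidableEq ι]

/-- The ends of a track and of a distinguished track can be exchanged. -/
theorem exists_swap_tracks {A : Set V} {φ : V → ℕ}
    (hφ : ∀ u ∈ A, ∀ v ∈ A, G.Adj u v → φ v ≤ φ u + 1) {H L α β : ℕ}
    (hjump : ∀ u ∈ A, ∀ v ∈ A, φ u = β → φ v = α → G.Adj u v)
    (hLα : L ≤ α) (hαβ : α ≤ β) (hβH : β < H) {o i : ι} (hi : i ≠ o) {Q : ι → List V}
    (hQ : ∀ j, G.IsTrack A φ H L (Q j)) (hdisj : ∀ i j, i ≠ j → ∀ v, v ∈ Q i → v ∉ Q j) :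
    ∃ Q' : ι → List V, (∀ j, G.IsTrack A φ H (β + 1) (Q' j)) ∧
      (∀ i j, i ≠ j → ∀ v, v ∈ Q' i → v ∉ Q' j) ∧ (∀ j ≠ o, (Q' j).head? = (Q j).head?) ∧
      ∀ j, (Q' j).getLast? = (Q (Equiv.swap i o j)).getLast? := by
  obtain ⟨p, q, hp, hq, hhead, hlast, hlast', hpq, hpsub, hqsub⟩ :=
    (hQ i).exchange hφ hjump hLα hαβ hβH (hQ o) (hdisj i o hi)
  have hval : ∀ j, Function.update (Function.update Q i p) o q j =
      if j = o then q else if j = i then p else Q j := by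
    intro j
    simp [Function.update_apply]
  refine ⟨Function.update (Function.update Q i p) o q, ?_, ?_, ?_, ?_⟩
  · intro j
    rw [hval]
    split_ifs
    exacts [hq, hp, (hQ j).mono (by omega)]
  · intro a b hab v hva hvb
    rw [hval] at hva hvb
    have hai := hdisj a i
    have hao := hdisj a o
    have hib := hdisj i b
    have hob := hdisj o b
    have hab' := hdisj a b hab v
    split_ifs at hva hvb <;> grind
  · intro j hj
    rw [hval, if_neg hj]
    split_ifs with h
    · rw [h, hhead]
    · rfl
  · intro j
    rw [hval]
    split_ifs with h h'
    · rw [h, Equiv.swap_apply_right, hlast']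
    · rw [h', Equiv.swap_apply_left, hlast]
    · rw [Equiv.swap_apply_of_ne_of_ne h' h]

/-- Tracks with permuted ends can be rearranged, using a distinguished spare track, so that
every other track reaches its own end. -/
theorem exists_sorted_tracks [Fintype ι] {A : Set V} {φ : V → ℕ}
    (hφ : ∀ u ∈ A, ∀ v ∈ A, G.Adj u v → φ v ≤ φ u + 1) {H P e t₀ : ℕ} (he : e < P)
    (hjump : ∀ t, ∀ u ∈ A, ∀ v ∈ A, φ u = t * P + e → φ v = t * P → G.Adj u v)
    (o : ι) (hH : (t₀ + 2 * Fintype.card ι) * P + e < H) {Q : ι → List V} {b : ι → V}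
    (σ : Equiv.Perm ι) (hQ : ∀ j, G.IsTrack A φ H (t₀ * P) (Q j))
    (hdisj : ∀ i j, i ≠ j → ∀ v, v ∈ Q i → v ∉ Q j)
    (hlast : ∀ j, (Q j).getLast? = some (b (σ j))) :
    ∃ Q' : ι → List V, (∀ j, (Q' j).IsChain G.Adj ∧ (Q' j).Nodup ∧ ∀ v ∈ Q' j, v ∈ A) ∧
      (∀ i j, i ≠ j → ∀ v, v ∈ Q' i → v ∉ Q' j) ∧
      ∀ j ≠ o, (Q' j).head? = (Q j).head? ∧ (Q' j).getLast? = some (b j) := by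
  have swap : ∀ t < t₀ + 2 * Fintype.card ι, ∀ i ≠ o, ∀ Q : ι → List V, ∀ τ : Equiv.Perm ι,
      (∀ j, G.IsTrack A φ H (t * P) (Q j)) → (∀ i j, i ≠ j → ∀ v, v ∈ Q i → v ∉ Q j) →
      (∀ j, (Q j).getLast? = some (b (τ j))) →
      ∃ Q' : ι → List V, (∀ j, G.IsTrack A φ H ((t + 1) * P) (Q' j)) ∧
        (∀ i j, i ≠ j → ∀ v, v ∈ Q' i → v ∉ Q' j) ∧ (∀ j ≠ o, (Q' j).head? = (Q j).head?) ∧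
        ∀ j, (Q' j).getLast? = some (b (τ (Equiv.swap i o j))) := by
    intro t ht i hi Q τ h1 h2 h3
    have ht' : t * P + e < H := by
      have := Nat.mul_le_mul_right P ht.le
      omega
    obtain ⟨Q', h1', h2', h3', h4'⟩ := exists_swap_tracks hφ (hjump t) le_rfl
      (Nat.le_add_right _ _) ht' hi h1 h2
    refine ⟨Q', fun j => (h1' j).mono ?_, h2', h3', fun j => by rw [h4', h3]⟩
    rw [Nat.succ_mul]
    omega
  suffices hs : ∀ s : Finset ι, o ∉ s → ∃ (Q' : ι → List V) (τ : Equiv.Perm ι),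
      (∀ j, G.IsTrack A φ H ((t₀ + 2 * s.card) * P) (Q' j)) ∧
      (∀ i j, i ≠ j → ∀ v, v ∈ Q' i → v ∉ Q' j) ∧ (∀ j ≠ o, (Q' j).head? = (Q j).head?) ∧
      (∀ j, (Q' j).getLast? = some (b (τ j))) ∧ ∀ j ∈ s, τ j = j by
    obtain ⟨Q', τ, h1, h2, h3, h4, h5⟩ := hs (Finset.univ.erase o) (by simp)
    refine ⟨Q', fun j => ⟨(h1 j).chain, (h1 j).nodup, (h1 j).mem⟩, h2, fun j hj => ⟨h3 j hj, ?_⟩⟩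
    rw [h4, h5 j (by simp [hj])]
  intro s
  induction s using Finset.induction_on with
  | empty => exact fun _ => ⟨Q, σ, by simpa using hQ, hdisj, fun _ _ => rfl, hlast, by simp⟩
  | insert i s his ih =>
    intro ho
    simp only [Finset.mem_insert, not_or] at ho
    obtain ⟨Q', τ, h1, h2, h3, h4, h5⟩ := ih ho.2
    have hcard : s.card + 1 ≤ Fintype.card ι := by
      rw [← Finset.card_insert_of_notMem his]
      exact Finset.card_le_univ _
    rw [Finset.card_insert_of_notMem his]
    have hj : ∃ j, τ j = i := τ.surjective i
    obtain ⟨j, hj⟩ := hj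
    have hjs : j ∉ s := fun h => his (by rwa [← hj, h5 j h])
    have hne : ∀ m ∈ s, m ≠ i ∧ m ≠ o ∧ m ≠ j :=
      fun m hm => ⟨fun h => his (h ▸ hm), fun h => ho.2 (h ▸ hm), fun h => hjs (h ▸ hm)⟩
    have mono : ∀ {c d : ℕ} {p : List V}, G.IsTrack A φ H (c * P) p → c ≤ d →
        G.IsTrack A φ H (d * P) p := fun h hcd => h.mono (Nat.mul_le_mul_right P hcd)
    by_cases hji : j = i
    · refine ⟨Q', τ, fun m => mono (h1 m) (by omega), h2, h3, h4, fun m hm => ?_⟩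
      rcases Finset.mem_insert.1 hm with rfl | hm
      · rwa [hji] at hj
      · exact h5 m hm
    by_cases hjo : j = o
    · obtain ⟨Q₁, g1, g2, g3, g4⟩ := swap _ (by omega) i (Ne.symm ho.1) Q' τ h1 h2 h4
      refine ⟨Q₁, τ * Equiv.swap i o, fun m => mono (g1 m) (by omega), g2,
        fun m hm => (g3 m hm).trans (h3 m hm), g4, fun m hm => ?_⟩
      rw [Equiv.Perm.mul_apply]
      rcases Finset.mem_insert.1 hm with rfl | hm
      · rw [Equiv.swap_apply_left, ← hjo, hj]
      · rw [Equiv.swap_apply_of_ne_of_ne (hne m hm).1 (hne m hm).2.1, h5 m hm]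
    · obtain ⟨Q₁, g1, g2, g3, g4⟩ := swap _ (by omega) j hjo Q' τ h1 h2 h4
      obtain ⟨Q₂, f1, f2, f3, f4⟩ := swap _ (by omega) i (Ne.symm ho.1) Q₁ (τ * Equiv.swap j o)
        g1 g2 g4
      refine ⟨Q₂, τ * Equiv.swap j o * Equiv.swap i o, fun m => mono (f1 m) (by omega), f2,
        fun m hm => ((f3 m hm).trans (g3 m hm)).trans (h3 m hm), f4, fun m hm => ?_⟩
      rw [Equiv.Perm.mul_apply, Equiv.Perm.mul_apply]
      rcases Finset.mem_insert.1 hm with rfl | hm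
      · rw [Equiv.swap_apply_left, Equiv.swap_apply_right, hj]
      · rw [Equiv.swap_apply_of_ne_of_ne (hne m hm).1 (hne m hm).2.1,
          Equiv.swap_apply_of_ne_of_ne (hne m hm).2.2 (hne m hm).2.1, h5 m hm]

end Tracks

end Digr

namespace Digr

section Linkage

variable {V : Type} {G : Digr V} {l : ℕ}

theorem mem_of_isChain_of_head? {A : Set V} {p : List V} {a : V}
    (h : p.IsChain fun u v => G.Adj u v ∧ u ∈ A ∧ v ∈ A) (ha : p.head? = some a) (haA : a ∈ A) :
    ∀ v ∈ p, v ∈ A := by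
  induction p generalizing a with
  | nil => simp
  | cons b p ih =>
    simp only [List.head?_cons, Option.some.injEq] at ha
    subst ha
    rcases p with _ | ⟨c, p⟩
    · simpa using haA
    · have h' := List.isChain_cons_cons.1 h
      exact List.forall_mem_cons.2 ⟨haA, ih h'.2 rfl h'.1.2.2⟩

theorem isChain_append_of_head? {R : V → V → Prop} {s q : List V} {a : V}
    (hs : (s ++ [a]).IsChain R) (hq : q.IsChain R) (ha : q.head? = some a) :
    (s ++ q).IsChain R := by
  obtain ⟨t, rfl⟩ := List.head?_eq_some_iff.1 ha
  exact List.isChain_split.2 ⟨hs, hq⟩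

theorem isChain_append_of_getLast? {R : V → V → Prop} {q t : List V} {b : V}
    (hq : q.IsChain R) (ht : (b :: t).IsChain R) (hb : q.getLast? = some b) :
    (q ++ t).IsChain R := by
  obtain ⟨s, rfl⟩ := List.getLast?_eq_some_iff.1 hb
  rw [List.append_assoc]
  exact List.isChain_split.2 ⟨hq, ht⟩

variable [Fintype V] [DecidableEq V] {ι : Type} [Fintype ι]

/-- Linking is possible when all distances remain small after deleting few vertices. -/
theorem KStrong.exists_linkage_of_walkDist_lt {K M : ℕ} (hK : G.KStrong K) {x y : ι → V}
    (hxy : Function.Injective (Sum.elim x y)) (T : Finset V) (hx : ∀ i, x i ∈ T)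
    (hy : ∀ i, y i ∈ T) (hTK : T.card + Fintype.card ι * M + 1 ≤ K)
    (hnear : ∀ S : Finset V, T ⊆ S → S.card ≤ T.card + Fintype.card ι * M →
      ∀ u v, u ∉ S → v ∉ S → G.walkDist (↑S : Set V)ᶜ u v < M) :
    ∃ P : ι → List V, (∀ i, G.IsPathFrom (P i) (x i) (y i)) ∧
      ∀ i j, i ≠ j → ∀ v, v ∈ P i → v ∉ P j := by
  obtain ⟨p, hp, hdisj⟩ := exists_disjoint_lists
    (fun (i : ι) (p : List V) => ∃ x' y', G.Adj (x i) x' ∧ G.Adj y' (y i) ∧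
      G.IsPathOn (↑T : Set V)ᶜ p x' y') M (by
    intro i F hF
    have hS := (Finset.card_union_le T F).trans (Nat.add_le_add_left hF _)
    obtain ⟨x', hx', hxx'⟩ := hK.exists_out_neighbor (x i) (T ∪ F) (by omega)
    obtain ⟨y', hy', hyy'⟩ := hK.exists_in_neighbor (y i) (T ∪ F) (by omega)
    have hdist := hnear _ Finset.subset_union_left hS x' y' hx' hy'
    have hstr := hK.2 (T ∪ F) (by omega)
    obtain ⟨z, h0, hn, hz, harc⟩ := hstr.exists_geodesic (r := x') (v := y')
      (by simpa using hx') (by simpa using hy')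
    have hmem : ∀ v ∈ initialSeg z (G.walkDist (↑(T ∪ F) : Set V)ᶜ x' y'), v ∉ T ∪ F := by
      intro v hv
      obtain ⟨j, hj, rfl⟩ := mem_initialSeg.1 hv
      simpa using (hz j hj).1
    refine ⟨initialSeg z _, ⟨x', y', hxx', hyy', ⟨by rw [head?_initialSeg, h0],
      by rw [getLast?_initialSeg, hn], isChain_initialSeg harc,
      nodup_initialSeg (StronglyConnectedOn.geodesic_inj hz)⟩, ?_⟩, ?_, ?_⟩
    · intro v hv hvT
      exact hmem v hv (Finset.mem_union_left _ hvT)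
    · rw [length_initialSeg]
      exact hdist
    · exact fun v hv hvF => hmem v hv (Finset.mem_union_right _ hvF))
  choose hp _ using hp
  choose x' y' hxx' hyy' hp using hp
  have hpT : ∀ i, ∀ v ∈ p i, v ∉ T := fun i => (hp i).2
  refine ⟨fun i => x i :: (p i ++ [y i]), fun i => ⟨rfl, by simp [List.getLast?_cons], ?_, ?_⟩, ?_⟩
  · have h1 : ([x i] ++ p i).IsChain G.Adj := isChain_append_of_head? (a := x' i)
      (by simpa using hxx' i) (hp i).1.2.2.1 (hp i).1.1
    refine isChain_append_of_getLast? (b := y' i) (q := x i :: p i) (t := [y i]) h1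
      (by simpa using hyy' i) ?_
    simp [List.getLast?_cons, (hp i).1.2.1]
  · have h1 := hpT i
    have h2 := (hp i).1.2.2.2
    have h3 : x i ≠ y i := fun h => by simpa using hxy (a₁ := Sum.inl i) (a₂ := Sum.inr i) h
    have hxi := hx i
    have hyi := hy i
    simp only [List.nodup_cons, List.nodup_append, List.mem_append, List.mem_singleton]
    grind
  · intro i j hij v hvi hvj
    have h1 : x i ≠ x j := fun h => hij (by simpa using hxy (a₁ := Sum.inl i) (a₂ := Sum.inl j) h)
    have h2 : y i ≠ y j := fun h => hij (by simpa using hxy (a₁ := Sum.inr i) (a₂ := Sum.inr j) h)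
    have h3 : x i ≠ y j := fun h => by simpa using hxy (a₁ := Sum.inl i) (a₂ := Sum.inr j) h
    have h4 : x j ≠ y i := fun h => by simpa using hxy (a₁ := Sum.inl j) (a₂ := Sum.inr i) h
    have h5 := hpT i
    have h6 := hpT j
    have h7 := hdisj i j hij v
    have := hx i
    have := hx j
    have := hy i
    have := hy j
    simp only [List.mem_cons, List.mem_append, List.not_mem_nil, or_false] at hvi hvj
    grind

end Linkage

end Digr

namespace Digr

theorem nodup_cons_append_append_append {V : Type} {x y : V} {s m t : List V} {S U : Finset V}
    (hs : s.Nodup) (hm : m.Nodup) (ht : t.Nodup) (hsU : ∀ v ∈ s, v ∉ S ∧ v ∈ U)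
    (hmU : ∀ v ∈ m, v ∉ U ∧ v ∉ S) (htU : ∀ v ∈ t, v ∉ S ∧ v ∈ U) (hst : ∀ v ∈ s, v ∉ t)
    (hx : x ∈ S) (hy : y ∈ S) (hxy : x ≠ y) : (x :: (s ++ (m ++ (t ++ [y])))).Nodup := by
  simp only [List.nodup_cons, List.nodup_append, List.mem_append, List.mem_singleton]
  grind

section FarLinkage

variable {V : Type} {G : Digr V} {l : ℕ} [Fintype V] [DecidableEq V] {ι : Type} [Fintype ι]

/-- Every vertex reaches the low layers by short paths avoiding any small set. -/
theorem LQuasiTransitive.exists_path_to_low (hqt : G.LQuasiTransitive l) (hl : 2 ≤ l) {K : ℕ}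
    (hK : G.KStrong K) {S F : Finset V} (hSF : S.card + F.card + 1 ≤ K) {r s : V} (hr : r ∉ S)
    (hs : s ∉ S) {c : ℕ} (hFc : F.card ≤ c) (hc : c ≤ G.walkDist (↑S : Set V)ᶜ r s) (x : V) :
    ∃ p x' a, G.Adj x x' ∧ G.IsPathOn (↑(S ∪ F) : Set V)ᶜ p x' a ∧ p.length ≤ l + 1 ∧
      G.walkDist (↑S : Set V)ᶜ r a ≤ c + 1 := by
  have hS := Finset.card_union_le S F
  have hA := hK.2 S (by omega)
  obtain ⟨x', hx', hxx'⟩ := hK.exists_out_neighbor x (S ∪ F) (by omega)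
  obtain ⟨z, h0, hn, hz, harc⟩ := hA.exists_geodesic (r := r) (v := s) (by simpa using hr)
    (by simpa using hs)
  have hinj := StronglyConnectedOn.geodesic_inj hz
  obtain ⟨w, hw, hwF⟩ := Finset.exists_mem_notMem_of_card_lt_card
    (s := F) (t := (Finset.range (c + 1)).image z) (by
      rw [Finset.card_image_of_injOn, Finset.card_range]
      · omega
      · intro i hi j hj hij
        simp only [Finset.coe_range, Set.mem_Iio] at hi hj
        exact hinj i (by omega) j (by omega) hij)
  obtain ⟨i, hi, rfl⟩ := Finset.mem_image.1 hw
  rw [Finset.mem_range] at hi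
  have hzi := hz i (by omega)
  obtain ⟨p, a, hp, hlen, ha⟩ := hqt.exists_short_path hl (C := (↑(S ∪ F) : Set V)ᶜ)
    (W := {v | G.walkDist (↑S : Set V)ᶜ r v ≤ c}) (hK.2 _ (by omega)) (by simpa using hx')
    ⟨z i, by rw [Set.mem_ofPred_eq, hzi.2]; omega, by simpa using ⟨by simpa using hzi.1, hwF⟩⟩
  refine ⟨p, x', a, hxx', hp, hlen, ?_⟩
  have hmem : ∀ v, v ∈ (↑(S ∪ F) : Set V)ᶜ → v ∈ (↑S : Set V)ᶜ := fun v hv hvS =>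
    hv (Finset.mem_union_left F hvS)
  rcases ha with ha | ⟨w', hw', hw'C, hadj⟩
  · exact le_add_right ha
  · have h1 := hA.walkDist_le_succ (r := r) (by simpa using hr) (hmem _ hw'C)
      (hmem _ (hp.2 a (List.mem_of_getLast? hp.1.2.1))) hadj
    exact h1.trans (Nat.add_le_add_right hw' 1)

/-- Every vertex is reached from the high layers by short paths avoiding any small set. -/
theorem LQuasiTransitive.exists_path_from_high (hqt : G.LQuasiTransitive l) (hl : 2 ≤ l) {K : ℕ}
    (hK : G.KStrong K) {S F : Finset V} (hSF : S.card + F.card + 1 ≤ K) {r s : V} (hr : r ∉ S)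
    (hs : s ∉ S) {H : ℕ} (hH : H + 1 + F.card ≤ G.walkDist (↑S : Set V)ᶜ r s) (y : V) :
    ∃ p y' b, G.Adj y' y ∧ G.IsPathOn (↑(S ∪ F) : Set V)ᶜ p b y' ∧ p.length ≤ l + 1 ∧
      H ≤ G.walkDist (↑S : Set V)ᶜ r b := by
  have hS := Finset.card_union_le S F
  have hA := hK.2 S (by omega)
  obtain ⟨y', hy', hyy'⟩ := hK.exists_in_neighbor y (S ∪ F) (by omega)
  obtain ⟨z, h0, hn, hz, harc⟩ := hA.exists_geodesic (r := r) (v := s) (by simpa using hr)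
    (by simpa using hs)
  have hinj := StronglyConnectedOn.geodesic_inj hz
  obtain ⟨w, hw, hwF⟩ := Finset.exists_mem_notMem_of_card_lt_card
    (s := F) (t := (Finset.range (F.card + 1)).image fun i => z (H + 1 + i)) (by
      rw [Finset.card_image_of_injOn, Finset.card_range]
      · omega
      · intro i hi j hj hij
        simp only [Finset.coe_range, Set.mem_Iio] at hi hj
        have := hinj (H + 1 + i) (by omega) (H + 1 + j) (by omega) hij
        omega)
  obtain ⟨i, hi, rfl⟩ := Finset.mem_image.1 hw
  rw [Finset.mem_range] at hi
  have hzi := hz (H + 1 + i) (by omega)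
  obtain ⟨p, b, hp, hlen, hb⟩ := hqt.exists_short_path_to hl (C := (↑(S ∪ F) : Set V)ᶜ)
    (W := {v | H + 1 ≤ G.walkDist (↑S : Set V)ᶜ r v}) (hK.2 _ (by omega)) (by simpa using hy')
    ⟨z (H + 1 + i), by rw [Set.mem_ofPred_eq, hzi.2]; omega,
      by simpa using ⟨by simpa using hzi.1, hwF⟩⟩
  refine ⟨p, y', b, hyy', hp, hlen, ?_⟩
  have hmem : ∀ v, v ∈ (↑(S ∪ F) : Set V)ᶜ → v ∈ (↑S : Set V)ᶜ := fun v hv hvS =>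
    hv (Finset.mem_union_left F hvS)
  rcases hb with hb | ⟨w', hw', hw'C, hadj⟩
  · exact (Nat.le_succ H).trans hb
  · have h1 := hA.walkDist_le_succ (r := r) (by simpa using hr)
      (hmem _ (hp.2 b (List.mem_of_head? hp.1.1))) (hmem _ hw'C) hadj
    exact Nat.le_of_succ_le_succ (le_trans (b := G.walkDist (↑S : Set V)ᶜ r w') hw' h1)

/-- Menger's theorem for highly connected digraphs, with two families of terminals. -/
theorem KStrong.exists_disjoint_paths {K : ℕ} (hK : G.KStrong K) {U : Finset V}
    (hU : U.card + Fintype.card ι ≤ K) {a b : ι → V} (ha : Function.Injective a)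
    (hb : Function.Injective b) (haU : ∀ i, a i ∉ U) (hbU : ∀ i, b i ∉ U) :
    ∃ (Q : ι → List V) (σ : Equiv.Perm ι), (∀ i, G.IsPathOn (↑U : Set V)ᶜ (Q i) (a i) (b (σ i))) ∧
      ∀ i j, i ≠ j → ∀ v, v ∈ Q i → v ∉ Q j := by
  obtain ⟨P, hP, hdisj⟩ := Digr.exists_disjoint_paths
    (fun u v => G.Adj u v ∧ u ∈ (↑U : Set V)ᶜ ∧ v ∈ (↑U : Set V)ᶜ)
    (Finset.univ.image a) (Finset.univ.image b) (by
      intro Z hZ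
      rw [Finset.card_image_of_injective _ ha, Finset.card_univ] at hZ
      obtain ⟨u, hu, huZ⟩ := Finset.exists_mem_notMem_of_card_lt_card
        (s := Z) (t := Finset.univ.image a)
        (by rwa [Finset.card_image_of_injective _ ha, Finset.card_univ])
      obtain ⟨w, hw, hwZ⟩ := Finset.exists_mem_notMem_of_card_lt_card
        (s := Z) (t := Finset.univ.image b)
        (by rwa [Finset.card_image_of_injective _ hb, Finset.card_univ])
      have huU : u ∉ U := by
        obtain ⟨i, -, rfl⟩ := Finset.mem_image.1 hu
        exact haU i
      have hwU : w ∉ U := by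
        obtain ⟨i, -, rfl⟩ := Finset.mem_image.1 hw
        exact hbU i
      have hcard := Finset.card_union_le U Z
      obtain ⟨n, z, h0, hn, hz, harc⟩ := (hK.2 (U ∪ Z) (by omega)).exists_hasWalk
        (x := u) (y := w) (by simp [huU, huZ]) (by simp [hwU, hwZ])
      have hz' : ∀ i ≤ n, z i ∉ U ∧ z i ∉ Z := fun i hi => by simpa using hz i hi
      exact ⟨z, n, h0 ▸ hu, hn ▸ hw, fun i hi => (hz' i hi).2,
        fun i hi => ⟨harc i hi, (hz' i hi.le).1, (hz' (i + 1) hi).1⟩⟩)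
  have hP' := fun i => hP (a i) (Finset.mem_image_of_mem a (Finset.mem_univ i))
  have hend : ∀ i, ∃ j, (P (a i)).getLast? = some (b j) := by
    intro i
    obtain ⟨v, hv, hlast⟩ := (hP' i).2.1
    obtain ⟨j, -, rfl⟩ := Finset.mem_image.1 hv
    exact ⟨j, hlast⟩
  have hd : ∀ i j, i ≠ j → ∀ v, v ∈ P (a i) → v ∉ P (a j) := fun i j hij =>
    hdisj _ (Finset.mem_image_of_mem a (Finset.mem_univ i)) _
      (Finset.mem_image_of_mem a (Finset.mem_univ j)) (ha.ne hij)
  choose σ hσ using hend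
  have hσinj : Function.Injective σ := by
    intro i j hij
    by_contra hne
    exact hd i j hne _ (List.mem_of_getLast? (hσ i)) (hij ▸ List.mem_of_getLast? (hσ j))
  refine ⟨fun i => P (a i), Equiv.ofBijective σ (Finite.injective_iff_bijective.1 hσinj),
    fun i => ⟨⟨(hP' i).1, hσ i, ?_, (hP' i).2.2.2⟩, ?_⟩, hd⟩
  · exact (hP' i).2.2.1.imp fun _ _ h => h.1
  · exact mem_of_isChain_of_head? (hP' i).2.2.1 (hP' i).1 (haU i)

variable [DecidableEq ι]

/-- All terminals but a spare pair can be linked when deleting few vertices produces a large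
distance. -/
theorem LQuasiTransitive.exists_linkage_of_le_walkDist (hqt : G.LQuasiTransitive l) (hl : 2 ≤ l)
    {K : ℕ} (hK : G.KStrong K) {x y : ι → V} (hxy : Function.Injective (Sum.elim x y))
    {S : Finset V} (hx : ∀ i, x i ∈ S) (hy : ∀ i, y i ∈ S) (o : ι) {N B : ℕ}
    (hN : Fintype.card ι = N) (hB : B = (N + N) * (l + 1)) (hSK : S.card + B + N + 1 ≤ K)
    {r s : V} (hr : r ∉ S) (hs : s ∉ S)
    (hdist : (B + 2 * N) * (4 * (l - 1)) + l + 2 + B ≤ G.walkDist (↑S : Set V)ᶜ r s) :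
    ∃ P : ι → List V, (∀ i ≠ o, G.IsPathFrom (P i) (x i) (y i)) ∧
      ∀ i ≠ o, ∀ j ≠ o, i ≠ j → ∀ v, v ∈ P i → v ∉ P j := by
  have hA := hK.2 S (by omega)
  have hNpos : 0 < N := hN ▸ Fintype.card_pos_iff.2 ⟨o⟩
  have hBpos : 0 < B := by rw [hB]; positivity
  have hBP : B + 1 ≤ B * (4 * (l - 1)) := by
    calc B + 1 ≤ B * 4 := by omega
      _ ≤ B * (4 * (l - 1)) := Nat.mul_le_mul_left _ (by omega)
  have hBP' : B * (4 * (l - 1)) ≤ (B + 2 * N) * (4 * (l - 1)) :=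
    Nat.mul_le_mul_right _ (by omega)
  let φ : V → ℕ := G.walkDist (↑S : Set V)ᶜ r
  set H := (B + 2 * N) * (4 * (l - 1)) + l + 1 with hHdef
  have hcardτ : Fintype.card (ι ⊕ ι) * (l + 1) = B := by rw [Fintype.card_sum, hN, hB]
  obtain ⟨p, hp, hpdisj⟩ := exists_disjoint_lists (τ := ι ⊕ ι)
    (fun i p => Sum.elim
      (fun i => ∃ x' a, G.Adj (x i) x' ∧ G.IsPathOn (↑S : Set V)ᶜ p x' a ∧ φ a ≤ B + 1)
      (fun i => ∃ y' b, G.Adj y' (y i) ∧ G.IsPathOn (↑S : Set V)ᶜ p b y' ∧ H ≤ φ b) i)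
    (l + 1) (by
      rintro (i | i) F hF
      · rw [hcardτ] at hF
        obtain ⟨p, x', a, h1, h2, h3, h4⟩ := hqt.exists_path_to_low hl hK (S := S) (F := F)
          (by omega) hr hs (c := B) hF (by omega) (x i)
        have h5 : ∀ v ∈ p, v ∉ S ∧ v ∉ F := fun v hv => by simpa using h2.2 v hv
        exact ⟨p, ⟨x', a, h1, ⟨h2.1, fun v hv => (h5 v hv).1⟩, h4⟩, h3, fun v hv => (h5 v hv).2⟩
      · rw [hcardτ] at hF
        obtain ⟨p, y', b, h1, h2, h3, h4⟩ := hqt.exists_path_from_high hl hK (S := S) (F := F)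
          (H := H) (by omega) hr hs (by omega) (y i)
        have h5 : ∀ v ∈ p, v ∉ S ∧ v ∉ F := fun v hv => by simpa using h2.2 v hv
        exact ⟨p, ⟨y', b, h1, ⟨h2.1, fun v hv => (h5 v hv).1⟩, h4⟩, h3, fun v hv => (h5 v hv).2⟩)
  have hl' := fun i => (hp (Sum.inl i)).1
  have hr' := fun i => (hp (Sum.inr i)).1
  simp only [Sum.elim_inl, Sum.elim_inr] at hl' hr'
  choose x' a hxx' hpx hφa using hl'
  choose y' b hyy' hpy hφb using hr'
  have hap : ∀ i, a i ∈ p (Sum.inl i) := fun i => List.mem_of_getLast? (hpx i).1.2.1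
  have hbp : ∀ i, b i ∈ p (Sum.inr i) := fun i => List.mem_of_head? (hpy i).1.1
  have hainj : Function.Injective a := by
    intro i j hij
    by_contra hne
    exact hpdisj (Sum.inl i) (Sum.inl j) (by simpa using hne) _ (hap i) (hij ▸ hap j)
  have hbinj : Function.Injective b := by
    intro i j hij
    by_contra hne
    exact hpdisj (Sum.inr i) (Sum.inr j) (by simpa using hne) _ (hbp i) (hij ▸ hbp j)
  set E : Finset V := Finset.univ.image a ∪ Finset.univ.image b with hE
  set U : Finset V := (S ∪ Finset.univ.biUnion fun i => (p i).toFinset) \ E with hUdef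
  have hUcard : U.card ≤ S.card + B := by
    refine (Finset.card_le_card Finset.sdiff_subset).trans ((Finset.card_union_le _ _).trans ?_)
    refine Nat.add_le_add_left ?_ _
    rw [← hcardτ, ← Finset.card_univ]
    exact Finset.card_biUnion_le_card_mul _ _ _ fun i _ =>
      (List.toFinset_card_le _).trans (hp i).2
  have haS : ∀ i, a i ∉ S := fun i => (hpx i).2 _ (hap i)
  have hbS : ∀ i, b i ∉ S := fun i => (hpy i).2 _ (hbp i)
  have hmemE : ∀ v, v ∈ E ↔ (∃ i, a i = v) ∨ ∃ i, b i = v := by simp [hE]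
  have hUS : ∀ v, v ∉ U → v ∉ S := by
    intro v hv hvS
    refine hv (Finset.mem_sdiff.2 ⟨Finset.mem_union_left _ hvS, fun hvE => ?_⟩)
    rcases (hmemE v).1 hvE with ⟨i, rfl⟩ | ⟨i, rfl⟩
    exacts [haS i hvS, hbS i hvS]
  have hpU : ∀ i, ∀ v ∈ p i, v ∉ E → v ∈ U := fun i v hv hvE => Finset.mem_sdiff.2
    ⟨Finset.mem_union_right _ (Finset.mem_biUnion.2 ⟨i, Finset.mem_univ i, by simpa using hv⟩), hvE⟩
  obtain ⟨Q, σ, hQ, hQdisj⟩ := hK.exists_disjoint_paths (ι := ι) (U := U) (by omega) hainj hbinj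
    (fun i h => (Finset.mem_sdiff.1 h).2 ((hmemE _).2 (Or.inl ⟨i, rfl⟩)))
    (fun i h => (Finset.mem_sdiff.1 h).2 ((hmemE _).2 (Or.inr ⟨i, rfl⟩)))
  have hφ : ∀ u ∈ (↑U : Set V)ᶜ, ∀ v ∈ (↑U : Set V)ᶜ, G.Adj u v → φ v ≤ φ u + 1 :=
    fun u hu v hv => hA.walkDist_le_succ hr (hUS u hu) (hUS v hv)
  obtain ⟨R, hR, hRdisj, hRend⟩ := exists_sorted_tracks (H := H) (P := 4 * (l - 1)) (e := l)
    (t₀ := B) (b := b) hφ (by omega)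
    (by
      intro t u hu v hv hφu hφv
      have hroot : G.Adj u r := hqt.adj_root hl hA hr (hUS u hu) (m := t * (2 * (l - 1)))
        (by rw [show G.walkDist (↑S : Set V)ᶜ r u = _ from hφu]; ring)
      have hφv' : φ v = (4 * t) * (l - 1) := by rw [hφv]; ring
      refine hqt.adj_of_adj_root hl hA hr (hUS u hu) hroot (4 * t) ?_ (hUS v hv) hφv'
      rw [show G.walkDist (↑S : Set V)ᶜ r u = _ from hφu, ← hφv', hφv]
      omega)
    o (by rw [hN]; omega) σ
    (fun i => ⟨(hQ i).1.2.2.1, (hQ i).1.2.2.2, (hQ i).2,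
      ⟨a i, List.mem_of_head? (hQ i).1.1, (hφa i).trans hBP⟩, ⟨b (σ i), (hQ i).1.2.1, hφb _⟩⟩)
    hQdisj (fun i => (hQ i).1.2.1)
  have hs₀ : ∀ i, ∃ s, p (Sum.inl i) = s ++ [a i] := fun i =>
    List.getLast?_eq_some_iff.1 (hpx i).1.2.1
  have ht₀ : ∀ i, ∃ t, p (Sum.inr i) = b i :: t := fun i =>
    List.head?_eq_some_iff.1 (hpy i).1.1
  choose s₀ hs₀ using hs₀
  choose t₀ ht₀ using ht₀
  have hsE : ∀ i, ∀ v ∈ s₀ i, v ∈ p (Sum.inl i) ∧ v ∉ S ∧ v ∈ U := by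
    intro i v hv
    have hvp : v ∈ p (Sum.inl i) := by simp [hs₀, hv]
    refine ⟨hvp, (hpx i).2 v hvp, hpU _ v hvp fun hvE => ?_⟩
    rcases (hmemE v).1 hvE with ⟨j, rfl⟩ | ⟨j, rfl⟩
    · by_cases hij : i = j
      · subst hij
        have := (hpx i).1.2.2.2
        rw [hs₀, List.nodup_append] at this
        exact this.2.2 _ hv _ (by simp) rfl
      · exact hpdisj (Sum.inl i) (Sum.inl j) (by simpa using hij) _ hvp (hap j)
    · exact hpdisj (Sum.inl i) (Sum.inr j) (by simp) _ hvp (hbp j)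
  have htE : ∀ i, ∀ v ∈ t₀ i, v ∈ p (Sum.inr i) ∧ v ∉ S ∧ v ∈ U := by
    intro i v hv
    have hvp : v ∈ p (Sum.inr i) := by simp [ht₀, hv]
    refine ⟨hvp, (hpy i).2 v hvp, hpU _ v hvp fun hvE => ?_⟩
    rcases (hmemE v).1 hvE with ⟨j, rfl⟩ | ⟨j, rfl⟩
    · exact hpdisj (Sum.inr i) (Sum.inl j) (by simp) _ hvp (hap j)
    · by_cases hij : i = j
      · subst hij
        have := (hpy i).1.2.2.2
        rw [ht₀, List.nodup_cons] at this
        exact this.1 hv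
      · exact hpdisj (Sum.inr i) (Sum.inr j) (by simpa using hij) _ hvp (hbp j)
  have hRmem : ∀ i, ∀ v ∈ R i, v ∉ U ∧ v ∉ S := fun i v hv =>
    ⟨(hR i).2.2 v hv, hUS v ((hR i).2.2 v hv)⟩
  refine ⟨fun i => x i :: (s₀ i ++ (R i ++ (t₀ i ++ [y i]))), fun i hi =>
    ⟨rfl, by simp [List.getLast?_cons, List.getLast?_append], ?_, ?_⟩, ?_⟩
  · have h1 : ([x i] ++ p (Sum.inl i)).IsChain G.Adj := isChain_append_of_head? (a := x' i)
      (by simpa using hxx' i) (hpx i).1.2.2.1 (hpx i).1.1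
    have h2 : (p (Sum.inr i) ++ [y i]).IsChain G.Adj := isChain_append_of_getLast? (b := y' i)
      (hpy i).1.2.2.1 (by simpa using hyy' i) (hpy i).1.2.1
    rw [hs₀, ← List.append_assoc] at h1
    rw [ht₀, List.cons_append] at h2
    have h3 := isChain_append_of_head? h1 (hR i).1 ((hRend i hi).1.trans (hQ i).1.1)
    have h4 := isChain_append_of_getLast? h3 h2 (b := b i) (by
      rw [List.getLast?_append, (hRend i hi).2, Option.some_or])
    show List.IsChain _ _
    simpa using h4
  · have h1 := (hpx i).1.2.2.2
    have h2 := (hpy i).1.2.2.2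
    rw [hs₀, List.nodup_append] at h1
    rw [ht₀, List.nodup_cons] at h2
    exact nodup_cons_append_append_append h1.1 (hR i).2.1 h2.2 (fun v hv => (hsE i v hv).2)
      (hRmem i) (fun v hv => (htE i v hv).2)
      (fun v hv hv' => hpdisj (Sum.inl i) (Sum.inr i) (by simp) v (hsE i v hv).1 (htE i v hv').1)
      (hx i) (hy i) fun h => by simpa using hxy (a₁ := Sum.inl i) (a₂ := Sum.inr i) h
  · intro i hi j hj hij v hvi hvj
    have h1 : x i ≠ x j := fun h => hij (by simpa using hxy (a₁ := Sum.inl i) (a₂ := Sum.inl j) h)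
    have h2 : y i ≠ y j := fun h => hij (by simpa using hxy (a₁ := Sum.inr i) (a₂ := Sum.inr j) h)
    have h3 : x i ≠ y j := fun h => by simpa using hxy (a₁ := Sum.inl i) (a₂ := Sum.inr j) h
    have h4 : x j ≠ y i := fun h => by simpa using hxy (a₁ := Sum.inl j) (a₂ := Sum.inr i) h
    have g1 := hpdisj (Sum.inl i) (Sum.inl j) (by simpa using hij) v
    have g2 := hpdisj (Sum.inl i) (Sum.inr j) (by simp) v
    have g3 := hpdisj (Sum.inr i) (Sum.inl j) (by simp) v
    have g4 := hpdisj (Sum.inr i) (Sum.inr j) (by simpa using hij) v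
    have g5 := hRdisj i j hij v
    have e1 := hsE i v
    have e2 := hsE j v
    have e3 := htE i v
    have e4 := htE j v
    have e5 := hRmem i v
    have e6 := hRmem j v
    have := hx i
    have := hx j
    have := hy i
    have := hy j
    simp only [List.mem_cons, List.mem_append, List.not_mem_nil, or_false] at hvi hvj
    grind

end FarLinkage

theorem linkage_bound {k l N B M : ℕ} (hk : 2 ≤ k) (hl : 2 ≤ l) (hN : N = k + 1)
    (hB : B = (N + N) * (l + 1)) (hM : M = (B + 2 * N) * (4 * (l - 1)) + l + 2 + B) :
    2 * N + N * M + B + N + 1 ≤ 81 * k ^ 2 * (l + 2) ^ 2 := by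
  obtain ⟨m, rfl⟩ : ∃ m, l = m + 2 := ⟨l - 2, by omega⟩
  obtain ⟨j, rfl⟩ : ∃ j, k = j + 2 := ⟨k - 2, by omega⟩
  subst hN hB hM
  rw [show m + 2 - 1 = m + 1 by omega]
  ring_nf
  nlinarith [Nat.zero_le (j * m), Nat.zero_le (j ^ 2 * m), Nat.zero_le (j * m ^ 2),
    Nat.zero_le (j ^ 2 * m ^ 2), Nat.zero_le (j ^ 2), Nat.zero_le (m ^ 2)]

end Digr

/-- Every 81k²(l+2)²-strong l-quasi-transitive digraph is k-linked
(k ≥ 2, l ≥ 2). -/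
theorem l_quasi_transitive_is_k_linked {V : Type} [Fintype V] (k l : ℕ)
    (hk : 2 ≤ k) (hl : 2 ≤ l) (G : Digr V) (hqt : G.LQuasiTransitive l)
    (hstrong : G.KStrong (81 * k ^ 2 * (l + 2) ^ 2)) :
    G.KLinked k := by
  classical
  obtain ⟨N, hN⟩ : ∃ N, N = k + 1 := ⟨_, rfl⟩
  obtain ⟨B, hB⟩ : ∃ B, B = (N + N) * (l + 1) := ⟨_, rfl⟩
  obtain ⟨M, hM⟩ : ∃ M, M = (B + 2 * N) * (4 * (l - 1)) + l + 2 + B := ⟨_, rfl⟩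
  have hbound := Digr.linkage_bound hk hl hN hB hM
  generalize 81 * k ^ 2 * (l + 2) ^ 2 = K at hstrong hbound
  have hcardV := hstrong.1
  refine ⟨by omega, fun x y hxy => ?_⟩
  have hcardT : (Finset.univ.image (Sum.elim x y)).card = 2 * k := by
    rw [Finset.card_image_of_injective _ hxy, Finset.card_univ, Fintype.card_sum, Fintype.card_fin]
    omega
  obtain ⟨x₀, hx₀⟩ : ∃ v, v ∉ Finset.univ.image (Sum.elim x y) := by
    by_contra! h
    have := Finset.card_le_card (fun v (_ : v ∈ Finset.univ) => h v)
    rw [Finset.card_univ] at this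
    omega
  obtain ⟨y₀, hy₀⟩ : ∃ v, v ∉ insert x₀ (Finset.univ.image (Sum.elim x y)) := by
    by_contra! h
    have := Finset.card_le_card (fun v (_ : v ∈ Finset.univ) => h v)
    rw [Finset.card_univ, Finset.card_insert_of_notMem hx₀] at this
    omega
  simp only [Finset.mem_insert, Finset.mem_image, Finset.mem_univ, true_and, not_or, not_exists,
    Sum.forall, Sum.elim_inl, Sum.elim_inr] at hx₀ hy₀
  let x' : Option (Fin k) → V := fun i => i.elim x₀ x
  let y' : Option (Fin k) → V := fun i => i.elim y₀ y
  have hxy' : Function.Injective (Sum.elim x' y') := by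
    have hxx : ∀ i j, x i = x j → i = j := fun i j h =>
      Sum.inl.inj (hxy (a₁ := .inl i) (a₂ := .inl j) h)
    have hyy : ∀ i j, y i = y j → i = j := fun i j h =>
      Sum.inr.inj (hxy (a₁ := .inr i) (a₂ := .inr j) h)
    have hne : ∀ i j, x i ≠ y j := fun i j h => by simpa using hxy (a₁ := .inl i) (a₂ := .inr j) h
    rintro ((_ | i) | (_ | i)) ((_ | j) | (_ | j)) h <;>
      simp only [x', y', Sum.elim_inl, Sum.elim_inr, Option.elim_none, Option.elim_some] at h <;>
      grind
  let T : Finset V := Finset.univ.image (Sum.elim x' y')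
  have hT : T.card = 2 * N := by
    rw [Finset.card_image_of_injective _ hxy', Finset.card_univ, Fintype.card_sum,
      Fintype.card_option, Fintype.card_fin]
    omega
  have hxT : ∀ i, x' i ∈ T := fun i => Finset.mem_image.2 ⟨.inl i, Finset.mem_univ _, rfl⟩
  have hyT : ∀ i, y' i ∈ T := fun i => Finset.mem_image.2 ⟨.inr i, Finset.mem_univ _, rfl⟩
  have hι : Fintype.card (Option (Fin k)) = N := by simp [hN]
  suffices h : ∃ P : Option (Fin k) → List V, (∀ i ≠ none, G.IsPathFrom (P i) (x' i) (y' i)) ∧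
      ∀ i ≠ none, ∀ j ≠ none, i ≠ j → ∀ v, v ∈ P i → v ∉ P j by
    obtain ⟨P, hP, hdisj⟩ := h
    exact ⟨fun i => P (some i), fun i => hP (some i) (by simp),
      fun i j hij => hdisj _ (by simp) _ (by simp) (by simpa using hij)⟩
  by_cases hnear : ∀ S : Finset V, T ⊆ S → S.card ≤ T.card + Fintype.card (Option (Fin k)) * M →
      ∀ u v, u ∉ S → v ∉ S → G.walkDist (↑S : Set V)ᶜ u v < M
  · obtain ⟨P, hP, hdisj⟩ := hstrong.exists_linkage_of_walkDist_lt hxy' T hxT hyT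
      (by rw [hι]; omega) hnear
    exact ⟨P, fun i _ => hP i, fun i _ j _ => hdisj i j⟩
  · push Not at hnear
    obtain ⟨S, hTS, hS, r, s, hr, hs, hdist⟩ := hnear
    rw [hι] at hS
    exact hqt.exists_linkage_of_le_walkDist hl hstrong hxy' (fun i => hTS (hxT i))
      (fun i => hTS (hyT i)) none hι hB (by omega) hr hs (hM ▸ hdist)
end

section
/- Let T be a tournament on n vertices and k a positive integer. If n ≥ 9k − 6, then there exist two disjoint vertex sets of T, each of size k, such that one short anchors the other. -/
namespace Digr

/-- For disjoint vertex sets A and S, A short anchors S within the vertex set T: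
for every bijection e from A to S there are pairwise disjoint paths, each of
length at most 3 (at most 4 vertices), with all vertices in T, joining each
a ∈ A to e(a). -/
def ShortAnchorsOn {V : Type} (G : Digr V) (T : Set V) (A S : Finset V) : Prop :=
  ∀ e : {x // x ∈ A} ≃ {y // y ∈ S},
    ∃ P : {x // x ∈ A} → List V,
      (∀ a, G.IsPathOn T (P a) (a : V) ((e a : V)) ∧ (P a).length ≤ 4) ∧
      (∀ a b, a ≠ b → ∀ v, v ∈ P a → v ∉ P b)

end Digr


namespace Digr

open scoped Classical in
/-- The number of pairs `(a, b) ∈ l₁ × l₂` with an arc from `b` to `a`. -/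
noncomputable def backArcsBetween {V : Type} (G : Digr V) (l₁ l₂ : List V) : ℕ :=
  (l₁.map fun a => l₂.countP fun b => G.Adj b a).sum

open scoped Classical in
/-- The number of arcs going backwards in the linear order given by a list. -/
noncomputable def backArcs {V : Type} (G : Digr V) : List V → ℕ
  | [] => 0
  | a :: l => l.countP (fun b => G.Adj b a) + backArcs G l

variable {V : Type} (G : Digr V)

lemma backArcsBetween_append_right (l l₁ l₂ : List V) :
    G.backArcsBetween l (l₁ ++ l₂) = G.backArcsBetween l l₁ + G.backArcsBetween l l₂ := by
  simp [backArcsBetween, List.sum_map_add]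

lemma backArcs_append (l₁ l₂ : List V) :
    G.backArcs (l₁ ++ l₂) = G.backArcs l₁ + G.backArcs l₂ + G.backArcsBetween l₁ l₂ := by
  induction l₁ with
  | nil => simp [backArcs, backArcsBetween]
  | cons a l ih =>
    simp only [backArcsBetween, List.map_cons, List.sum_cons, List.cons_append, backArcs,
      List.countP_append] at ih ⊢
    omega

lemma backArcsBetween_perm_left {l₁ l₂ : List V} (h : l₁.Perm l₂) (l : List V) :
    G.backArcsBetween l₁ l = G.backArcsBetween l₂ l :=
  (h.map _).sum_eq

lemma backArcsBetween_perm_right {l₁ l₂ : List V} (h : l₁.Perm l₂) (l : List V) :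
    G.backArcsBetween l l₁ = G.backArcsBetween l l₂ := by
  simp only [backArcsBetween, h.countP_eq]

open scoped Classical in
lemma backArcs_concat (l : List V) (a : V) :
    G.backArcs (l ++ [a]) = l.countP (fun b => G.Adj a b) + G.backArcs l := by
  induction l with
  | nil => simp [backArcs]
  | cons b l ih =>
    simp only [List.cons_append, backArcs, List.countP_append, ih, List.countP_cons,
      List.countP_nil]
    omega

/-- A list has the fewest backward arcs among its permutations. -/
def IsMedianOrder (l : List V) : Prop :=
  ∀ l' : List V, l'.Perm l → G.backArcs l ≤ G.backArcs l'

lemma exists_isMedianOrder (l : List V) : ∃ l', l'.Perm l ∧ G.IsMedianOrder l' := by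
  obtain ⟨l', h, hmin⟩ := WellFounded.has_min (measure G.backArcs).wf {l' | l'.Perm l}
    ⟨l, List.Perm.refl l⟩
  exact ⟨l', h, fun l'' h'' => not_lt.1 (hmin l'' (h''.trans h))⟩

variable {G}

/-- Sublists of consecutive elements of a median order are median orders. -/
lemma IsMedianOrder.of_append {p m r : List V} (h : G.IsMedianOrder (p ++ m ++ r)) :
    G.IsMedianOrder m := by
  intro m' hm
  have := h (p ++ m' ++ r) ((hm.append_left p).append_right r)
  simp only [List.append_assoc, backArcs_append, backArcsBetween_append_right,
    G.backArcsBetween_perm_left hm, G.backArcsBetween_perm_right hm] at this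
  omega

open scoped Classical in
lemma IsMedianOrder.countP_cons {a : V} {q : List V} (h : G.IsMedianOrder (a :: q)) :
    q.countP (fun b => G.Adj b a) ≤ q.countP (fun b => G.Adj a b) := by
  have := h (q ++ [a]) (List.perm_append_singleton a q)
  rw [backArcs_concat, backArcs] at this
  omega

open scoped Classical in
lemma IsMedianOrder.countP_concat {a : V} {q : List V} (h : G.IsMedianOrder (q ++ [a])) :
    q.countP (fun b => G.Adj a b) ≤ q.countP (fun b => G.Adj b a) := by
  have := h (a :: q) (List.perm_append_singleton a q).symm
  rw [backArcs_concat, backArcs] at this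
  omega

open scoped Classical in
lemma length_le_countP_add_countP (htour : ∀ u v : V, u ≠ v → (G.Adj u v ↔ ¬ G.Adj v u))
    {a : V} {q : List V} (ha : a ∉ q) :
    q.length ≤ q.countP (fun b => G.Adj a b) + q.countP (fun b => G.Adj b a) := by
  rw [q.length_eq_countP_add_countP (fun b => G.Adj a b)]
  gcongr 1
  refine List.countP_mono_left fun b hb h => ?_
  have hne : b ≠ a := fun h' => ha (h' ▸ hb)
  simpa [htour b a hne] using h

open scoped Classical in
lemma countP_eq_card_filter {l : List V} (hl : l.Nodup) (P : V → Prop) :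
    l.countP (fun b => P b) = (l.toFinset.filter P).card := by
  rw [List.countP_eq_length_filter, ← List.toFinset_card_of_nodup (hl.filter _)]
  congr 1
  ext
  simp

open scoped Classical in
/-- A large tournament splits into a set of sources, a middle part, and a set of sinks, where
sources have many out-neighbours and sinks have many in-neighbours in the middle part. -/
lemma exists_sources_sinks [Fintype V] {k : ℕ} (hk : 1 ≤ k)
    (htour : ∀ u v : V, u ≠ v → (G.Adj u v ↔ ¬ G.Adj v u))
    (hn : 9 * k - 6 ≤ Fintype.card V) :
    ∃ X Y M : Finset V, Disjoint X Y ∧ Disjoint X M ∧ Disjoint Y M ∧ X.card = k ∧ Y.card = k ∧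
      (∀ x ∈ X, 3 * k - 2 ≤ (M.filter (fun v => G.Adj x v)).card) ∧
      (∀ y ∈ Y, 3 * k - 2 ≤ (M.filter (fun v => G.Adj v y)).card) := by
  obtain ⟨l, hperm, hmed⟩ := G.exists_isMedianOrder (Finset.univ : Finset V).toList
  have hlen : l.length = Fintype.card V := by simp [hperm.length_eq]
  have hnodup : l.Nodup := hperm.nodup_iff.2 (Finset.nodup_toList _)
  obtain ⟨X, M, Y, rfl, hX, hY⟩ : ∃ X M Y : List V, l = X ++ M ++ Y ∧ X.length = k ∧
      Y.length = k := by
    refine ⟨l.take k, (l.drop k).take (l.length - 2 * k), (l.drop k).drop (l.length - 2 * k),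
      by simp [List.append_assoc], ?_, ?_⟩
    · simp; omega
    · simp; omega
  simp only [List.length_append] at hlen
  simp only [List.nodup_append', List.disjoint_append_left] at hnodup
  obtain ⟨⟨nX, nM, dXM⟩, nY, dXY, dMY⟩ := hnodup
  refine ⟨X.toFinset, Y.toFinset, M.toFinset, ?_, ?_, ?_, ?_, ?_, ?_, ?_⟩
  · simpa using dXY
  · simpa using dXM
  · simpa using dMY.symm
  · rw [List.toFinset_card_of_nodup nX, hX]
  · rw [List.toFinset_card_of_nodup nY, hY]
  · intro x hx
    rw [List.mem_toFinset] at hx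
    have hxM : x ∉ M := dXM hx
    obtain ⟨s, t, rfl⟩ := List.append_of_mem hx
    have hxt : x ∉ t := by
      simp only [List.nodup_append', List.nodup_cons] at nX
      exact nX.2.1.1
    have h₁ := (IsMedianOrder.of_append (p := s) (m := x :: (t ++ M)) (r := Y)
      (by simpa using hmed)).countP_cons
    have h₂ := length_le_countP_add_countP htour (a := x) (q := t ++ M) (by simp [hxt, hxM])
    have h₃ : t.countP (fun b => G.Adj x b) ≤ t.length := List.countP_le_length
    rw [← countP_eq_card_filter nM]
    simp only [List.countP_append, List.length_append, List.length_cons] at *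
    omega
  · intro y hy
    rw [List.mem_toFinset] at hy
    have hyM : y ∉ M := fun h => dMY h hy
    obtain ⟨s, t, rfl⟩ := List.append_of_mem hy
    have hys : y ∉ s := by
      simp only [List.nodup_append'] at nY
      exact fun h => nY.2.2 h (by simp)
    have h₁ := (IsMedianOrder.of_append (p := X) (m := (M ++ s) ++ [y]) (r := t)
      (by simpa using hmed)).countP_concat
    have h₂ := length_le_countP_add_countP htour (a := y) (q := M ++ s) (by simp [hys, hyM])
    have h₃ : s.countP (fun b => G.Adj b y) ≤ s.length := List.countP_le_length
    rw [← countP_eq_card_filter nM]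
    simp only [List.countP_append, List.length_append, List.length_cons] at *
    omega

/-- If all arcs from `B` to `A` are present, then `B` short anchors `A`. -/
lemma shortAnchorsOn_of_forall_adj {A B : Finset V} (hd : Disjoint B A)
    (h : ∀ b ∈ B, ∀ a ∈ A, G.Adj b a) : G.ShortAnchorsOn Set.univ B A := by
  intro e
  have hne : ∀ b c : {x // x ∈ B}, (b : V) ≠ e c := fun b c h' =>
    Finset.disjoint_left.1 hd b.2 (h' ▸ (e c).2)
  refine ⟨fun b => [(b : V), (e b : V)], fun b => ?_, fun b c hbc v hv hv' => ?_⟩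
  · refine ⟨⟨⟨rfl, rfl, ?_, by simp [hne]⟩, by simp⟩, by simp⟩
    exact List.isChain_pair.2 (h b b.2 (e b) (e b).2)
  · simp only [List.mem_cons, List.not_mem_nil, or_false] at hv hv'
    rcases hv with rfl | rfl <;> rcases hv' with h' | h'
    · exact hbc (Subtype.ext h')
    · exact hne _ _ h'
    · exact hne _ _ h'.symm
    · exact hbc (e.injective (Subtype.ext h'))

open scoped Classical in
/-- A family of short paths with inner vertices in `M` can be built greedily, if after the
deletion of few vertices every required source and sink still can be joined through `M`. -/
lemma shortAnchorsOn_of_connecting {k : ℕ} {X Y M : Finset V} (hXY : Disjoint X Y)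
    (hXM : Disjoint X M) (hYM : Disjoint Y M) (hX : X.card = k)
    (hconn : ∀ x ∈ X, ∀ y ∈ Y, ∀ U : Finset V, U.card ≤ 2 * (k - 1) →
      ∃ p : List V, p.length ≤ 2 ∧ p.Nodup ∧ (∀ v ∈ p, v ∈ M ∧ v ∉ U) ∧
        (x :: (p ++ [y])).IsChain G.Adj) :
    G.ShortAnchorsOn Set.univ X Y := by
  intro e
  have key : ∀ S : Finset {x // x ∈ X}, ∃ I : {x // x ∈ X} → List V,
      (∀ a ∈ S, (I a).length ≤ 2 ∧ (I a).Nodup ∧ (∀ v ∈ I a, v ∈ M) ∧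
        ((a : V) :: (I a ++ [(e a : V)])).IsChain G.Adj) ∧
      (∀ a ∈ S, ∀ b ∈ S, a ≠ b → ∀ v ∈ I a, v ∉ I b) := by
    intro S
    induction S using Finset.induction_on with
    | empty => exact ⟨fun _ => [], by simp, by simp⟩
    | insert x S hx ih =>
      obtain ⟨I, hI, hdisj⟩ := ih
      have hS : S.card ≤ k - 1 := by
        have := Finset.card_le_univ (insert x S)
        rw [Finset.card_insert_of_notMem hx, Fintype.card_coe, hX] at this
        omega
      obtain ⟨p, hp₂, hpn, hpM, hpc⟩ := hconn x x.2 (e x) (e x).2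
        (S.biUnion fun a => (I a).toFinset) (by
          calc _ ≤ S.card * 2 := Finset.card_biUnion_le_card_mul _ _ _ fun a ha =>
                  (List.toFinset_card_le _).trans (hI a ha).1
            _ ≤ _ := by omega)
      have hne : ∀ a ∈ S, a ≠ x := fun a ha h => hx (h ▸ ha)
      have hp : ∀ v ∈ p, ∀ a ∈ S, v ∉ I a := fun v hv a ha h =>
        (hpM v hv).2 (Finset.mem_biUnion.2 ⟨a, ha, List.mem_toFinset.2 h⟩)
      refine ⟨Function.update I x p, fun a ha => ?_, fun a ha b hb hab v hva hvb => ?_⟩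
      · rcases Finset.mem_insert.1 ha with rfl | ha
        · simpa using ⟨hp₂, hpn, fun v hv => (hpM v hv).1, hpc⟩
        · simpa [hne a ha] using hI a ha
      · rcases Finset.mem_insert.1 ha with rfl | ha' <;> rcases Finset.mem_insert.1 hb with rfl | hb'
        · exact hab rfl
        · simp only [Function.update_self, Function.update_of_ne (hne b hb')] at hva hvb
          exact hp v hva b hb' hvb
        · simp only [Function.update_self, Function.update_of_ne (hne a ha')] at hva hvb
          exact hp v hvb a ha' hva
        · simp only [Function.update_of_ne (hne a ha'),
            Function.update_of_ne (hne b hb')] at hva hvb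
          exact hdisj a ha' b hb' hab v hva hvb
  obtain ⟨I, hI, hdisj⟩ := key Finset.univ
  have hXY' : ∀ b c : {x // x ∈ X}, (b : V) ≠ e c := fun b c h' =>
    Finset.disjoint_left.1 hXY b.2 (h' ▸ (e c).2)
  have hXI : ∀ a b : {x // x ∈ X}, (a : V) ∉ I b := fun a b h =>
    Finset.disjoint_left.1 hXM a.2 ((hI b (Finset.mem_univ b)).2.2.1 _ h)
  have hYI : ∀ a b : {x // x ∈ X}, (e a : V) ∉ I b := fun a b h =>
    Finset.disjoint_left.1 hYM (e a).2 ((hI b (Finset.mem_univ b)).2.2.1 _ h)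
  refine ⟨fun a => a :: (I a ++ [(e a : V)]), fun a => ?_, fun a b hab v hva hvb => ?_⟩
  · obtain ⟨h₂, hn, -, hc⟩ := hI a (Finset.mem_univ a)
    refine ⟨⟨⟨rfl, ?_, hc, ?_⟩, by simp⟩, by simp; omega⟩
    · exact (List.cons_append ▸ List.getLast?_concat :
        ((a : V) :: (I a ++ [(e a : V)])).getLast? = some (e a : V))
    · simp [List.nodup_append', hXI, hYI, hXY', hn]
  · simp only [List.mem_cons, List.mem_append, List.not_mem_nil, or_false] at hva hvb
    rcases hva with rfl | hva | rfl <;> rcases hvb with h | h | h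
    · exact hab (Subtype.ext h)
    · exact hXI _ _ h
    · exact hXY' _ _ h
    · exact hXI _ _ (h ▸ hva)
    · exact hdisj a (Finset.mem_univ a) b (Finset.mem_univ b) hab v hva h
    · exact hYI _ _ (h ▸ hva)
    · exact hXY' _ _ h.symm
    · exact hYI _ _ h
    · exact hab (e.injective (Subtype.ext h))

end Digr

/-- Every tournament on n ≥ 9k − 6 vertices contains two disjoint
vertex sets, each of size k, such that one short anchors the other. -/
theorem tournament_short_anchor {V : Type} [Fintype V] (k : ℕ) (hk : 1 ≤ k)
    (T : Digr V) (htour : ∀ u v : V, u ≠ v → (T.Adj u v ↔ ¬ T.Adj v u))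
    (hn : 9 * k - 6 ≤ Fintype.card V) :
    ∃ X Y : Finset V, Disjoint X Y ∧ X.card = k ∧ Y.card = k ∧
      T.ShortAnchorsOn Set.univ X Y := by
  classical
  obtain ⟨X, Y, M, hXY, hXM, hYM, hX, hY, hout, hin⟩ := Digr.exists_sources_sinks hk htour hn
  by_cases hcomplete : ∃ A B : Finset V, Disjoint B A ∧ k ≤ A.card ∧ k ≤ B.card ∧
      ∀ b ∈ B, ∀ a ∈ A, T.Adj b a
  · obtain ⟨A, B, hd, hA, hB, h⟩ := hcomplete
    obtain ⟨A', hA', hAk⟩ := Finset.exists_subset_card_eq hA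
    obtain ⟨B', hB', hBk⟩ := Finset.exists_subset_card_eq hB
    have hd' := Finset.disjoint_of_subset_left hB' (Finset.disjoint_of_subset_right hA' hd)
    exact ⟨B', A', hd', hBk, hAk, Digr.shortAnchorsOn_of_forall_adj hd' fun b hb a ha =>
      h b (hB' hb) a (hA' ha)⟩
  · refine ⟨X, Y, hXY, hX, hY, Digr.shortAnchorsOn_of_connecting hXY hXM hYM hX ?_⟩
    intro x hx y hy U hU
    set A := M.filter (fun v => T.Adj x v) \ U with hA
    set B := M.filter (fun v => T.Adj v y) \ U with hB
    have hAk : k ≤ A.card := by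
      have := Finset.le_card_sdiff U (M.filter (fun v => T.Adj x v))
      rw [← hA] at this
      have := hout x hx
      omega
    have hBk : k ≤ B.card := by
      have := Finset.le_card_sdiff U (M.filter (fun v => T.Adj v y))
      rw [← hB] at this
      have := hin y hy
      omega
    by_cases hd : Disjoint B A
    · obtain ⟨b, hb, a, ha, hba⟩ : ∃ b ∈ B, ∃ a ∈ A, ¬ T.Adj b a := by
        by_contra! h
        exact hcomplete ⟨A, B, hd, hAk, hBk, h⟩
      have hne : a ≠ b := fun h => Finset.disjoint_left.1 hd hb (h ▸ ha)
      have hab := (htour a b hne).2 hba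
      simp only [hA, hB, Finset.mem_sdiff, Finset.mem_filter] at ha hb
      exact ⟨[a, b], by simp, by simp [hne], by simp [ha, hb], by simp [ha, hb, hab]⟩
    · obtain ⟨v, hvB, hvA⟩ := Finset.not_disjoint_iff.1 hd
      simp only [hA, hB, Finset.mem_sdiff, Finset.mem_filter] at hvA hvB
      exact ⟨[v], by simp, by simp, by simp [hvA], by simp [hvA, hvB]⟩
end

section
/- Let T be a tournament on n vertices and k a positive integer. If n ≥ 8.5k − 6 (i.e., 2n ≥ 17k − 12), then there exist two disjoint vertex sets of T, each of size k, such that one short anchors the other. -/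
namespace Digr

variable {V : Type}

open Classical in
/-- The number of arcs of `G` that go forward along the list `L`. -/
noncomputable def forwardArcs (G : Digr V) : List V → ℕ
  | [] => 0
  | x :: L => L.countP (fun v => G.Adj x v) + forwardArcs G L

open Classical in
lemma forwardArcs_move (G : Digr V) (x : V) (L₁ L₂ L₃ : List V) :
    G.forwardArcs (L₁ ++ x :: (L₂ ++ L₃)) + L₂.countP (fun v => G.Adj v x) =
      G.forwardArcs (L₁ ++ (L₂ ++ x :: L₃)) + L₂.countP (fun v => G.Adj x v) := by
  induction L₁ with
  | nil =>
    simp only [List.nil_append]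
    induction L₂ with
    | nil => simp
    | cons z L₂ ih =>
      simp only [forwardArcs, List.cons_append, List.countP_cons, List.countP_append,
        decide_eq_true_eq] at ih ⊢
      omega
  | cons z L₁ ih =>
    simp only [forwardArcs, List.cons_append, List.countP_cons, List.countP_append] at ih ⊢
    omega

open Classical in
/-- Every finite tournament has a median order: each vertex dominates at least half of every
interval following it and is dominated by at least half of every interval preceding it. -/
lemma exists_median_order [Fintype V] (T : Digr V)
    (htour : ∀ u v : V, u ≠ v → (T.Adj u v ↔ ¬ T.Adj v u)) :
    ∃ L : List V, L.Nodup ∧ L.length = Fintype.card V ∧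
      (∀ x L₁ L₂ L₃, L = L₁ ++ x :: (L₂ ++ L₃) →
        L₂.length ≤ 2 * L₂.countP (fun v => T.Adj x v)) ∧
      (∀ x L₁ L₂ L₃, L = L₁ ++ (L₂ ++ x :: L₃) →
        L₂.length ≤ 2 * L₂.countP (fun v => T.Adj v x)) := by
  have key : ∀ (x : V) (L₂ : List V), x ∉ L₂ →
      L₂.countP (fun v => T.Adj x v) + L₂.countP (fun v => T.Adj v x) = L₂.length := by
    intro x L₂ hx
    rw [List.length_eq_countP_add_countP (fun v => decide (T.Adj x v))]
    congr 1
    refine List.countP_congr fun v hv => ?_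
    have hne : v ≠ x := fun h => hx (h ▸ hv)
    simpa using htour v x hne
  obtain ⟨L, hL, hmax⟩ := Finset.exists_max_image
    (Finset.univ.toList : List V).permutations.toFinset T.forwardArcs
    ⟨Finset.univ.toList, by simp⟩
  simp only [List.mem_toFinset, List.mem_permutations] at hL hmax
  have hnd : L.Nodup := hL.nodup_iff.2 (Finset.nodup_toList _)
  refine ⟨L, hnd, by simpa using hL.length_eq, ?_, ?_⟩
  · rintro x L₁ L₂ L₃ rfl
    have h1 := hmax (L₁ ++ (L₂ ++ x :: L₃))
      ((List.perm_middle.append_left L₁).trans hL)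
    have h2 := T.forwardArcs_move x L₁ L₂ L₃
    have h3 := key x L₂ (by
      intro h
      simp [List.nodup_append, h] at hnd)
    omega
  · rintro x L₁ L₂ L₃ rfl
    have h1 := hmax (L₁ ++ x :: (L₂ ++ L₃))
      ((List.perm_middle.symm.append_left L₁).trans hL)
    have h2 := T.forwardArcs_move x L₁ L₂ L₃
    have h3 := key x L₂ (by
      intro h
      have := (List.perm_middle.append_left L₁).nodup_iff.1 hnd
      simp [List.nodup_append, h] at this)
    omega

open Classical in
/-- The first `k` and the last `k` vertices of a median order, ranked by their distance to the
middle part `M`, have many out-neighbours, respectively in-neighbours, in `M`. -/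
lemma exists_ends_of_median_order [Fintype V] (T : Digr V)
    (htour : ∀ u v : V, u ≠ v → (T.Adj u v ↔ ¬ T.Adj v u)) (k : ℕ)
    (hk : 2 * k ≤ Fintype.card V) :
    ∃ (x y : Fin k → V) (M : Finset V), Function.Injective x ∧ Function.Injective y ∧
      (∀ i j, x i ≠ y j) ∧ (∀ i, x i ∉ M) ∧ (∀ j, y j ∉ M) ∧
      (∀ i, Fintype.card V ≤ 2 * (M.filter fun v => T.Adj (x i) v).card + 2 * k + i) ∧
      (∀ j, Fintype.card V ≤ 2 * (M.filter fun v => T.Adj v (y j)).card + 2 * k + j) := by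
  obtain ⟨L, hnd, hlen, hout, hin⟩ := T.exists_median_order htour
  obtain ⟨X, M, Y, rfl, hX, hY⟩ : ∃ X M Y : List V, L = X ++ (M ++ Y) ∧ X.length = k ∧
      Y.length = k := by
    refine ⟨L.take k, (L.drop k).take (L.length - 2 * k), (L.drop k).drop (L.length - 2 * k),
      by simp only [List.take_append_drop], ?_, ?_⟩
    · simp; omega
    · simp; omega
  simp only [List.length_append] at hlen
  simp only [List.nodup_append, List.mem_append] at hnd
  obtain ⟨hXn, ⟨hMn, hYn, hMY⟩, hXMY⟩ := hnd
  have hcard : ∀ p : V → Prop, (M.toFinset.filter p).card = M.countP (fun v => p v) := by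
    intro p
    rw [List.countP_eq_length_filter, ← List.toFinset_card_of_nodup (hMn.filter _),
      List.toFinset_filter]
    simp
  refine ⟨fun i => X[k - 1 - i.1]'(by omega), fun j => Y[j.1]'(by omega), M.toFinset,
    ?_, ?_, ?_, ?_, ?_, ?_, ?_⟩
  · intro i j h
    have := (hXn.getElem_inj_iff).1 h
    ext
    omega
  · intro i j h
    have := (hYn.getElem_inj_iff).1 h
    ext
    omega
  · intro i j
    exact hXMY _ (List.getElem_mem _) _ (.inr (List.getElem_mem _))
  · intro i h
    exact hXMY _ (List.getElem_mem _) _ (.inl (List.mem_toFinset.1 h)) rfl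
  · intro j h
    exact hMY _ (List.mem_toFinset.1 h) _ (List.getElem_mem _) rfl
  · intro i
    rw [hcard]
    dsimp only
    have hi : k - 1 - i.1 < X.length := by omega
    have h := hout X[k - 1 - i.1] (X.take (k - 1 - i.1)) (X.drop (k - 1 - i.1 + 1) ++ M) Y (by
      conv_lhs => rw [← List.take_append_drop (k - 1 - i.1) X, List.drop_eq_getElem_cons hi]
      simp only [List.append_assoc, List.cons_append])
    have h2 := List.countP_le_length (p := fun v => decide (T.Adj X[k - 1 - i.1] v))
      (l := X.drop (k - 1 - i.1 + 1))
    simp only [List.countP_append, List.length_append, List.length_drop] at h h2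
    omega
  · intro j
    rw [hcard]
    dsimp only
    have hj : j.1 < Y.length := by omega
    have h := hin Y[j.1] X (M ++ Y.take j.1) (Y.drop (j.1 + 1)) (by
      conv_lhs => rw [← List.take_append_drop j.1 Y, List.drop_eq_getElem_cons hj]
      simp)
    have h2 := List.countP_le_length (p := fun v => decide (T.Adj v Y[j.1])) (l := Y.take j.1)
    simp only [List.countP_append, List.length_append, List.length_take] at h h2
    omega

/-- `l` is the list of interior vertices of a path from `x` to `y` of length at most `3`
through `M`. -/
def IsShortInterior (G : Digr V) (M : Finset V) (x y : V) (l : List V) : Prop :=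
  (x :: (l ++ [y])).IsChain G.Adj ∧ l.Nodup ∧ l.length ≤ 2 ∧ ∀ v ∈ l, v ∈ M

open Classical in
lemma exists_isShortInterior (T : Digr V)
    (htour : ∀ u v : V, u ≠ v → (T.Adj u v ↔ ¬ T.Adj v u)) {k : ℕ}
    (hK : ∀ X Y : Finset V, Disjoint X Y → X.card = k → Y.card = k →
      ∃ u ∈ X, ∃ v ∈ Y, ¬ T.Adj u v)
    {M U : Finset V} {x y : V} (hx : x ∉ M) (hy : y ∉ M)
    (hA : U.card + k ≤ (M.filter fun v => T.Adj x v).card + 1)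
    (hB : U.card + k ≤ (M.filter fun v => T.Adj v y).card + 1)
    (hAB : 2 * U.card + 2 * k ≤
      (M.filter fun v => T.Adj x v).card + (M.filter fun v => T.Adj v y).card + 1) :
    ∃ l, T.IsShortInterior M x y l ∧ ∀ v ∈ l, v ∉ U := by
  by_contra! hno
  set A := (M.filter fun v => T.Adj x v) \ U with hAdef
  set B := (M.filter fun v => T.Adj v y) \ U with hBdef
  have hAc := Finset.le_card_sdiff U (M.filter fun v => T.Adj x v)
  have hBc := Finset.le_card_sdiff U (M.filter fun v => T.Adj v y)
  rw [← hAdef] at hAc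
  rw [← hBdef] at hBc
  have memA : ∀ a, a ∈ A ↔ (a ∈ M ∧ T.Adj x a) ∧ a ∉ U := by simp [hAdef]
  have memB : ∀ b, b ∈ B ↔ (b ∈ M ∧ T.Adj b y) ∧ b ∉ U := by simp [hBdef]
  have hdisj : Disjoint B A := by
    rw [Finset.disjoint_left]
    intro c hcB hcA
    rw [memA] at hcA
    rw [memB] at hcB
    obtain ⟨v, hv, hvU⟩ := hno [c] ⟨by simp [hcA.1.2, hcB.1.2], by simp, by simp,
      by simp [hcA.1.1]⟩
    simp only [List.mem_singleton] at hv
    exact hcA.2 (hv ▸ hvU)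
  have hBA : ∀ b ∈ B, ∀ a ∈ A, T.Adj b a := by
    intro b hb a ha
    have hne : b ≠ a := fun h => Finset.disjoint_left.1 hdisj hb (h ▸ ha)
    rw [htour b a hne]
    intro hab
    rw [memA] at ha
    rw [memB] at hb
    obtain ⟨v, hv, hvU⟩ := hno [a, b] ⟨by simp [ha.1.2, hb.1.2, hab], by simp [hne.symm],
      by simp, by simp [ha.1.1, hb.1.1]⟩
    simp only [List.mem_cons, List.not_mem_nil, or_false] at hv
    rcases hv with rfl | rfl
    exacts [ha.2 hvU, hb.2 hvU]
  have hyA : y ∉ A := fun h => hy ((memA y).1 h).1.1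
  have hyB : y ∉ B := fun h => hy ((memB y).1 h).1.1
  have hxA : x ∉ A := fun h => hx ((memA x).1 h).1.1
  have hxB : x ∉ B := fun h => hx ((memB x).1 h).1.1
  have main : ∀ P Q : Finset V, Disjoint P Q → (∀ u ∈ P, ∀ v ∈ Q, T.Adj u v) →
      k ≤ P.card → k ≤ Q.card → False := by
    intro P Q hPQ hadj hP hQ
    obtain ⟨P', hP', hP'c⟩ := Finset.exists_subset_card_eq hP
    obtain ⟨Q', hQ', hQ'c⟩ := Finset.exists_subset_card_eq hQ
    obtain ⟨u, hu, v, hv, huv⟩ := hK P' Q' (hPQ.mono hP' hQ') hP'c hQ'c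
    exact huv (hadj u (hP' hu) v (hQ' hv))
  rcases le_or_gt k B.card with hkB | hkB
  · refine main B (insert y A) ?_ ?_ hkB ?_
    · simp [hyB, hdisj]
    · intro b hb v hv
      rcases Finset.mem_insert.1 hv with rfl | hv
      exacts [((memB b).1 hb).1.2, hBA b hb v hv]
    · rw [Finset.card_insert_of_notMem hyA]
      omega
  · refine main (insert x B) A ?_ ?_ ?_ ?_
    · simp [hxA, hdisj]
    · intro b hb v hv
      rcases Finset.mem_insert.1 hb with rfl | hb
      exacts [((memA v).1 hv).1.2, hBA b hb v hv]
    · rw [Finset.card_insert_of_notMem hxB]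
      omega
    · omega

/-- Bounds on the number of pairs of ranks below `k` whose larger entry is at least that of a
given further pair, when both ranks are injective. -/
lemma card_le_of_max_rank_le {α : Type*} [Fintype α] [DecidableEq α] {k : ℕ} {r s : α → Fin k}
    (hr : Function.Injective r) (hs : Function.Injective s) {b : α} {S : Finset α}
    (hb : b ∉ S) (hS : ∀ a ∈ S, max (r b) (s b) ≤ max (r a) (s a)) :
    S.card + 1 + 2 * (max (r b) (s b)).1 ≤ 2 * k ∧ S.card + 2 + (r b).1 + (s b).1 ≤ 2 * k := by
  set w := max (r b) (s b) with hw
  set P := Finset.univ.filter fun a => w ≤ r a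
  set Q := Finset.univ.filter fun a => w ≤ s a
  have hP : P.card ≤ k - w.1 := by
    rw [← Fin.card_Ici]
    exact Finset.card_le_card_of_injOn r (fun a ha => by simpa [P] using ha) hr.injOn
  have hQ : Q.card ≤ k - w.1 := by
    rw [← Fin.card_Ici]
    exact Finset.card_le_card_of_injOn s (fun a ha => by simpa [Q] using ha) hs.injOn
  have hsub : insert b S ⊆ P ∪ Q := by
    intro a ha
    have : w ≤ max (r a) (s a) := by
      rcases Finset.mem_insert.1 ha with rfl | ha
      exacts [le_rfl, hS a ha]
    simpa [P, Q] using this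
  have h1 := Finset.card_le_card hsub
  rw [Finset.card_insert_of_notMem hb] at h1
  have h2 := Finset.card_union_add_card_inter P Q
  have hwk := w.2
  have hrw : (r b).1 ≤ w.1 := le_max_left (r b) (s b)
  have hsw : (s b).1 ≤ w.1 := le_max_right (r b) (s b)
  refine ⟨by omega, ?_⟩
  by_cases heq : r b = s b
  · have hmem : b ∈ P ∩ Q := by simp [P, Q, hw, heq]
    have := Finset.card_pos.2 ⟨b, hmem⟩
    omega
  · have : (r b).1 ≠ (s b).1 := fun h => heq (Fin.ext h)
    omega

open Classical in
/-- The greedy choice of disjoint interiors, treating the pairs of extreme rank first. -/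
lemma exists_disjoint_interiors [Fintype V] (T : Digr V)
    (htour : ∀ u v : V, u ≠ v → (T.Adj u v ↔ ¬ T.Adj v u)) {k : ℕ}
    (hn : 17 * k - 12 ≤ 2 * Fintype.card V)
    (hK : ∀ X Y : Finset V, Disjoint X Y → X.card = k → Y.card = k →
      ∃ u ∈ X, ∃ v ∈ Y, ¬ T.Adj u v)
    {x y : Fin k → V} {M : Finset V} (hx : ∀ i, x i ∉ M) (hy : ∀ j, y j ∉ M)
    (hxM : ∀ i, Fintype.card V ≤ 2 * (M.filter fun v => T.Adj (x i) v).card + 2 * k + i)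
    (hyM : ∀ j, Fintype.card V ≤ 2 * (M.filter fun v => T.Adj v (y j)).card + 2 * k + j)
    {α : Type*} [Fintype α] {r s : α → Fin k}
    (hr : Function.Injective r) (hs : Function.Injective s) :
    ∃ I : α → List V, (∀ a, T.IsShortInterior M (x (r a)) (y (s a)) (I a)) ∧
      ∀ a b, a ≠ b → ∀ v ∈ I a, v ∉ I b := by
  suffices h : ∀ S : Finset α, ∃ I : α → List V,
      (∀ a ∈ S, T.IsShortInterior M (x (r a)) (y (s a)) (I a)) ∧
      ∀ a ∈ S, ∀ b ∈ S, a ≠ b → ∀ v ∈ I a, v ∉ I b by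
    obtain ⟨I, h1, h2⟩ := h Finset.univ
    exact ⟨I, fun a => h1 a (Finset.mem_univ a),
      fun a b => h2 a (Finset.mem_univ a) b (Finset.mem_univ b)⟩
  intro S
  induction S using Finset.induction_on_min_value (fun a => max (r a) (s a)) with
  | empty => exact ⟨fun _ => [], by simp⟩
  | insert b S hb hS ih =>
    obtain ⟨I, hI, hdisj⟩ := ih
    obtain ⟨h1, h2⟩ := card_le_of_max_rank_le hr hs hb hS
    have hrw : (r b).1 ≤ (max (r b) (s b)).1 := le_max_left (r b) (s b)
    have hsw : (s b).1 ≤ (max (r b) (s b)).1 := le_max_right (r b) (s b)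
    have hU : (S.biUnion fun a => (I a).toFinset).card ≤ S.card * 2 :=
      Finset.card_biUnion_le_card_mul _ _ _ fun a ha =>
        (List.toFinset_card_le _).trans (hI a ha).2.2.1
    have hSk : S.card + 1 ≤ k := by
      rw [← Finset.card_insert_of_notMem hb, ← Fintype.card_fin k]
      exact (Finset.card_le_univ _).trans (Fintype.card_le_of_injective r hr)
    have hxb := hxM (r b)
    have hyb := hyM (s b)
    obtain ⟨l, hl, hlU⟩ := T.exists_isShortInterior htour hK
      (U := S.biUnion fun a => (I a).toFinset) (hx (r b)) (hy (s b))
      (by omega) (by omega) (by omega)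
    simp only [Finset.mem_biUnion, List.mem_toFinset, not_exists, not_and] at hlU
    have hne : ∀ a ∈ S, a ≠ b := fun a ha h => hb (h ▸ ha)
    refine ⟨Function.update I b l, ?_, ?_⟩
    · intro a ha
      rcases Finset.mem_insert.1 ha with rfl | ha
      · simpa using hl
      · simpa [hne a ha] using hI a ha
    · intro a ha c hc hac v hva hvc
      rcases Finset.mem_insert.1 ha with rfl | ha
      · rcases Finset.mem_insert.1 hc with rfl | hc
        · exact hac rfl
        · rw [Function.update_self] at hva
          rw [Function.update_of_ne hac.symm] at hvc
          exact hlU v hva c hc hvc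
      · rw [Function.update_of_ne (hne a ha)] at hva
        rcases Finset.mem_insert.1 hc with rfl | hc
        · rw [Function.update_self] at hvc
          exact hlU v hvc a ‹_› hva
        · rw [Function.update_of_ne (hne c hc)] at hvc
          exact hdisj a ha c hc hac v hva hvc

lemma shortAnchorsOn_univ_of_complete (G : Digr V) {X Y : Finset V} (hXY : Disjoint X Y)
    (h : ∀ u ∈ X, ∀ v ∈ Y, G.Adj u v) : G.ShortAnchorsOn Set.univ X Y := by
  have hne : ∀ u ∈ X, ∀ v ∈ Y, u ≠ v := fun u hu v hv huv =>
    Finset.disjoint_left.1 hXY hu (huv ▸ hv)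
  intro e
  refine ⟨fun a => [a.1, (e a).1], fun a => ⟨⟨⟨rfl, rfl, ?_, ?_⟩, by simp⟩, by simp⟩, ?_⟩
  · exact List.isChain_pair.2 (h _ a.2 _ (e a).2)
  · simpa using hne _ a.2 _ (e a).2
  · intro a b hab v hva hvb
    simp only [List.mem_cons, List.not_mem_nil, or_false] at hva hvb
    rcases hva with rfl | rfl <;> rcases hvb with hv | hv
    · exact hab (Subtype.ext hv)
    · exact hne _ a.2 _ (e b).2 hv
    · exact hne _ b.2 _ (e a).2 hv.symm
    · exact hab (e.injective (Subtype.ext hv))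

end Digr

/-- Every tournament on n vertices with 2n ≥ 17k − 12 (i.e.
n ≥ 8.5k − 6) contains two disjoint vertex sets, each of size k, such that one
short anchors the other. -/
theorem tournament_short_anchor_improved {V : Type} [Fintype V] (k : ℕ) (hk : 1 ≤ k)
    (T : Digr V) (htour : ∀ u v : V, u ≠ v → (T.Adj u v ↔ ¬ T.Adj v u))
    (hn : 17 * k - 12 ≤ 2 * Fintype.card V) :
    ∃ X Y : Finset V, Disjoint X Y ∧ X.card = k ∧ Y.card = k ∧
      T.ShortAnchorsOn Set.univ X Y := by
  by_cases hK : ∃ X Y : Finset V, Disjoint X Y ∧ X.card = k ∧ Y.card = k ∧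
      ∀ u ∈ X, ∀ v ∈ Y, T.Adj u v
  · obtain ⟨X, Y, hXY, hX, hY, h⟩ := hK
    exact ⟨X, Y, hXY, hX, hY, T.shortAnchorsOn_univ_of_complete hXY h⟩
  push Not at hK
  obtain ⟨x, y, M, hxi, hyi, hxy, hx, hy, hxM, hyM⟩ :=
    T.exists_ends_of_median_order htour k (by omega)
  refine ⟨Finset.univ.map ⟨x, hxi⟩, Finset.univ.map ⟨y, hyi⟩, ?_, by simp, by simp, ?_⟩
  · rw [Finset.disjoint_left]
    simp only [Finset.mem_map, Finset.mem_univ, true_and, Function.Embedding.coeFn_mk]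
    rintro _ ⟨i, rfl⟩ ⟨j, hj⟩
    exact hxy i j hj.symm
  intro e
  have hr : ∀ a : {v // v ∈ Finset.univ.map ⟨x, hxi⟩}, ∃ i, x i = a.1 := fun a => by
    obtain ⟨i, -, hi⟩ := Finset.mem_map.1 a.2
    exact ⟨i, hi⟩
  have hs : ∀ a : {v // v ∈ Finset.univ.map ⟨x, hxi⟩}, ∃ j, y j = (e a).1 := fun a => by
    obtain ⟨j, -, hj⟩ := Finset.mem_map.1 (e a).2
    exact ⟨j, hj⟩
  choose r hr using hr
  choose s hs using hs
  have hri : Function.Injective r := fun a b h => Subtype.ext (by rw [← hr, ← hr, h])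
  have hsi : Function.Injective s := fun a b h =>
    e.injective (Subtype.ext (by rw [← hs, ← hs, h]))
  obtain ⟨I, hI, hdisj⟩ := T.exists_disjoint_interiors htour hn hK hx hy hxM hyM hri hsi
  refine ⟨fun a => x (r a) :: (I a ++ [y (s a)]), fun a => ?_, fun a b hab v hva hvb => ?_⟩
  · obtain ⟨hchain, hnd, hlen, hM⟩ := hI a
    refine ⟨⟨⟨by simp [hr], ?_, hchain, ?_⟩, by simp⟩, by simpa [Nat.lt_succ_iff] using hlen⟩
    · dsimp only
      rw [← List.cons_append, List.getLast?_concat, hs]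
    · have h1 : x (r a) ∉ I a := fun h => hx _ (hM _ h)
      have h2 : y (s a) ∉ I a := fun h => hy _ (hM _ h)
      rw [List.nodup_cons, List.nodup_append]
      simp only [List.mem_append, List.mem_singleton, not_or, h1, hxy, hnd, List.nodup_singleton,
        true_and, not_false_eq_true]
      rintro u hu v rfl rfl
      exact h2 hu
  · have hMa := (hI a).2.2.2
    have hMb := (hI b).2.2.2
    simp only [List.mem_cons, List.mem_append, List.not_mem_nil, or_false] at hva hvb
    rcases hva with rfl | hva | rfl <;> rcases hvb with hv | hv | hv
    · exact hab (hri (hxi hv))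
    · exact hx _ (hMb _ hv)
    · exact hxy _ _ hv
    · exact hx _ (hv ▸ hMa _ hva)
    · exact hdisj a b hab v hva hv
    · exact hy _ (hv ▸ hMa _ hva)
    · exact hxy _ _ hv.symm
    · exact hy _ (hMb _ hv)
    · exact hab (hsi (hyi hv))
end
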